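/- Let (M,p) be a germ of a generic real-analytic submanifold of ℂ^N which is minimal at p, let M' ⊆ ℂ^{N'} be a generic real-analytic submanifold with p' ∈ M', and fix ℓ ∈ ℕ. Then there exists t₀ ∈ ℕ (depending only on (M,p) and ℓ) such that any two holomorphic maps H₁, H₂ on neighborhoods of p with H₁(p) = H₂(p) = p', H_i(M) ⊆ M' near p, both finitely nondegenerate of order at most ℓ at p, and with ∂^α H₁(p) = ∂^α H₂(p) for all multi-indices α with |α| ≤ t₀, coincide on a neighborhood of p. -/

import Mathlib

open Complex Topology

noncomputable section

/-- `ℂ^n`. -/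
abbrev Cn (n : ℕ) : Type := EuclideanSpace ℂ (Fin n)

/-- `ℝ^m`. -/
abbrev Rm (m : ℕ) : Type := EuclideanSpace ℝ (Fin m)

/-- The vector of `ℂ^n` with entry `c` in the `j`-th coordinate and `0` elsewhere. -/
def cbasis {n : ℕ} (j : Fin n) (c : ℂ) : Cn n := EuclideanSpace.single j c

/-- The `j`-th component of the Wirtinger gradient `∂f(q)` of a real-valued function `f`. -/
def wirtD {n : ℕ} (f : Cn n → ℝ) (q : Cn n) : Fin n → ℂ := fun j =>
  (1 / 2 : ℂ) * ((fderiv ℝ f q (cbasis j 1) : ℂ)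
    - Complex.I * (fderiv ℝ f q (cbasis j Complex.I) : ℂ))

/-- The `j`-th component of `∂̄g(q)` for a complex-valued function `g`. -/
def wirtDBar {n : ℕ} (g : Cn n → ℂ) (q : Cn n) : Fin n → ℂ := fun j =>
  (1 / 2 : ℂ) * (fderiv ℝ g q (cbasis j 1) + Complex.I * fderiv ℝ g q (cbasis j Complex.I))

/-- The `j`-th component of `∂̄f(q)` for a real-valued function `f`. -/
def wirtDBarR {n : ℕ} (f : Cn n → ℝ) (q : Cn n) : Fin n → ℂ := fun j =>
  (1 / 2 : ℂ) * ((fderiv ℝ f q (cbasis j 1) : ℂ)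
    + Complex.I * (fderiv ℝ f q (cbasis j Complex.I) : ℂ))

/-- `M` is a generic real-analytic submanifold of codimension `d` near `p`. -/
def IsGenericAt {n : ℕ} (M : Set (Cn n)) (d : ℕ) (p : Cn n) : Prop :=
  p ∈ M ∧ ∃ (U : Set (Cn n)) (ρ : Cn n → Fin d → ℝ),
    IsOpen U ∧ p ∈ U ∧ (∀ k, AnalyticOnNhd ℝ (fun z => ρ z k) U) ∧
    (M ∩ U = {z | z ∈ U ∧ ∀ k, ρ z k = 0}) ∧
    ∀ q ∈ M ∩ U, LinearIndependent ℂ (fun k : Fin d => wirtD (fun z => ρ z k) q)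

/-- `S` is, near its point `q`, a real-analytic submanifold of (real) dimension `mdim`. -/
def IsRASubmanifoldAt {E : Type*} [NormedAddCommGroup E] [NormedSpace ℝ E]
    (S : Set E) (q : E) (mdim : ℕ) : Prop :=
  ∃ (c : ℕ) (U : Set E) (ρ : E → Fin c → ℝ),
    IsOpen U ∧ q ∈ U ∧ mdim + c = Module.finrank ℝ E ∧
    (∀ k, AnalyticOnNhd ℝ (fun z => ρ z k) U) ∧
    (S ∩ U = {z | z ∈ U ∧ ∀ k, ρ z k = 0}) ∧
    ∀ x ∈ S ∩ U, LinearIndependent ℝ (fun k : Fin c => fderiv ℝ (fun z => ρ z k) x)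

/-- The tangent space of a set at a point: the span of the tangent cone. -/
def tangentSpaceAt {E : Type*} [NormedAddCommGroup E] [NormedSpace ℝ E] (S : Set E) (q : E) :
    Submodule ℝ E := Submodule.span ℝ (tangentConeAt ℝ S q)

/-- Multiplication by `i` on `ℂ^n` as an `ℝ`-linear map. -/
def mulI {n : ℕ} : Cn n →ₗ[ℝ] Cn n :=
  (LinearMap.lsmul ℂ (Cn n) Complex.I).restrictScalars ℝ

/-- `M` (a generic submanifold of codimension `d`, hence of real dimension `2n - d`) is
minimal at `p`: there is no real-analytic submanifold `S ⊆ M` through `p` of strictly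
smaller dimension whose tangent spaces contain the complex tangent spaces of `M`. -/
def IsMinimalAt {n : ℕ} (M : Set (Cn n)) (d : ℕ) (p : Cn n) : Prop :=
  ¬ ∃ (S : Set (Cn n)) (mdim : ℕ), S ⊆ M ∧ p ∈ S ∧ mdim < 2 * n - d ∧
      (∀ q ∈ S, IsRASubmanifoldAt S q mdim) ∧
      ∀ q ∈ S, tangentSpaceAt M q ⊓ (tangentSpaceAt M q).map mulI ≤ tangentSpaceAt S q

/-- A real-analytic CR vector field of `M` near `p`. -/
structure CRVectorField {N : ℕ} (M : Set (Cn N)) (p : Cn N) where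
  coeff : Cn N → Fin N → ℂ
  dom : Set (Cn N)
  isOpen : IsOpen dom
  mem : p ∈ dom
  analytic : ∀ j, AnalyticOnNhd ℝ (fun z => coeff z j) dom
  tangent : ∀ (f : Cn N → ℝ) (U : Set (Cn N)), IsOpen U → p ∈ U → AnalyticOnNhd ℝ f U →
    (∀ z ∈ M ∩ U, f z = 0) →
    ∃ V, IsOpen V ∧ p ∈ V ∧ ∀ z ∈ M ∩ V, (∑ j, coeff z j * wirtDBarR f z j) = 0

/-- Application of a CR vector field to a complex-valued function. -/
def CRVectorField.apply {N : ℕ} {M : Set (Cn N)} {p : Cn N} (L : CRVectorField M p)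
    (g : Cn N → ℂ) : Cn N → ℂ := fun z => ∑ j, L.coeff z j * wirtDBar g z j

/-- Iterated application `L̄₁ ⋯ L̄ₖ g` of a list of CR vector fields. -/
def CRApplyList {N : ℕ} {M : Set (Cn N)} {p : Cn N} (Ls : List (CRVectorField M p))
    (g : Cn N → ℂ) : Cn N → ℂ := Ls.foldr CRVectorField.apply g

/-- `H` is finitely nondegenerate of order at most `ℓ` at `p` (as a map of `M` into `M'`). -/
def FinNondeg {N N' : ℕ} (M : Set (Cn N)) (p : Cn N) (M' : Set (Cn N')) (ℓ : ℕ)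
    (H : Cn N → Cn N') : Prop :=
  Submodule.span ℂ
    { v : Fin N' → ℂ | ∃ (Ls : List (CRVectorField M p)) (ρ' : Cn N' → ℝ) (U' : Set (Cn N')),
        Ls.length ≤ ℓ ∧ IsOpen U' ∧ H p ∈ U' ∧ AnalyticOnNhd ℝ ρ' U' ∧
        (∀ w ∈ M' ∩ U', ρ' w = 0) ∧
        v = fun j => CRApplyList Ls (fun z => wirtD ρ' (H z) j) p } = ⊤

/-- The mapping locus `E_ℓ ⊆ M'`. -/
def MappingLocus {N N' : ℕ} (M : Set (Cn N)) (p : Cn N) (M' : Set (Cn N')) (ℓ : ℕ) :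
    Set (Cn N') :=
  { p' | p' ∈ M' ∧ ∃ (Ω : Set (Cn N)) (H : Cn N → Cn N'),
      IsOpen Ω ∧ p ∈ Ω ∧ DifferentiableOn ℂ H Ω ∧ H p = p' ∧
      (∀ z ∈ M ∩ Ω, H z ∈ M') ∧ FinNondeg M p M' ℓ H }

/-- A semi-analytic subset of a real vector space. -/
def SemiAnalyticSet {E : Type*} [NormedAddCommGroup E] [NormedSpace ℝ E] (A : Set E) : Prop :=
  ∀ x : E, ∃ U : Set E, IsOpen U ∧ x ∈ U ∧
    ∃ (n k : ℕ) (f : Fin n → Fin k → E → ℝ) (iseq : Fin n → Fin k → Bool),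
      (∀ i j, AnalyticOnNhd ℝ (f i j) U) ∧
      A ∩ U = ⋃ i, ⋂ j, {x | x ∈ U ∧ if iseq i j then f i j x = 0 else 0 < f i j x}

/-- `A` is locally semi-analytic along `M'`. -/
def LocallySemiAnalyticOn {E : Type*} [NormedAddCommGroup E] [NormedSpace ℝ E]
    (M' A : Set E) : Prop :=
  ∀ q ∈ M', ∃ U : Set E, IsOpen U ∧ q ∈ U ∧ SemiAnalyticSet (A ∩ U)


/-- The list in which each `i : Fin N` is repeated `α i` times. -/
def multiList (N : ℕ) (α : Fin N → ℕ) : List (Fin N) :=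
  (List.finRange N).flatMap fun i => List.replicate (α i) i

/-- The multi-index partial derivative `∂^α H (p)`. -/
def mderiv {N N' : ℕ} (α : Fin N → ℕ) (H : Cn N → Cn N') (p : Cn N) : Cn N' :=
  iteratedFDeriv ℂ (multiList N α).length H p
    fun j => EuclideanSpace.single ((multiList N α).get j) 1

section part1

/-- weak holomorphy into `C(K,F)` -/
lemma weak_hol {K F : Type} [TopologicalSpace K] [CompactSpace K] [NormedAddCommGroup F]
    [NormedSpace ℂ F] [CompleteSpace F] (G : ℂ → C(K, F)) {U : Set ℂ} (hU : IsOpen U)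
    (hc : ContinuousOn G U) (hd : ∀ k, DifferentiableOn ℂ (fun s => G s k) U) :
    DifferentiableOn ℂ G U := by
  intro c hcU
  obtain ⟨r, hr, hrU⟩ := Metric.nhds_basis_closedBall.mem_iff.1 (hU.mem_nhds hcU)
  lift r to NNReal using hr.le
  have hr' : 0 < r := by exact_mod_cast hr
  have hci : CircleIntegrable G c r :=
    ContinuousOn.circleIntegrable r.2 (hc.mono (Metric.sphere_subset_closedBall.trans hrU))
  have h1 := hasFPowerSeriesOn_cauchy_integral hci hr'
  have h2 : (fun w => (2 * Real.pi * I : ℂ)⁻¹ • ∮ z in C(c, r), (z - w)⁻¹ • G z) =ᶠ[𝓝 c] G := by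
    filter_upwards [Metric.ball_mem_nhds c hr] with w hw
    ext k
    have h3 := (hd k).mono hrU |>.circleIntegral_sub_inv_smul hw
    have hIntg : CircleIntegrable (fun z => (z - w)⁻¹ • G z) c r := by
      have hcc : ContinuousOn (fun z : ℂ => z - w) (Metric.sphere c r) := by fun_prop
      refine ContinuousOn.circleIntegrable r.2 (ContinuousOn.smul (ContinuousOn.inv₀ hcc ?_)
        (hc.mono (Metric.sphere_subset_closedBall.trans hrU)))
      intro x hx h
      rw [sub_eq_zero] at h
      subst h
      simp only [Metric.mem_sphere, Metric.mem_ball] at hx hw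
      linarith
    have h4 : (∮ z in C(c, r), (z - w)⁻¹ • G z) k = ∮ z in C(c, r), (z - w)⁻¹ • G z k := by
      have := ((ContinuousMap.evalCLM ℂ k : C(K, F) →L[ℂ] F)).intervalIntegral_comp_comm hIntg.out
      simp only [circleIntegral]
      simpa using this.symm
    rw [ContinuousMap.smul_apply, h4, h3, smul_smul, inv_mul_cancel₀, one_smul]
    simp [Real.pi_ne_zero]
  exact (h1.analyticAt.congr h2).differentiableAt.differentiableWithinAt

def Osg (E : Type) [NormedAddCommGroup E] [NormedSpace ℂ E] : Prop :=
  ∀ (F : Type) [NormedAddCommGroup F] [NormedSpace ℂ F] [CompleteSpace F] (f : E → F) (c : E)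
    (U : Set E), IsOpen U → c ∈ U → ContinuousOn f U →
    (∀ z ∈ U, ∀ v, DifferentiableAt ℂ (fun s : ℂ => f (z + s • v)) 0) → AnalyticAt ℂ f c

lemma Osg.equiv {E E' : Type} [NormedAddCommGroup E] [NormedSpace ℂ E] [NormedAddCommGroup E']
    [NormedSpace ℂ E'] (h : Osg E) (e : E ≃L[ℂ] E') : Osg E' := by
  intro F _ _ _ f c U hU hc hf hd
  have := h F (f ∘ e) (e.symm c) (e ⁻¹' U) (hU.preimage e.continuous) (by simpa)
    (hf.comp e.continuous.continuousOn (fun x hx => hx)) (by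
      intro z hz v
      have := hd (e z) hz (e v)
      simpa using this)
  have h2 : AnalyticAt ℂ ((f ∘ e) ∘ e.symm) c :=
    AnalyticAt.comp this (e.symm.toContinuousLinearMap.analyticAt c)
  convert h2 using 1
  ext x; simp

/-- gateaux derivative at any point -/
lemma gat {E F : Type} [NormedAddCommGroup E] [NormedSpace ℂ E] [NormedAddCommGroup F]
    [NormedSpace ℂ F] {f : E → F} {U : Set E}
    (hd : ∀ z ∈ U, ∀ v, DifferentiableAt ℂ (fun s : ℂ => f (z + s • v)) 0) (z v : E) (s : ℂ)
    (h : z + s • v ∈ U) : DifferentiableAt ℂ (fun s : ℂ => f (z + s • v)) s := by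
  have h1 := hd _ h v
  have h2 : DifferentiableAt ℂ ((fun t : ℂ => f (z + s • v + t • v)) ∘ (fun t => t - s)) s := by
    refine DifferentiableAt.comp (𝕜 := ℂ) s ?_ (by fun_prop)
    simpa using h1
  convert h2 using 2 with t
  simp [sub_smul]

lemma osg_prod {E : Type} [NormedAddCommGroup E] [NormedSpace ℂ E] (h : Osg E) : Osg (ℂ × E) := by
  intro F _ _ _ f c U hU hc hf hd
  obtain ⟨r, hr, hrU⟩ := Metric.nhds_basis_closedBall.mem_iff.1 (hU.mem_nhds hc)
  obtain ⟨a, b⟩ := c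
  have hmem : ∀ z w, z ∈ Metric.closedBall a r → w ∈ Metric.closedBall b r → (z, w) ∈ U := by
    intro z w hz hw
    apply hrU
    simp only [Metric.mem_closedBall, Prod.dist_eq, max_le_iff] at *
    exact ⟨hz, hw⟩
  let K := Set.Icc (0:ℝ) (2 * Real.pi)
  have hcm : ∀ θ, circleMap a r θ ∈ Metric.closedBall a r := fun θ =>
    circleMap_mem_closedBall a hr.le θ
  have hUo : IsOpen (Metric.ball b r) := Metric.isOpen_ball
  have hcont : ∀ w ∈ Metric.ball b r, Continuous (fun θ : K => f (circleMap a r θ, w)) := by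
    intro w hw
    refine hf.comp_continuous (by fun_prop) (fun θ => hmem _ _ (hcm _) (Metric.ball_subset_closedBall hw))
  classical
  let g : E → C(K, F) := fun w => if hw : w ∈ Metric.ball b r then ⟨_, hcont w hw⟩ else 0
  have gval : ∀ w ∈ Metric.ball b r, ∀ θ : K, g w θ = f (circleMap a r θ, w) := by
    intro w hw θ
    simp only [g, hw, dite_true, ContinuousMap.coe_mk]
  have gc : ContinuousOn g (Metric.ball b r) := by
    rw [continuousOn_iff_continuous_domRestrict]
    apply ContinuousMap.continuous_of_continuous_uncurry
    have : Function.uncurry (fun (x : Metric.ball b r) (y : K) => ((Metric.ball b r).domRestrict g x) y)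
        = fun x => f (circleMap a r x.2, x.1) := by
      ext ⟨x, y⟩
      exact gval x.1 x.2 y
    rw [this]
    exact hf.comp_continuous (by fun_prop) (fun x => hmem _ _ (hcm _) (Metric.ball_subset_closedBall x.1.2))
  have ga : AnalyticAt ℂ g b := by
    refine h _ g b _ hUo (Metric.mem_ball_self hr) gc ?_
    intro w hw v
    let V : Set ℂ := (fun s : ℂ => w + s • v) ⁻¹' Metric.ball b r
    have hV : IsOpen V := hUo.preimage (by fun_prop)
    refine (weak_hol (fun s => g (w + s • v)) hV (gc.comp (by fun_prop) (fun x hx => hx)) ?_).differentiableAt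
      (hV.mem_nhds (by simpa [V] using hw))
    intro θ
    intro s hs
    have h1 : DifferentiableAt ℂ (fun s : ℂ => f ((circleMap a r θ, w) + s • ((0:ℂ), v))) s :=
      gat hd _ _ _ (by
        have := hmem (circleMap a r θ) (w + s • v) (hcm _) (Metric.ball_subset_closedBall hs)
        simpa using this)
    refine (h1.congr_of_eventuallyEq ?_).differentiableWithinAt
    filter_upwards [hV.mem_nhds hs] with t ht
    rw [gval _ ht]
    simp
  -- kernel
  have hne : ∀ z ∈ Metric.ball a r, ∀ θ : ℝ, circleMap a r θ - z ≠ 0 := by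
    intro z hz θ h
    rw [sub_eq_zero] at h
    have := circleMap_mem_sphere a hr.le θ
    rw [h] at this
    simp only [Metric.mem_ball, Metric.mem_sphere] at *
    linarith
  let dm : ℝ → ℂ := deriv (circleMap a r)
  have dmc : Continuous dm := by
    have : dm = fun θ => circleMap 0 r θ * I := by ext θ; simp [dm]
    rw [this]; fun_prop
  have kcont : ∀ z ∈ Metric.ball a r, Continuous (fun θ : K => dm θ * (circleMap a r θ - z)⁻¹) := by
    intro z hz
    exact (dmc.comp continuous_subtype_val).mul (Continuous.inv₀ (by fun_prop) (fun θ => hne z hz θ))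
  let k : ℂ → C(K, ℂ) := fun z => if hz : z ∈ Metric.ball a r then ⟨_, kcont z hz⟩ else 0
  have kval : ∀ z ∈ Metric.ball a r, ∀ θ : K, k z θ = dm θ * (circleMap a r θ - z)⁻¹ := by
    intro z hz θ
    simp only [k, hz, dite_true, ContinuousMap.coe_mk]
  have kc : ContinuousOn k (Metric.ball a r) := by
    rw [continuousOn_iff_continuous_domRestrict]
    apply ContinuousMap.continuous_of_continuous_uncurry
    have : Function.uncurry (fun (x : Metric.ball a r) (y : K) => ((Metric.ball a r).domRestrict k x) y)
        = fun x => dm x.2 * (circleMap a r x.2 - x.1)⁻¹ := by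
      ext ⟨x, y⟩
      exact kval x.1 x.2 y
    rw [this]
    exact (dmc.comp (by fun_prop)).mul (Continuous.inv₀ (by fun_prop) (fun x => hne x.1 x.1.2 x.2))
  have ka : AnalyticAt ℂ k a := by
    refine (weak_hol k Metric.isOpen_ball kc ?_).analyticAt (Metric.ball_mem_nhds a hr)
    intro θ z hz
    have h1 : DifferentiableAt ℂ (fun z => dm θ * (circleMap a r θ - z)⁻¹) z := by
      refine DifferentiableAt.const_mul (DifferentiableAt.inv (by fun_prop) (hne z hz θ)) _
    refine (h1.congr_of_eventuallyEq ?_).differentiableWithinAt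
    filter_upwards [Metric.isOpen_ball.mem_nhds hz] with t ht
    rw [kval _ ht]
  let μ : MeasureTheory.Measure K := MeasureTheory.Measure.comap Subtype.val MeasureTheory.volume
  haveI : MeasureTheory.IsFiniteMeasure μ := by
    refine ⟨?_⟩
    rw [MeasureTheory.Measure.comap_apply _ Subtype.val_injective (fun s hs => MeasurableSet.subtype_image measurableSet_Icc hs) _ MeasurableSet.univ]
    simp only [Set.image_univ, Subtype.range_coe_subtype]
    exact measure_Icc_lt_top
  have hIntg : ∀ φ : C(K, F), MeasureTheory.Integrable φ μ := fun φ =>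
    φ.continuous.integrable_of_hasCompactSupport (HasCompactSupport.of_compactSpace _)
  let mulk : C(K, ℂ) → C(K, F) → C(K, F) := fun k φ => ⟨fun θ => k θ • φ θ, by fun_prop⟩
  let β : C(K, ℂ) →L[ℂ] C(K, F) →L[ℂ] F := LinearMap.mkContinuous₂
    (LinearMap.mk₂ ℂ (fun k φ => ∫ θ, k θ • φ θ ∂μ)
      (by
        intro k k' φ
        simp only [ContinuousMap.add_apply, add_smul]
        exact MeasureTheory.integral_add (hIntg (mulk k φ)) (hIntg (mulk k' φ)))
      (by
        intro c k φ
        simp only [ContinuousMap.smul_apply, smul_assoc]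
        exact MeasureTheory.integral_smul c _)
      (by
        intro k φ φ'
        simp only [ContinuousMap.add_apply, smul_add]
        exact MeasureTheory.integral_add (hIntg (mulk k φ)) (hIntg (mulk k φ')))
      (by
        intro c k φ
        simp only [ContinuousMap.smul_apply, smul_comm _ c]
        exact MeasureTheory.integral_smul c _)) (μ.real Set.univ) (by
      intro k φ
      simp only [LinearMap.mk₂_apply]
      have := MeasureTheory.norm_integral_le_of_norm_le_const (μ := μ) (f := fun θ => k θ • φ θ)
        (C := ‖k‖ * ‖φ‖) (Filter.Eventually.of_forall (fun θ => by
          rw [norm_smul]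
          exact mul_le_mul (k.norm_coe_le_norm θ) (φ.norm_coe_le_norm θ) (norm_nonneg _) (norm_nonneg _)))
      calc _ ≤ _ := this
        _ = _ := by ring)
  have hβ : ∀ k φ, β k φ = ∫ θ, k θ • φ θ ∂μ := fun k φ => rfl
  have key : (fun x : ℂ × E => (2 * Real.pi * I : ℂ)⁻¹ • β (k x.1) (g x.2)) =ᶠ[𝓝 (a, b)] f := by
    filter_upwards [Metric.ball_mem_nhds (a, b) hr] with x hx
    obtain ⟨z, w⟩ := x
    simp only [Metric.mem_ball, Prod.dist_eq, max_lt_iff] at hx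
    obtain ⟨hz, hw⟩ := hx
    have hz' : z ∈ Metric.ball a r := hz
    have hw' : w ∈ Metric.ball b r := hw
    have hdd : DifferentiableOn ℂ (fun z => f (z, w)) (Metric.closedBall a r) := by
      intro z hz
      have h1 : DifferentiableAt ℂ (fun s : ℂ => f ((0, w) + s • ((1:ℂ), (0:E)))) z :=
        gat hd _ _ _ (by
          have := hmem z w hz (Metric.ball_subset_closedBall hw')
          simpa using this)
      refine DifferentiableAt.differentiableWithinAt ?_
      simpa using h1
    have h3 := hdd.circleIntegral_sub_inv_smul hz'
    have h4 : β (k z) (g w) = ∮ y in C(a, r), (y - z)⁻¹ • f (y, w) := by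
      rw [hβ]
      simp only [kval z hz', gval w hw']
      have := MeasureTheory.integral_subtype_comap (μ := MeasureTheory.volume) (s := K) measurableSet_Icc
        (fun θ => (dm θ * (circleMap a r θ - z)⁻¹) • f (circleMap a r θ, w))
      rw [this, circleIntegral, intervalIntegral.integral_of_le (by positivity),
        MeasureTheory.integral_Icc_eq_integral_Ioc]
      simp only [mul_smul]
      rfl
    show (2 * Real.pi * I : ℂ)⁻¹ • β (k z) (g w) = f (z, w)
    rw [h4, h3, smul_smul, inv_mul_cancel₀, one_smul]
    simp [Real.pi_ne_zero]
  refine AnalyticAt.congr ?_ key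
  refine AnalyticAt.fun_const_smul ?_
  have h1 : AnalyticAt ℂ (fun x : ℂ × E => k x.1) (a, b) :=
    AnalyticAt.fun_comp (g := k) (f := Prod.fst) (x := ((a,b) : ℂ × E)) ka analyticAt_fst
  have h2 : AnalyticAt ℂ (fun x : ℂ × E => g x.2) (a, b) :=
    AnalyticAt.fun_comp (g := g) (f := Prod.snd) (x := ((a,b) : ℂ × E)) ga analyticAt_snd
  exact AnalyticAt.comp₂ (h := fun y : C(K, ℂ) × C(K, F) => β y.1 y.2) (β.analyticAt_bilinear _) h1 h2

lemma osg_pi : ∀ m : ℕ, Osg (Fin m → ℂ)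
  | 0 => by
    intro F _ _ _ f c U hU hc hf hd
    have : f = fun _ => f c := by ext x; rw [Subsingleton.elim x c]
    rw [this]; exact analyticAt_const
  | m + 1 => (osg_prod (osg_pi m)).equiv (Fin.consEquivL ℂ (fun _ : Fin (m+1) => ℂ))

lemma osgood {E F : Type} [NormedAddCommGroup E] [NormedSpace ℂ E] [FiniteDimensional ℂ E]
    [NormedAddCommGroup F] [NormedSpace ℂ F] [CompleteSpace F] {f : E → F} {U : Set E}
    (hU : IsOpen U) (hf : DifferentiableOn ℂ f U) : AnalyticOnNhd ℂ f U := by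
  intro c hc
  have e : (Fin (Module.finrank ℂ E) → ℂ) ≃L[ℂ] E :=
    ContinuousLinearEquiv.ofFinrankEq (by simp)
  refine (osg_pi _).equiv e F f c U hU hc hf.continuousOn ?_
  intro z hz v
  have h1 : DifferentiableAt ℂ f (z + (0:ℂ) • v) := by simpa using hf.differentiableAt (hU.mem_nhds hz)
  exact DifferentiableAt.comp (𝕜 := ℂ) (0:ℂ) h1 (by fun_prop)
end part1

section part2

abbrev Bn (N : ℕ) : Type := Cn N × Cn N

/-- coordinatewise conjugation -/
def cj {N : ℕ} : Cn N →L[ℝ] Cn N :=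
  LinearMap.toContinuousLinearMap
    { toFun := fun z => WithLp.toLp 2 (fun i => (starRingEnd ℂ) (z i))
      map_add' := fun x y => by ext i; simp
      map_smul' := fun a x => by ext i; simp }

@[simp] lemma cj_coord {N : ℕ} (z : Cn N) (i : Fin N) : cj z i = (starRingEnd ℂ) (z i) := rfl

@[simp] lemma cj_cj {N : ℕ} (z : Cn N) : cj (cj z) = z := by ext i; simp

@[simp] lemma cj_smul {N : ℕ} (a : ℂ) (z : Cn N) : cj (a • z) = (starRingEnd ℂ) a • cj z := by
  ext i; simp

@[simp] lemma norm_cj {N : ℕ} (z : Cn N) : ‖cj z‖ = ‖z‖ := by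
  simp [EuclideanSpace.norm_eq]

/-- the totally real embedding -/
def iot {N : ℕ} : Cn N →L[ℝ] Bn N := (ContinuousLinearMap.id ℝ (Cn N)).prod cj

lemma iot_apply {N : ℕ} (z : Cn N) : iot z = (z, cj z) := rfl

/-- the involution -/
def sg {N : ℕ} : Bn N →L[ℝ] Bn N :=
  (cj.comp (ContinuousLinearMap.snd ℝ (Cn N) (Cn N))).prod
    (cj.comp (ContinuousLinearMap.fst ℝ (Cn N) (Cn N)))

lemma sg_apply {N : ℕ} (x : Bn N) : sg x = (cj x.2, cj x.1) := rfl

lemma sg_sg {N : ℕ} (x : Bn N) : sg (sg x) = x := by simp [sg_apply]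

lemma sg_smul {N : ℕ} (a : ℂ) (x : Bn N) : sg (a • x) = (starRingEnd ℂ) a • sg x := by
  simp [sg_apply]

lemma norm_sg {N : ℕ} (x : Bn N) : ‖sg x‖ = ‖x‖ := by
  simp [sg_apply, Prod.norm_def, max_comm]

lemma sg_fixed {N : ℕ} {x : Bn N} (h : sg x = x) : x = iot x.1 := by
  have := congrArg Prod.snd h
  simp [sg_apply] at this
  ext1 <;> simp [iot_apply, this]

/-- real coordinates, extended to the complexification -/
def lam {N : ℕ} (i : Fin N × Bool) : Bn N →L[ℂ] ℂ :=
  if i.2 then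
    ((2 * I)⁻¹ : ℂ) • ((EuclideanSpace.proj i.1 : Cn N →L[ℂ] ℂ).comp (ContinuousLinearMap.fst ℂ (Cn N) (Cn N))
      - (EuclideanSpace.proj i.1 : Cn N →L[ℂ] ℂ).comp (ContinuousLinearMap.snd ℂ (Cn N) (Cn N)))
  else
    ((2 : ℂ)⁻¹) • ((EuclideanSpace.proj i.1 : Cn N →L[ℂ] ℂ).comp (ContinuousLinearMap.fst ℂ (Cn N) (Cn N))
      + (EuclideanSpace.proj i.1 : Cn N →L[ℂ] ℂ).comp (ContinuousLinearMap.snd ℂ (Cn N) (Cn N)))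

def bas {N : ℕ} (i : Fin N × Bool) : Cn N := cbasis i.1 (if i.2 then I else 1)

def lamR {N : ℕ} (i : Fin N × Bool) (v : Cn N) : ℝ := if i.2 then (v i.1).im else (v i.1).re

lemma lam_iot {N : ℕ} (i : Fin N × Bool) (v : Cn N) : lam i (iot v) = (lamR i v : ℂ) := by
  rcases i with ⟨i, b⟩
  cases b
  · simp [iot_apply, lam, lamR]
    rw [← mul_add, Complex.add_conj]; push_cast; ring
  · simp [iot_apply, lam, lamR, ]
    rw [Complex.sub_conj]; push_cast
    have := Complex.I_ne_zero
    field_simp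
    simp

lemma sum_bas {N : ℕ} (v : Cn N) : ∑ i : Fin N × Bool, lamR i v • bas i = v := by
  ext j
  rw [Fintype.sum_prod_type]
  simp [lamR, bas, cbasis, Finset.sum_add_distrib]
  simp [Pi.single_apply, Finset.sum_ite_eq]
  rw [add_comm]; exact Complex.re_add_im _

def cpx {N : ℕ} {F : Type} [NormedAddCommGroup F] [NormedSpace ℂ F]
    (q : FormalMultilinearSeries ℝ (Cn N) F) : FormalMultilinearSeries ℂ (Bn N) F :=
  fun n => ∑ i : Fin n → Fin N × Bool,
    ((ContinuousMultilinearMap.mkPiAlgebra ℂ (Fin n) ℂ).compContinuousLinearMap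
      (fun j => lam (i j))).smulRight (q n (fun j => bas (i j)))

lemma cpx_iot {N : ℕ} {F : Type} [NormedAddCommGroup F] [NormedSpace ℂ F]
    (q : FormalMultilinearSeries ℝ (Cn N) F) (n : ℕ) (v : Cn N) :
    cpx q n (fun _ => iot v) = q n (fun _ => v) := by
  conv_rhs => rw [← sum_bas v]
  rw [ContinuousMultilinearMap.map_sum]
  simp only [ContinuousMultilinearMap.map_smul_univ]
  rw [cpx, ContinuousMultilinearMap.sum_apply]
  refine Finset.sum_congr rfl fun i _ => ?_
  simp only [ContinuousMultilinearMap.smulRight_apply,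
    ContinuousMultilinearMap.compContinuousLinearMap_apply,
    ContinuousMultilinearMap.mkPiAlgebra_apply, lam_iot]
  rw [← Complex.ofReal_prod]
  exact Complex.coe_smul _ _

lemma cpx_bound {N : ℕ} {F : Type} [NormedAddCommGroup F] [NormedSpace ℂ F] :
    ∃ K : ℝ, 0 < K ∧ ∀ (q : FormalMultilinearSeries ℝ (Cn N) F) (n : ℕ),
      ‖cpx q n‖ ≤ K ^ n * ‖q n‖ := by
  set Λ : ℝ := 1 + ∑ i : Fin N × Bool, ‖(lam i : Bn N →L[ℂ] ℂ)‖ with hΛ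
  set β : ℝ := 1 + ∑ i : Fin N × Bool, ‖(bas i : Cn N)‖ with hβ
  have hl : ∀ i : Fin N × Bool, ‖(lam i : Bn N →L[ℂ] ℂ)‖ ≤ Λ := fun i => by
    have := Finset.single_le_sum (f := fun i : Fin N × Bool => ‖(lam i : Bn N →L[ℂ] ℂ)‖)
      (fun i _ => norm_nonneg _) (Finset.mem_univ i)
    linarith
  have hb : ∀ i : Fin N × Bool, ‖(bas i : Cn N)‖ ≤ β := fun i => by
    have := Finset.single_le_sum (f := fun i : Fin N × Bool => ‖(bas i : Cn N)‖)
      (fun i _ => norm_nonneg _) (Finset.mem_univ i)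
    linarith
  have hΛ0 : 0 < Λ := by positivity
  have hβ0 : 0 < β := by positivity
  refine ⟨(Fintype.card (Fin N × Bool) + 1) * Λ * β, by positivity, fun q n => ?_⟩
  have hterm : ∀ i : Fin n → Fin N × Bool,
      ‖((ContinuousMultilinearMap.mkPiAlgebra ℂ (Fin n) ℂ).compContinuousLinearMap
      (fun j => lam (i j))).smulRight (q n (fun j => bas (i j)))‖ ≤ Λ ^ n * (‖q n‖ * β ^ n) := by
    intro i
    refine ContinuousMultilinearMap.opNorm_le_bound (by positivity) fun m => ?_
    rw [ContinuousMultilinearMap.smulRight_apply, norm_smul]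
    have h1 : ‖((ContinuousMultilinearMap.mkPiAlgebra ℂ (Fin n) ℂ).compContinuousLinearMap
      (fun j => lam (i j))) m‖ ≤ Λ ^ n * ∏ j, ‖m j‖ := by
      simp only [ContinuousMultilinearMap.compContinuousLinearMap_apply,
        ContinuousMultilinearMap.mkPiAlgebra_apply, norm_prod]
      calc ∏ j, ‖lam (i j) (m j)‖ ≤ ∏ j, Λ * ‖m j‖ := by
            refine Finset.prod_le_prod (fun _ _ => norm_nonneg _) fun j _ => ?_
            exact ((lam (i j)).le_opNorm _).trans (by gcongr; exact hl _)
        _ = _ := by rw [Finset.prod_mul_distrib]; simp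
    have h2 : ‖q n (fun j => bas (i j))‖ ≤ ‖q n‖ * β ^ n := by
      refine ((q n).le_opNorm _).trans ?_
      gcongr
      calc ∏ j, ‖bas (i j)‖ ≤ ∏ j : Fin n, β := by
            refine Finset.prod_le_prod (fun _ _ => norm_nonneg _) fun j _ => hb _
        _ = _ := by simp
    calc _ ≤ (Λ ^ n * ∏ j, ‖m j‖) * (‖q n‖ * β ^ n) := by gcongr
      _ = _ := by ring
  calc ‖cpx q n‖ ≤ ∑ i : Fin n → Fin N × Bool, Λ ^ n * (‖q n‖ * β ^ n) := by
        refine (norm_sum_le _ _).trans (Finset.sum_le_sum fun i _ => hterm i)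
    _ = (Fintype.card (Fin N × Bool) : ℝ) ^ n * (Λ ^ n * (‖q n‖ * β ^ n)) := by
        simp
    _ ≤ ((Fintype.card (Fin N × Bool) : ℝ) + 1) ^ n * (Λ ^ n * (‖q n‖ * β ^ n)) := by
        gcongr; linarith
    _ = _ := by rw [mul_pow, mul_pow]; ring

/-- complexification of a real-analytic germ -/
lemma exists_cpx {N : ℕ} {F : Type} [NormedAddCommGroup F] [NormedSpace ℂ F] [CompleteSpace F]
    {f : Cn N → F} {p : Cn N} (hf : AnalyticAt ℝ f p) :
    ∃ G : Bn N → F, AnalyticAt ℂ G (iot p) ∧ ∀ᶠ q in 𝓝 p, G (iot q) = f q := by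
  obtain ⟨q, r, hq⟩ := hf
  obtain ⟨K, hK, hb⟩ := cpx_bound (N := N) (F := F)
  have hrad : 0 < (cpx q).radius := by
    obtain ⟨s, hs0, hs⟩ := ENNReal.lt_iff_exists_nnreal_btwn.1 hq.radius_pos
    obtain ⟨C, hC, hCb⟩ := q.norm_mul_pow_le_of_lt_radius hs
    have hs0' : (0:ℝ) < s := by exact_mod_cast hs0
    have : (((s : ℝ) / K).toNNReal : ENNReal) ≤ (cpx q).radius := by
      refine (cpx q).le_radius_of_bound C fun n => ?_
      rw [Real.coe_toNNReal _ (by positivity)]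
      calc ‖cpx q n‖ * (s / K) ^ n ≤ (K ^ n * ‖q n‖) * (s / K) ^ n := by gcongr; exact hb q n
        _ = ‖q n‖ * s ^ n := by rw [div_pow]; field_simp
        _ ≤ C := hCb n
    refine lt_of_lt_of_le ?_ this
    simp; positivity
  have hP := (cpx q).hasFPowerSeriesOnBall hrad
  refine ⟨fun x => (cpx q).sum (x - iot p), ?_, ?_⟩
  · have := hP.analyticAt
    refine AnalyticAt.fun_comp (g := (cpx q).sum) (f := fun x => x - iot p) (by simpa using this) (by fun_prop)
  · have h1 : ∀ᶠ y in 𝓝 p, y ∈ Metric.eball p r := Metric.eball_mem_nhds p hq.r_pos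
    filter_upwards [h1] with y hy
    have h2 : HasSum (fun n => q n fun _ => y - p) (f (p + (y - p))) := hq.hasSum (by
      simpa [edist_eq_enorm_sub] using hy)
    rw [add_sub_cancel] at h2
    rw [← h2.tsum_eq, FormalMultilinearSeries.sum, ← map_sub]
    exact tsum_congr fun n => cpx_iot q n _

end part2

section part3

lemma ident_real {N : ℕ} {F : Type} [NormedAddCommGroup F] [NormedSpace ℂ F] [CompleteSpace F]
    {f : Bn N → F} {p : Cn N} (hf : AnalyticAt ℂ f (iot p))
    (h0 : ∀ᶠ q in 𝓝 p, f (iot q) = 0) : ∀ᶠ x in 𝓝 (iot p), f x = 0 := by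
  obtain ⟨r₁, hr₁, h1⟩ := Metric.eventually_nhds_iff_ball.1 hf.eventually_analyticAt
  obtain ⟨r₂, hr₂, h2⟩ := Metric.eventually_nhds_iff_ball.1 h0
  set r := min r₁ r₂
  have hr : 0 < r := lt_min hr₁ hr₂
  rw [Metric.eventually_nhds_iff_ball]
  refine ⟨r / 4, by positivity, fun x hx => ?_⟩
  set y := x - iot p with hy
  have hyn : ‖y‖ < r / 4 := by simpa [hy, dist_eq_norm] using hx
  set a : Bn N := (2⁻¹ : ℂ) • (y + sg y) with ha
  set b : Bn N := ((2 * I)⁻¹ : ℂ) • (y - sg y) with hb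
  have hsa : sg a = a := by
    rw [ha, sg_smul, map_add, sg_sg, add_comm, map_inv₀, map_ofNat]
  have hsb : sg b = b := by
    have : (starRingEnd ℂ) (2 * I)⁻¹ = -(2 * I)⁻¹ := by
      rw [map_inv₀, map_mul, map_ofNat, conj_I, mul_neg, inv_neg]
    rw [hb, sg_smul, map_sub, sg_sg, ← neg_sub, smul_neg, ← neg_smul, this, neg_neg]
  have hab : y = a + I • b := by
    rw [ha, hb, smul_smul]
    have : I * (2 * I)⁻¹ = 2⁻¹ := by
      have := I_ne_zero
      field_simp
    rw [this, ← smul_add, add_add_sub_cancel, ← two_smul ℂ y, smul_smul]; simp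
  have hna : ‖a‖ ≤ ‖y‖ := by
    rw [ha, norm_smul]
    have := norm_add_le y (sg y)
    rw [norm_sg] at this
    simp; linarith
  have hnb : ‖b‖ ≤ ‖y‖ := by
    rw [hb, norm_smul]
    have := norm_sub_le y (sg y)
    rw [norm_sg] at this
    simp; linarith
  clear_value a b
  set g : ℂ → F := fun s => f (iot p + a + s • b) with hg
  have hmem : ∀ s ∈ Metric.ball (0:ℂ) 2, ‖a + s • b‖ < r := by
    intro s hs
    have hs : ‖s‖ < 2 := by simpa using hs
    have : ‖a + s • b‖ ≤ ‖a‖ + ‖s‖ * ‖b‖ := (norm_add_le _ _).trans (by rw [norm_smul s])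
    have : ‖s‖ * ‖b‖ ≤ 2 * ‖y‖ := by gcongr
    linarith
  have hgan : AnalyticOnNhd ℂ g (Metric.ball 0 2) := by
    intro s hs
    refine AnalyticAt.fun_comp (g := f) (f := fun s : ℂ => iot p + a + s • b) ?_ (by fun_prop)
    refine h1 _ ?_
    rw [Metric.mem_ball, dist_eq_norm, add_assoc, add_sub_cancel_left]
    exact (hmem s hs).trans_le (min_le_left _ _)
  have hgre : ∀ t : ℝ, |t| < 2 → g t = 0 := by
    intro t ht
    have hs : ‖a + (t:ℂ) • b‖ < r := hmem t (by simpa using ht)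
    have h3 : a + (t : ℂ) • b = iot (a + (t : ℂ) • b).1 := by
      apply sg_fixed
      rw [map_add, sg_smul, hsa, hsb]; simp
    rw [hg]; simp only
    rw [add_assoc, h3, ← map_add]
    refine h2 _ ?_
    rw [Metric.mem_ball, dist_eq_norm, add_sub_cancel_left]
    exact (norm_fst_le _).trans_lt (hs.trans_le (min_le_right _ _))
  have hfr : ∃ᶠ z in 𝓝[≠] (0:ℂ), g z = 0 := by
    have : Filter.Tendsto (fun n : ℕ => (((1:ℝ) / ((n:ℝ) + 1) : ℝ) : ℂ)) Filter.atTop (𝓝[≠] (0:ℂ)) := by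
      refine tendsto_nhdsWithin_iff.2 ⟨?_, ?_⟩
      · have := (Complex.continuous_ofReal.tendsto 0).comp (tendsto_one_div_add_atTop_nhds_zero_nat (𝕜 := ℝ))
        simpa [Function.comp_def] using this
      · refine Filter.Eventually.of_forall fun n => ?_
        simp only [Set.mem_compl_iff, Set.mem_singleton_iff, Complex.ofReal_eq_zero]
        positivity
    refine this.frequently (Filter.Frequently.of_forall fun n => hgre _ ?_)
    rw [abs_of_pos (by positivity), div_lt_iff₀ (by positivity)]
    have : (0:ℝ) ≤ n := by positivity
    linarith
  have := hgan.eqOn_zero_of_preconnected_of_frequently_eq_zero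
    (convex_ball (0:ℂ) 2).isPreconnected (by simp) hfr
  have hI := this (x := I) (by simp)
  have hx' : x = iot p + a + I • b := by rw [add_assoc, ← hab, hy]; simp
  rw [hx']; exact hI

lemma analyticAt_of_diff {E F : Type} [NormedAddCommGroup E] [NormedSpace ℂ E]
    [FiniteDimensional ℂ E] [NormedAddCommGroup F] [NormedSpace ℂ F] [CompleteSpace F]
    {f : E → F} {x : E} (h : ∀ᶠ y in 𝓝 x, DifferentiableAt ℂ f y) : AnalyticAt ℂ f x := by
  obtain ⟨r, hr, h1⟩ := Metric.eventually_nhds_iff_ball.1 h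
  exact osgood Metric.isOpen_ball (fun y hy => (h1 y hy).differentiableWithinAt) x
    (Metric.mem_ball_self hr)

/-- conjugating an analytic map by conjugate-linear maps -/
lemma analyticAt_conj {E E' F F' : Type} [NormedAddCommGroup E] [NormedSpace ℂ E]
    [FiniteDimensional ℂ E] [NormedAddCommGroup F] [NormedSpace ℂ F] [CompleteSpace F]
    [NormedAddCommGroup E'] [NormedSpace ℂ E'] [NormedAddCommGroup F'] [NormedSpace ℂ F']
    [CompleteSpace F']
    {f : E' → F} {x : E} (a : E →L[ℝ] E') (b : F →L[ℝ] F')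
    (ha : ∀ (s : ℂ) x, a (s • x) = (starRingEnd ℂ) s • a x)
    (hb : ∀ (s : ℂ) x, b (s • x) = (starRingEnd ℂ) s • b x)
    (hf : AnalyticAt ℂ f (a x)) : AnalyticAt ℂ (fun y => b (f (a y))) x := by
  apply analyticAt_of_diff
  have h1 : ∀ᶠ y in 𝓝 x, AnalyticAt ℂ f (a y) :=
    a.continuous.continuousAt.eventually hf.eventually_analyticAt
  filter_upwards [h1] with y hy
  set L := fderiv ℂ f (a y) with hL
  have h2 : HasFDerivAt (fun y => b (f (a y))) (b.comp ((L.restrictScalars ℝ).comp a)) y :=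
    b.hasFDerivAt.comp y ((hy.differentiableAt.hasFDerivAt.restrictScalars ℝ).comp y a.hasFDerivAt)
  let T : E →L[ℂ] F' :=
    { toFun := fun v => b (L (a v))
      map_add' := fun u v => by simp
      map_smul' := fun s v => by simp [ha, hb]
      cont := by fun_prop }
  exact (hasFDerivAt_of_restrictScalars ℝ (f' := T) h2 (by ext; rfl)).differentiableAt

end part3

section part4

/-- local retraction onto a zero set -/
lemma retraction {E G : Type} [NormedAddCommGroup E] [NormedSpace ℂ E] [CompleteSpace E]
    [NormedAddCommGroup G] [NormedSpace ℂ G] [CompleteSpace G]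
    {R : E → G} {x0 : E} (hR : AnalyticAt ℂ R x0) (h0 : R x0 = 0) (D : G →L[ℂ] E)
    (hD : ∀ μ, fderiv ℂ R x0 (D μ) = μ) :
    ∃ l : E → G, AnalyticAt ℂ l x0 ∧ l x0 = 0 ∧ (∀ᶠ x in 𝓝 x0, R (x + D (l x)) = 0) ∧
      (∀ᶠ y in 𝓝 ((x0, 0) : E × G), R (y.1 + D y.2) = 0 → l y.1 = y.2) ∧
      (∀ᶠ x in 𝓝 x0, R x = 0 → l x = 0) ∧
      ∀ᶠ x in 𝓝 x0, R x = 0 → ∀ v, fderiv ℂ R x v = 0 → fderiv ℂ l x v = 0 := by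
  set f : E × G → G := fun y => R (y.1 + D y.2) with hf
  have hfan : AnalyticAt ℂ f (x0, 0) := by
    refine AnalyticAt.fun_comp (g := R) (f := fun y : E × G => y.1 + D y.2) (by simpa using hR) ?_
    exact (ContinuousLinearMap.fst ℂ E G + D.comp (ContinuousLinearMap.snd ℂ E G)).analyticAt _
  have cdf : ContDiffAt ℂ (⊤ : WithTop ℕ∞) f (x0, 0) := hfan.contDiffAt
  have hfd : HasFDerivAt f ((fderiv ℂ R x0).comp
      (ContinuousLinearMap.fst ℂ E G + D.comp (ContinuousLinearMap.snd ℂ E G))) (x0, 0) := by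
    refine HasFDerivAt.comp (g := R) (x0, (0:G)) ?_ ?_
    · simpa using hR.differentiableAt.hasFDerivAt
    · exact (ContinuousLinearMap.fst ℂ E G + D.comp (ContinuousLinearMap.snd ℂ E G)).hasFDerivAt
  have hinv : (fderiv ℂ f (x0, 0) ∘L .inr ℂ E G).IsInvertible := by
    have : (fderiv ℂ f (x0, 0) ∘L .inr ℂ E G) = (ContinuousLinearEquiv.refl ℂ G : G →L[ℂ] G) := by
      rw [hfd.fderiv]; ext μ; simp [hD]
    rw [this]; exact ContinuousLinearMap.isInvertible_equiv
  have hn : (⊤ : WithTop ℕ∞) ≠ 0 := by simp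
  set l := cdf.implicitFunction hn hinv with hl
  have hl0 : l x0 = 0 := cdf.implicitFunction_apply_self hn hinv
  have hlan : AnalyticAt ℂ l x0 := (cdf.contDiffAt_implicitFunction hn hinv).analyticAt
  have h1 := cdf.eventually_apply_implicitFunction hn hinv
  have h2 := cdf.eventually_apply_eq_iff_implicitFunction hn hinv
  have hf0 : f (x0, 0) = 0 := by simp [hf, h0]
  rw [hf0] at h1 h2
  have h1' : ∀ᶠ x in 𝓝 x0, R (x + D (l x)) = 0 := h1
  have h2' : ∀ᶠ y in 𝓝 ((x0, 0) : E × G), R (y.1 + D y.2) = 0 → l y.1 = y.2 := by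
    filter_upwards [h2] with y hy using hy.1
  have h3 : ∀ᶠ x in 𝓝 x0, R x = 0 → l x = 0 := by
    have hc : Filter.Tendsto (fun x : E => (x, (0:G))) (𝓝 x0) (𝓝 (x0, 0)) :=
      Continuous.tendsto (by fun_prop) _
    filter_upwards [hc.eventually h2'] with x hx h
    exact hx (by simpa using h)
  refine ⟨l, hlan, hl0, h1', h2', h3, ?_⟩
  have h4 : ∀ᶠ x in 𝓝 x0, ‖(fderiv ℂ R x).comp D - ContinuousLinearMap.id ℂ G‖ < 1 := by
    have hc : ContinuousAt (fun x => ‖(fderiv ℂ R x).comp D - ContinuousLinearMap.id ℂ G‖) x0 := by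
      have := hR.fderiv.continuousAt
      fun_prop
    have : (fderiv ℂ R x0).comp D = ContinuousLinearMap.id ℂ G := by ext μ; simp [hD]
    exact hc.eventually_lt continuousAt_const (by simp [this])
  filter_upwards [h4, h3, h1'.eventually_nhds, hlan.eventually_analyticAt, hR.eventually_analyticAt]
    with x hx4 hx3 hx1 hxl hxR hx v hv
  have hlx := hx3 hx
  have hd : HasFDerivAt (fun x => R (x + D (l x)))
      ((fderiv ℂ R x).comp (ContinuousLinearMap.id ℂ E + D.comp (fderiv ℂ l x))) x := by
    refine HasFDerivAt.comp (g := R) x ?_ ?_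
    · simpa [hlx] using hxR.differentiableAt.hasFDerivAt
    · exact (hasFDerivAt_id x).add (D.hasFDerivAt.comp x hxl.differentiableAt.hasFDerivAt)
  have hd0 : HasFDerivAt (fun x => R (x + D (l x))) (0 : E →L[ℂ] G) x :=
    (hasFDerivAt_const (0:G) x).congr_of_eventuallyEq hx1
  have h5 := congrArg (fun L : E →L[ℂ] G => L v) (hd.unique hd0)
  simp [hv] at h5
  set μ := fderiv ℂ l x v
  have h6 := ((fderiv ℂ R x).comp D - ContinuousLinearMap.id ℂ G).le_opNorm μ
  simp [h5] at h6
  by_contra hμ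
  have : 0 < ‖μ‖ := norm_pos_iff.2 hμ
  nlinarith

/-- conjugation on `ℂ^d` -/
def cjd {d : ℕ} : (Fin d → ℂ) →L[ℝ] (Fin d → ℂ) :=
  LinearMap.toContinuousLinearMap
    { toFun := fun z i => (starRingEnd ℂ) (z i)
      map_add' := fun x y => by ext i; simp
      map_smul' := fun a x => by ext i; simp }

@[simp] lemma cjd_apply {d : ℕ} (z : Fin d → ℂ) (i : Fin d) : cjd z i = (starRingEnd ℂ) (z i) := rfl

@[simp] lemma cjd_cjd {d : ℕ} (z : Fin d → ℂ) : cjd (cjd z) = z := by ext i; simp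

@[simp] lemma cjd_smul {d : ℕ} (a : ℂ) (z : Fin d → ℂ) : cjd (a • z) = (starRingEnd ℂ) a • cjd z := by
  ext i; simp

lemma sg_iot {N : ℕ} (q : Cn N) : sg (iot q) = iot q := by simp [sg_apply, iot_apply]

/-- real derivative of a restricted complexification -/
lemma fderiv_iot {N : ℕ} {F : Type} [NormedAddCommGroup F] [NormedSpace ℂ F]
    {G : Bn N → F} {z : Cn N} (hG : DifferentiableAt ℂ G (iot z)) (v : Cn N) :
    fderiv ℝ (fun q => G (iot q)) z v = fderiv ℂ G (iot z) (iot v) := by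
  have : HasFDerivAt (fun q => G (iot q)) (((fderiv ℂ G (iot z)).restrictScalars ℝ).comp iot) z :=
    (hG.hasFDerivAt.restrictScalars ℝ).comp z iot.hasFDerivAt
  rw [this.fderiv]; rfl

lemma inl_eq {N : ℕ} (v : Cn N) :
    ((v, 0) : Bn N) = (1/2 : ℂ) • (iot v - I • iot (I • v)) := by
  ext i <;> simp [iot_apply]
  all_goals (try ring_nf)
  all_goals (try simp)
  all_goals (try ring)

lemma inr_eq {N : ℕ} (v : Cn N) :
    ((0, cj v) : Bn N) = (1/2 : ℂ) • (iot v + I • iot (I • v)) := by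
  ext i <;> simp [iot_apply]
  all_goals (try ring_nf)
  all_goals (try simp)
  all_goals (try ring)

lemma cbasis_I {N : ℕ} (j : Fin N) : (cbasis j I : Cn N) = I • cbasis j 1 := by
  ext i; simp [cbasis, Pi.single_apply]

lemma cj_cbasis {N : ℕ} (j : Fin N) : cj (cbasis j 1 : Cn N) = cbasis j 1 := by
  ext i; simp [cbasis, Pi.single_apply]

lemma fderiv_ofReal_comp {N : ℕ} {f : Cn N → ℝ} {z : Cn N} (hf : DifferentiableAt ℝ f z)
    (v : Cn N) : fderiv ℝ (fun q => (f q : ℂ)) z v = (fderiv ℝ f z v : ℂ) := by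
  have : HasFDerivAt (fun q => (f q : ℂ)) (Complex.ofRealCLM.comp (fderiv ℝ f z)) z :=
    Complex.ofRealCLM.hasFDerivAt.comp z hf.hasFDerivAt
  rw [this.fderiv]; rfl

lemma wirtDBar_iot {N : ℕ} {G : Bn N → ℂ} {g : Cn N → ℂ} {z : Cn N}
    (hG : DifferentiableAt ℂ G (iot z))
    (hg : ∀ᶠ q in 𝓝 z, G (iot q) = g q) (j : Fin N) :
    wirtDBar g z j = fderiv ℂ G (iot z) (0, cbasis j 1) := by
  have he : fderiv ℝ g z = fderiv ℝ (fun q => G (iot q)) z :=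
    Filter.EventuallyEq.fderiv_eq (by filter_upwards [hg] with q hq using hq.symm)
  rw [← cj_cbasis j, inr_eq, ← cbasis_I, map_smul, map_add, map_smul, wirtDBar, he,
    fderiv_iot hG, fderiv_iot hG]
  simp [smul_eq_mul]

lemma wirtDBarR_iot {N : ℕ} {G : Bn N → ℂ} {g : Cn N → ℝ} {z : Cn N}
    (hG : DifferentiableAt ℂ G (iot z)) (hgd : DifferentiableAt ℝ g z)
    (hg : ∀ᶠ q in 𝓝 z, G (iot q) = (g q : ℂ)) (j : Fin N) :
    wirtDBarR g z j = fderiv ℂ G (iot z) (0, cbasis j 1) := by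
  rw [← wirtDBar_iot hG hg, wirtDBarR, wirtDBar, fderiv_ofReal_comp hgd, fderiv_ofReal_comp hgd]

lemma wirtD_iot {N : ℕ} {G : Bn N → ℂ} {g : Cn N → ℝ} {z : Cn N}
    (hG : DifferentiableAt ℂ G (iot z)) (hgd : DifferentiableAt ℝ g z)
    (hg : ∀ᶠ q in 𝓝 z, G (iot q) = (g q : ℂ)) (j : Fin N) :
    wirtD g z j = fderiv ℂ G (iot z) (cbasis j 1, 0) := by
  have he : fderiv ℝ (fun q => (g q : ℂ)) z = fderiv ℝ (fun q => G (iot q)) z :=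
    Filter.EventuallyEq.fderiv_eq (by filter_upwards [hg] with q hq using hq.symm)
  rw [inl_eq, ← cbasis_I, map_smul, map_sub, map_smul, wirtD, ← fderiv_ofReal_comp hgd,
    ← fderiv_ofReal_comp hgd, he, fderiv_iot hG, fderiv_iot hG]
  simp [smul_eq_mul]

end part4

section part5

def ilC {d N : ℕ} (D : (Fin d → ℂ) →L[ℂ] Cn N) : (Fin d → ℂ) →L[ℂ] Bn N :=
  (ContinuousLinearMap.inl ℂ (Cn N) (Cn N)).comp D

@[simp] lemma ilC_apply {d N : ℕ} (D : (Fin d → ℂ) →L[ℂ] Cn N) (μ : Fin d → ℂ) :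
    ilC D μ = (D μ, 0) := rfl

/-- the complexified data of a generic submanifold near `p` -/
structure Geo (N d : ℕ) (M : Set (Cn N)) (p : Cn N) where
  R : Bn N → (Fin d → ℂ)
  an : AnalyticAt ℂ R (iot p)
  sym : ∀ᶠ x in 𝓝 (iot p), R (sg x) = cjd (R x)
  mem : p ∈ M
  loc : ∀ᶠ q in 𝓝 p, (q ∈ M ↔ R (iot q) = 0)
  D : (Fin d → ℂ) →L[ℂ] Cn N
  hD : ∀ μ, fderiv ℂ R (iot p) (D μ, 0) = μ
  l : Bn N → (Fin d → ℂ)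
  l_an : AnalyticAt ℂ l (iot p)
  l_zero : l (iot p) = 0
  l_R : ∀ᶠ x in 𝓝 (iot p), R (x + (D (l x), 0)) = 0
  l_uniq : ∀ᶠ y in 𝓝 ((iot p, 0) : Bn N × (Fin d → ℂ)), R (y.1 + (D y.2, 0)) = 0 → l y.1 = y.2
  l_id : ∀ᶠ x in 𝓝 (iot p), R x = 0 → l x = 0
  l_der : ∀ᶠ x in 𝓝 (iot p), R x = 0 → ∀ v, fderiv ℂ R x v = 0 → fderiv ℂ l x v = 0

lemma exists_geo {N d : ℕ} {M : Set (Cn N)} {p : Cn N} (hM : IsGenericAt M d p) :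
    Nonempty (Geo N d M p) := by
  obtain ⟨hpM, U, ρ, hU, hpU, hρ, hMU, hli⟩ := hM
  have hex : ∀ k, ∃ G : Bn N → ℂ, AnalyticAt ℂ G (iot p) ∧
      ∀ᶠ q in 𝓝 p, G (iot q) = (ρ q k : ℂ) := fun k =>
    exists_cpx (f := fun q => (ρ q k : ℂ))
      ((Complex.ofRealCLM.analyticAt _).fun_comp (hρ k p hpU))
  choose G hGan hG using hex
  set R : Bn N → (Fin d → ℂ) := fun x k => G k x with hR
  have hRan : AnalyticAt ℂ R (iot p) := AnalyticAt.pi hGan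
  have hRι : ∀ᶠ q in 𝓝 p, ∀ k, R (iot q) k = (ρ q k : ℂ) := Filter.eventually_all.2 hG
  have hsym : ∀ᶠ x in 𝓝 (iot p), R (sg x) = cjd (R x) := by
    have h1 : AnalyticAt ℂ (fun x => cjd (R (sg x)) - R x) (iot p) :=
      (analyticAt_conj sg cjd sg_smul cjd_smul (by rwa [sg_iot])).sub hRan
    have h2 := ident_real h1 (by
      filter_upwards [hRι] with q hq
      rw [sg_iot, sub_eq_zero]
      ext k; rw [cjd_apply, hq]; simp)
    filter_upwards [h2] with x hx
    rw [← sub_eq_zero.1 hx, cjd_cjd]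
  have hloc : ∀ᶠ q in 𝓝 p, (q ∈ M ↔ R (iot q) = 0) := by
    filter_upwards [hRι, hU.mem_nhds hpU] with q hq hqU
    have : q ∈ M ∩ U ↔ q ∈ {z | z ∈ U ∧ ∀ k, ρ z k = 0} := by rw [hMU]
    simp only [Set.mem_inter_iff, hqU, and_true, Set.mem_setOf_eq, true_and] at this
    rw [this, funext_iff]
    refine forall_congr' fun k => ?_
    rw [hq]; simp
  -- surjectivity
  set T : Cn N →L[ℂ] (Fin d → ℂ) := (fderiv ℂ R (iot p)).comp (ContinuousLinearMap.inl ℂ _ _) with hT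
  have hTk : ∀ k v, T v k = fderiv ℂ (G k) (iot p) (v, 0) := by
    intro k v
    rw [hT, hR, fderiv_pi (fun k => (hGan k).differentiableAt)]
    rfl
  have hTb : ∀ k j, T (cbasis j 1) k = wirtD (fun z => ρ z k) p j := by
    intro k j
    rw [hTk, wirtD_iot (hGan k).differentiableAt (hρ k p hpU).differentiableAt (hG k)]
  have hsurj : Function.Surjective T := by
    rw [← ContinuousLinearMap.coe_coe, ← LinearMap.range_eq_top]
    by_contra hne
    obtain ⟨f, hf0, hf⟩ := Submodule.exists_le_ker_of_lt_top _ (lt_top_iff_ne_top.2 hne)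
    have hfs : ∀ v, f v = ∑ k, v k * f (Pi.single k 1) := fun v => by
      conv_lhs => rw [pi_eq_sum_univ' v]
      simp
    have hz := Fintype.linearIndependent_iff.1 (hli p ⟨hpM, hpU⟩) (fun k => f (Pi.single k 1)) (by
      ext j
      have h1 : f (T (cbasis j 1)) = 0 := hf ⟨cbasis j 1, rfl⟩
      rw [hfs] at h1
      simp only [Finset.sum_apply, Pi.smul_apply, smul_eq_mul, Pi.zero_apply]
      rw [← h1]
      exact Finset.sum_congr rfl fun k _ => by rw [hTb, mul_comm])
    apply hf0
    ext k
    simpa using hz k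
  obtain ⟨D, hD⟩ := T.exists_rightInverse_of_surjective (LinearMap.range_eq_top.2 hsurj)
  have hD' : ∀ μ, fderiv ℂ R (iot p) (D μ, 0) = μ := fun μ =>
    congrArg (fun L : (Fin d → ℂ) →L[ℂ] (Fin d → ℂ) => L μ) hD
  have hR0 : R (iot p) = 0 := hloc.self_of_nhds.1 hpM
  obtain ⟨l, h1, h2, h3, h4, h5, h6⟩ := retraction hRan hR0 (ilC D) (by simpa using hD')
  exact ⟨⟨R, hRan, hsym, hpM, hloc, D, hD', l, h1, h2, h3, h4, h5, h6⟩⟩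

namespace Geo

variable {N d : ℕ} {M : Set (Cn N)} {p : Cn N} (g : Geo N d M p)

lemma R0 : g.R (iot p) = 0 := g.loc.self_of_nhds.1 g.mem

/-- the map `sg` preserves neighbourhoods of `iot p` -/
lemma tendsto_sg : Filter.Tendsto (sg : Bn N → Bn N) (𝓝 (iot p)) (𝓝 (iot p)) := by
  have := (sg : Bn N →L[ℝ] Bn N).continuous.tendsto (iot p)
  rwa [sg_iot] at this

lemma fderiv_sym {F : Type} [NormedAddCommGroup F] [NormedSpace ℂ F] {f : Bn N → F}
    {h : Bn N → F}
    (b : F →L[ℝ] F) {x : Bn N} (hx : DifferentiableAt ℂ f x) (hx' : DifferentiableAt ℂ h (sg x))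
    (hs : ∀ᶠ y in 𝓝 x, h (sg y) = b (f y)) (v : Bn N) :
    fderiv ℂ h (sg x) (sg v) = b (fderiv ℂ f x v) := by
  have h1 : HasFDerivAt (fun y => h (sg y)) (((fderiv ℂ h (sg x)).restrictScalars ℝ).comp sg) x :=
    (hx'.hasFDerivAt.restrictScalars ℝ).comp x sg.hasFDerivAt
  have h2 : HasFDerivAt (fun y => b (f y)) (b.comp ((fderiv ℂ f x).restrictScalars ℝ)) x :=
    b.hasFDerivAt.comp x (hx.hasFDerivAt.restrictScalars ℝ)
  have h3 := h1.unique (h2.congr_of_eventuallyEq hs)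
  exact congrArg (fun L : Bn N →L[ℝ] F => L v) h3

lemma fderiv_R_sg : ∀ᶠ x in 𝓝 (iot p), ∀ v, fderiv ℂ g.R (sg x) (sg v) = cjd (fderiv ℂ g.R x v) := by
  filter_upwards [g.sym.eventually_nhds, g.an.eventually_analyticAt,
    tendsto_sg.eventually g.an.eventually_analyticAt] with x h1 h2 h3 v
  exact fderiv_sym cjd h2.differentiableAt h3.differentiableAt h1 v

/-- identity principle on the complexification of `M` -/
lemma ident {F : Type} [NormedAddCommGroup F] [NormedSpace ℂ F] [CompleteSpace F] {f : Bn N → F}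
    (hf : AnalyticAt ℂ f (iot p)) (h0 : ∀ᶠ q in 𝓝 p, q ∈ M → f (iot q) = 0) :
    ∀ᶠ x in 𝓝 (iot p), g.R x = 0 → f x = 0 := by
  set σD : (Fin d → ℂ) →L[ℂ] Bn N :=
    LinearMap.toContinuousLinearMap
    { toFun := fun μ => sg ((g.D (cjd μ), 0) : Bn N)
      map_add' := fun a b => by rw [← map_add, map_add, map_add]; simp
      map_smul' := fun a b => by simp [sg_apply] } with hσD
  have hσDa : ∀ μ, σD μ = sg ((g.D (cjd μ), 0) : Bn N) := fun μ => rfl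
  set DB : (Fin d → ℂ) →L[ℂ] Bn N := (2⁻¹ : ℂ) • (ilC g.D + σD) with hDB
  have hDBa : ∀ μ, DB μ = (2⁻¹ : ℂ) • (((g.D μ, 0) : Bn N) + sg ((g.D (cjd μ), 0) : Bn N)) :=
    fun μ => rfl
  have hDBs : ∀ μ, sg (DB μ) = DB (cjd μ) := by
    intro μ
    rw [hDBa, hDBa, sg_smul, map_add, sg_sg, map_inv₀, map_ofNat, cjd_cjd, add_comm]
  have hDBd : ∀ μ, fderiv ℂ g.R (iot p) (DB μ) = μ := by
    intro μ
    have := g.fderiv_R_sg.self_of_nhds (g.D (cjd μ), 0)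
    rw [sg_iot, g.hD, cjd_cjd] at this
    rw [hDBa, map_smul, map_add, g.hD, this, ← two_smul ℂ μ, smul_smul]
    simp
  obtain ⟨l, h1, h2, h3, h4, h5, -⟩ := retraction g.an g.R0 DB hDBd
  set Ψ : Bn N → Bn N := fun x => x + DB (l x) with hΨ
  have hΨan : AnalyticAt ℂ Ψ (iot p) :=
    analyticAt_id.add ((DB.analyticAt _).fun_comp h1)
  have hΨ0 : Ψ (iot p) = iot p := by simp [hΨ, h2]
  have hι : Filter.Tendsto (iot : Cn N → Bn N) (𝓝 p) (𝓝 (iot p)) := iot.continuous.tendsto p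
  have hreal : ∀ᶠ q in 𝓝 p, f (Ψ (iot q)) = 0 := by
    have ht : Filter.Tendsto (fun x => ((x, cjd (l x)) : Bn N × (Fin d → ℂ))) (𝓝 (iot p)) (𝓝 (iot p, 0)) := by
      have : ContinuousAt (fun x => ((x, cjd (l x)) : Bn N × (Fin d → ℂ))) (iot p) := by
        have := h1.continuousAt
        fun_prop
      simpa [ContinuousAt, h2] using this
    have hq' : Filter.Tendsto (fun q => (Ψ (iot q)).1) (𝓝 p) (𝓝 p) := by
      have : ContinuousAt Ψ (iot p) := hΨan.continuousAt
      have h := this.tendsto.comp hι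
      rw [hΨ0] at h
      exact (continuous_fst.tendsto _).comp h
    have hΨt : Filter.Tendsto Ψ (𝓝 (iot p)) (𝓝 (iot p)) := by
      have := hΨan.continuousAt.tendsto
      rwa [hΨ0] at this
    filter_upwards [hι.eventually (ht.eventually h4), hι.eventually h3, hq'.eventually h0, hq'.eventually g.loc,
      hι.eventually (hΨt.eventually g.sym)]
      with q e1 e2 e3 e4 e5
    have hs : sg (Ψ (iot q)) = iot q + DB (cjd (l (iot q))) := by
      rw [hΨ]; simp only; rw [map_add, sg_iot, hDBs]
    have hl : l (iot q) = cjd (l (iot q)) := e1 (by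
      rw [← hs, e5, hΨ]; simp only; rw [e2]; simp)
    have hfix : sg (Ψ (iot q)) = Ψ (iot q) := by
      rw [hs, ← hl]
    rw [sg_fixed hfix]
    refine e3 (e4.2 ?_)
    rw [← sg_fixed hfix]; exact e2
  have := ident_real (f := fun x => f (Ψ x)) (AnalyticAt.fun_comp (by rwa [hΨ0]) hΨan) hreal
  filter_upwards [this, h5] with x e1 e2 hx
  rw [← e1, hΨ]; simp [e2 hx]

end Geo
end part5

section part6
open Filter

namespace Geo

variable {N d : ℕ} {M : Set (Cn N)} {p : Cn N} (g : Geo N d M p)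

lemma add00 (x : Bn N) : x + ((0, 0) : Bn N) = x := add_zero x

/-- retraction along `Z` -/
def Ps (x : Bn N) : Bn N := x + (g.D (g.l x), 0)

lemma Ps_snd (x : Bn N) : (g.Ps x).2 = x.2 := by simp [Ps]

lemma Ps_an : AnalyticAt ℂ g.Ps (iot p) :=
  analyticAt_id.add (((ilC g.D).analyticAt _).fun_comp g.l_an)

lemma Ps_p : g.Ps (iot p) = iot p := by simp [Ps, g.l_zero]

/-- elementary moves -/
def mv : Bool → Cn N → Bn N → Bn N
  | true, a, x => g.Ps (x + (a, 0))
  | false, a, x => sg (g.Ps (sg x + (cj a, 0)))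

lemma mv_sg (b : Bool) (a : Cn N) (x : Bn N) : sg (g.mv b a x) = g.mv (!b) (cj a) (sg x) := by
  cases b <;> simp [mv, sg_sg]

lemma mv_true_snd (a : Cn N) (x : Bn N) : (g.mv true a x).2 = x.2 := by
  simp [mv, Ps_snd]

lemma mv_false_fst (a : Cn N) (x : Bn N) : (g.mv false a x).1 = x.1 := by
  simp [mv, sg_apply, Ps_snd]

lemma mv_an (b : Bool) : AnalyticAt ℂ (fun y : Cn N × Bn N => g.mv b y.1 y.2) (0, iot p) := by
  have h : AnalyticAt ℂ (fun y : Cn N × Bn N => g.mv true y.1 y.2) (0, iot p) := by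
    refine AnalyticAt.fun_comp (g := g.Ps) (f := fun y : Cn N × Bn N => y.2 + (y.1, 0)) ?_ ?_
    · simpa [add00] using g.Ps_an
    · exact (ContinuousLinearMap.snd ℂ (Cn N) (Bn N) + (ContinuousLinearMap.inl ℂ (Cn N) (Cn N)).comp
        (ContinuousLinearMap.fst ℂ (Cn N) (Bn N))).analyticAt _
  cases b
  · have := analyticAt_conj (f := fun y : Cn N × Bn N => g.mv true y.1 y.2) (x := (0, iot p))
      (cj.prodMap sg : Cn N × Bn N →L[ℝ] Cn N × Bn N) sg (fun s x => by
        simp [Prod.map, sg_smul]) sg_smul (by simpa [Prod.map, sg_iot] using h)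
    simpa [mv] using this
  · exact h

lemma mv_p (b : Bool) : g.mv b 0 (iot p) = iot p := by
  cases b <;> simp [mv, sg_iot, Ps_p, add00]

lemma mv_tendsto (b : Bool) {P : Type} {f : Filter P} {a : P → Cn N} {x : P → Bn N}
    (ha : Tendsto a f (𝓝 0)) (hx : Tendsto x f (𝓝 (iot p))) :
    Tendsto (fun s => g.mv b (a s) (x s)) f (𝓝 (iot p)) := by
  have := (g.mv_an b).continuousAt.tendsto
  simp only [mv_p] at this
  exact this.comp (ha.prodMk_nhds hx)

lemma mv_R (b : Bool) {P : Type} {f : Filter P} {a : P → Cn N} {x : P → Bn N}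
    (ha : Tendsto a f (𝓝 0)) (hx : Tendsto x f (𝓝 (iot p))) :
    ∀ᶠ s in f, g.R (g.mv b (a s) (x s)) = 0 := by
  have key : ∀ {a : P → Cn N} {x : P → Bn N}, Tendsto a f (𝓝 0) → Tendsto x f (𝓝 (iot p)) →
      ∀ᶠ s in f, g.R (g.mv true (a s) (x s)) = 0 := by
    intro a x ha hx
    have : Tendsto (fun s => x s + ((a s, 0) : Bn N)) f (𝓝 (iot p)) := by
      have := hx.add (ha.prodMk_nhds (tendsto_const_nhds (x := (0 : Cn N))))
      simpa [add00] using this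
    exact this.eventually g.l_R
  cases b
  · have hca : Tendsto (fun s => cj (a s)) f (𝓝 0) := by
      have := (cj.continuous.tendsto (0 : Cn N)).comp ha
      simpa [Function.comp_def] using this
    have hsx : Tendsto (fun s => sg (x s)) f (𝓝 (iot p)) := tendsto_sg.comp hx
    filter_upwards [key hca hsx, (g.mv_tendsto true hca hsx).eventually g.sym] with s h1 h2
    have : g.mv false (a s) (x s) = sg (g.mv true (cj (a s)) (sg (x s))) := rfl
    rw [this, h2]
    rw [h1]; simp
  · exact key ha hx

lemma mv_cancel (b : Bool) {P : Type} {f : Filter P} {a : P → Cn N} {x : P → Bn N}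
    (ha : Tendsto a f (𝓝 0)) (hx : Tendsto x f (𝓝 (iot p))) (hR : ∀ᶠ s in f, g.R (x s) = 0) :
    ∀ᶠ s in f, g.mv b (-a s) (g.mv b (a s) (x s)) = x s := by
  have key : ∀ {a : P → Cn N} {x : P → Bn N}, Tendsto a f (𝓝 0) → Tendsto x f (𝓝 (iot p)) →
      (∀ᶠ s in f, g.R (x s) = 0) →
      ∀ᶠ s in f, g.mv true (-a s) (g.mv true (a s) (x s)) = x s := by
    intro a x ha hx hR
    have h1 : Tendsto (fun s => x s + ((a s, 0) : Bn N)) f (𝓝 (iot p)) := by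
      have := hx.add (ha.prodMk_nhds (tendsto_const_nhds (x := (0 : Cn N))))
      simpa [add00] using this
    have h2 : Tendsto (fun s => g.l (x s + ((a s, 0) : Bn N))) f (𝓝 0) := by
      have := g.l_an.continuousAt.tendsto.comp h1
      rwa [g.l_zero] at this
    have h3 : Tendsto (fun s => x s + ((g.D (g.l (x s + ((a s, 0) : Bn N))), 0) : Bn N)) f (𝓝 (iot p)) := by
      have h := (g.D.continuous.tendsto 0).comp h2
      rw [map_zero] at h
      have := hx.add (h.prodMk_nhds (tendsto_const_nhds (x := (0 : Cn N))))
      simpa [add00] using this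
    have h4 := h3.prodMk_nhds h2.neg
    rw [neg_zero] at h4
    filter_upwards [h4.eventually g.l_uniq, hR] with s hs hRs
    have h5 := hs (by simpa [add_assoc, add00] using hRs)
    have h6 : g.mv true (a s) (x s) + ((-a s, 0) : Bn N)
        = x s + ((g.D (g.l (x s + ((a s, 0) : Bn N))), 0) : Bn N) := by
      rw [mv, Ps]; ext1 <;> simp
      abel
    rw [mv, h6, Ps, h5]; ext1 <;> simp
  cases b
  · have hca : Tendsto (fun s => cj (a s)) f (𝓝 0) := by
      have := (cj.continuous.tendsto (0 : Cn N)).comp ha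
      simpa [Function.comp_def] using this
    have hsx : Tendsto (fun s => sg (x s)) f (𝓝 (iot p)) := tendsto_sg.comp hx
    have hRs : ∀ᶠ s in f, g.R (sg (x s)) = 0 := by
      filter_upwards [hx.eventually g.sym, hR] with s h1 h2
      simp [h1, h2]
    filter_upwards [key hca hsx hRs] with s h1
    apply_fun sg using (fun u v h => by rw [← sg_sg u, h, sg_sg])
    rw [mv_sg, mv_sg, map_neg]
    exact h1
  · exact key ha hx hR

/-- run a list of moves -/
def run : List (Bool × Cn N) → Bn N → Bn N
  | [], x => x
  | m :: ms, x => run ms (g.mv m.1 m.2 x)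

lemma run_append (l₁ l₂ : List (Bool × Cn N)) (x : Bn N) :
    g.run (l₁ ++ l₂) x = g.run l₂ (g.run l₁ x) := by
  induction l₁ generalizing x with
  | nil => rfl
  | cons m ms ih => exact ih _

/-- conjugate moves -/
def fl (m : Bool × Cn N) : Bool × Cn N := (!m.1, cj m.2)

lemma run_sg (ms : List (Bool × Cn N)) (x : Bn N) :
    sg (g.run ms x) = g.run (ms.map fl) (sg x) := by
  induction ms generalizing x with
  | nil => rfl
  | cons m ms ih =>
    simp only [run, List.map_cons]
    rw [ih, mv_sg]; rfl

/-- the inverse list of moves -/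
def rv (ms : List (Bool × Cn N)) : List (Bool × Cn N) := (ms.map fun m => (m.1, -m.2)).reverse

/-- parametrised list -/
def ev {P : Type} (ms : List (Bool × (P → Cn N))) (s : P) : List (Bool × Cn N) :=
  ms.map fun m => (m.1, m.2 s)

lemma run_tendsto {P : Type} {f : Filter P} (ms : List (Bool × (P → Cn N))) {x : P → Bn N}
    (hm : ∀ m ∈ ms, Tendsto m.2 f (𝓝 0)) (hx : Tendsto x f (𝓝 (iot p))) :
    Tendsto (fun s => g.run (ev ms s) (x s)) f (𝓝 (iot p)) := by
  induction ms generalizing x with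
  | nil => exact hx
  | cons m ms ih =>
    exact ih (fun m' hm' => hm m' (List.mem_cons_of_mem _ hm'))
      (g.mv_tendsto m.1 (hm m List.mem_cons_self) hx)

lemma run_R {P : Type} {f : Filter P} (ms : List (Bool × (P → Cn N))) {x : P → Bn N}
    (hm : ∀ m ∈ ms, Tendsto m.2 f (𝓝 0)) (hx : Tendsto x f (𝓝 (iot p)))
    (hR : ∀ᶠ s in f, g.R (x s) = 0) :
    ∀ᶠ s in f, g.R (g.run (ev ms s) (x s)) = 0 := by
  induction ms generalizing x with
  | nil => exact hR
  | cons m ms ih =>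
    exact ih (fun m' hm' => hm m' (List.mem_cons_of_mem _ hm'))
      (g.mv_tendsto m.1 (hm m List.mem_cons_self) hx) (g.mv_R m.1 (hm m List.mem_cons_self) hx)

lemma run_cancel {P : Type} {f : Filter P} (ms : List (Bool × (P → Cn N))) {x : P → Bn N}
    (hm : ∀ m ∈ ms, Tendsto m.2 f (𝓝 0)) (hx : Tendsto x f (𝓝 (iot p)))
    (hR : ∀ᶠ s in f, g.R (x s) = 0) :
    ∀ᶠ s in f, g.run (rv (ev ms s)) (g.run (ev ms s) (x s)) = x s := by
  induction ms generalizing x with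
  | nil => exact Eventually.of_forall fun s => rfl
  | cons m ms ih =>
    have h1 := ih (fun m' hm' => hm m' (List.mem_cons_of_mem _ hm'))
      (g.mv_tendsto m.1 (hm m List.mem_cons_self) hx) (g.mv_R m.1 (hm m List.mem_cons_self) hx)
    filter_upwards [h1, g.mv_cancel m.1 (hm m List.mem_cons_self) hx hR] with s e1 e2
    have : rv (ev (m :: ms) s) = rv (ev ms s) ++ [(m.1, - m.2 s)] := by
      simp [rv, ev]
    rw [this, run_append]
    change g.run _ (g.run (rv (ev ms s)) (g.run (ev ms s) (g.mv m.1 (m.2 s) (x s)))) = _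
    rw [e1]
    exact e2

lemma run_an {P : Type} [NormedAddCommGroup P] [NormedSpace ℂ P] {s0 : P}
    (ms : List (Bool × (P → Cn N))) {x : P → Bn N}
    (hm : ∀ m ∈ ms, AnalyticAt ℂ m.2 s0 ∧ m.2 s0 = 0) (hx : AnalyticAt ℂ x s0) (hx0 : x s0 = iot p) :
    AnalyticAt ℂ (fun s => g.run (ev ms s) (x s)) s0 ∧ g.run (ev ms s0) (x s0) = iot p := by
  induction ms generalizing x with
  | nil => exact ⟨hx, hx0⟩
  | cons m ms ih =>
    have hm0 := hm m List.mem_cons_self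
    refine ih (x := fun s => g.mv m.1 (m.2 s) (x s)) (fun m' hm' => hm m' (List.mem_cons_of_mem _ hm')) ?_ ?_
    · refine AnalyticAt.fun_comp (g := fun y : Cn N × Bn N => g.mv m.1 y.1 y.2)
        (f := fun s => (m.2 s, x s)) ?_ (AnalyticAt.prod hm0.1 hx)
      rw [hm0.2, hx0]; exact g.mv_an m.1
    · rw [hm0.2, hx0]; exact g.mv_p m.1

/-- canonical word map -/
def Vw {n : ℕ} (w : Fin n → Bool) (t : Fin n → Cn N) : Bn N :=
  g.run (List.ofFn fun i => (w i, t i)) (iot p)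

lemma ev_get {P : Type} (ms : List (Bool × (P → Cn N))) (s : P) :
    g.run (ev ms s) (iot p) =
      g.Vw (fun i : Fin ms.length => (ms.get i).1) (fun i => (ms.get i).2 s) := by
  rw [Vw]; congr 1
  rw [ev]
  apply List.ext_get <;> simp

/-- canonical parametrised list -/
def cw {n : ℕ} (w : Fin n → Bool) {P : Type} (pr : P → Fin n → Cn N) : List (Bool × (P → Cn N)) :=
  List.ofFn fun i => (w i, fun s => pr s i)

lemma ev_cw {n : ℕ} (w : Fin n → Bool) {P : Type} (pr : P → Fin n → Cn N) (s : P) :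
    ev (cw w pr) s = List.ofFn fun i => (w i, pr s i) := by
  rw [ev, cw]; apply List.ext_get <;> simp

lemma ev_append {P : Type} (ms ms' : List (Bool × (P → Cn N))) (s : P) :
    ev (ms ++ ms') s = ev ms s ++ ev ms' s := by simp [ev]

/-- parametrised reverse -/
def rvP {P : Type} (ms : List (Bool × (P → Cn N))) : List (Bool × (P → Cn N)) :=
  (ms.map fun m => (m.1, fun s => -m.2 s)).reverse

lemma ev_rvP {P : Type} (ms : List (Bool × (P → Cn N))) (s : P) : ev (rvP ms) s = rv (ev ms s) := by
  simp [ev, rvP, rv, Function.comp_def]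

end Geo
end part6

section part7
open Filter

/-- rank of a continuous linear map -/
def rk {E F : Type} [NormedAddCommGroup E] [NormedSpace ℂ E] [NormedAddCommGroup F] [NormedSpace ℂ F]
    (L : E →L[ℂ] F) : ℕ := Module.finrank ℂ (LinearMap.range (L : E →ₗ[ℂ] F))

section
variable {Q B : Type} [NormedAddCommGroup Q] [NormedSpace ℂ Q] [FiniteDimensional ℂ Q]
    [CompleteSpace Q]
    [NormedAddCommGroup B] [NormedSpace ℂ B] [FiniteDimensional ℂ B] [CompleteSpace B]

lemma exists_section (A : Q →L[ℂ] B) (π : B →L[ℂ] B)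
    (hr : LinearMap.range (π : B →ₗ[ℂ] B) ≤ LinearMap.range (A : Q →ₗ[ℂ] B)) (hπ : ∀ x, π (π x) = π x) :
    ∃ J : B →L[ℂ] Q, (∀ y, A (J y) = π y) ∧ ∀ y, J (π y) = J y := by
  obtain ⟨s, hs⟩ := (A : Q →ₗ[ℂ] B).rangeRestrict.exists_rightInverse_of_surjective
    (LinearMap.range_rangeRestrict _)
  have hmem : ∀ y, (π : B →ₗ[ℂ] B) y ∈ LinearMap.range (A : Q →ₗ[ℂ] B) := fun y => hr ⟨y, rfl⟩
  refine ⟨LinearMap.toContinuousLinearMap (s ∘ₗ (π : B →ₗ[ℂ] B).codRestrict _ hmem), ?_, ?_⟩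
  · intro y
    have := congrArg Subtype.val (congrArg (fun L => L ⟨_, hmem y⟩) hs)
    exact this
  · intro y
    simp only [LinearMap.coe_toContinuousLinearMap', LinearMap.comp_apply]
    congr 1
    ext
    exact hπ y

lemma ker_of_rank (A L : Q →L[ℂ] B) (h1 : ∀ v, L v = 0 → A v = 0) (h2 : rk L ≤ rk A) :
    ∀ v, A v = 0 → L v = 0 := by
  have hle : LinearMap.ker (L : Q →ₗ[ℂ] B) ≤ LinearMap.ker (A : Q →ₗ[ℂ] B) := fun v hv => h1 v hv
  have e1 := LinearMap.finrank_range_add_finrank_ker (L : Q →ₗ[ℂ] B)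
  have e2 := LinearMap.finrank_range_add_finrank_ker (A : Q →ₗ[ℂ] B)
  have := Submodule.eq_of_le_of_finrank_le hle (by unfold rk at h2; omega)
  intro v hv
  have : v ∈ LinearMap.ker (L : Q →ₗ[ℂ] B) := by rw [this]; exact hv
  exact this

lemma const_rank {E : Q → B} {q0 : Q} {p0 : B} (hE : AnalyticAt ℂ E q0) (hq : E q0 = p0)
    (π : B →L[ℂ] B) (hπ : ∀ x, π (π x) = π x)
    (hr : LinearMap.range (π : B →ₗ[ℂ] B) = LinearMap.range (fderiv ℂ E q0 : Q →ₗ[ℂ] B))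
    (hrk : ∀ᶠ s in 𝓝 q0, rk (fderiv ℂ E s) ≤ rk π) :
    ∃ (φ : B → B) (sec : B → Q), AnalyticAt ℂ φ 0 ∧ φ 0 = 0 ∧ (∀ y, π (φ y) = 0) ∧
      (∀ y, φ (π y) = φ y) ∧ ContinuousAt sec 0 ∧ sec 0 = q0 ∧
      (∀ᶠ s in 𝓝 q0, (E s - p0) - π (E s - p0) = φ (E s - p0)) ∧
      (∀ᶠ y in 𝓝 (0 : B), E (sec y) = p0 + π y + φ y) := by
  set A := fderiv ℂ E q0 with hA
  obtain ⟨J, hJ, hJπ⟩ := exists_section A π hr.le hπ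
  have hπA : ∀ v, π (A v) = A v := by
    intro v
    obtain ⟨y, hy⟩ : A v ∈ LinearMap.range (π : B →ₗ[ℂ] B) := by rw [hr]; exact ⟨v, rfl⟩
    have hy : π y = A v := hy
    rw [← hy, hπ]
  set Θ : Q → Q := fun s => q0 + J (E s - p0) + (s - q0) - J (A (s - q0)) with hΘ
  have hΘan : AnalyticAt ℂ Θ q0 := by
    have h1 : AnalyticAt ℂ (fun s => J (E s - p0)) q0 :=
      (J.analyticAt _).fun_comp (hE.sub analyticAt_const)
    have h2 : AnalyticAt ℂ (fun s => J (A (s - q0))) q0 :=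
      ((J.comp A).analyticAt _).fun_comp (analyticAt_id.sub analyticAt_const)
    exact ((analyticAt_const.add h1).add (analyticAt_id.sub analyticAt_const)).sub h2
  have hΘd : HasFDerivAt Θ ((ContinuousLinearEquiv.refl ℂ Q : Q ≃L[ℂ] Q) : Q →L[ℂ] Q) q0 := by
    have h1 : HasFDerivAt (fun s => J (E s - p0)) (J.comp A) q0 :=
      J.hasFDerivAt.comp q0 (hE.differentiableAt.hasFDerivAt.sub_const p0)
    have h2 : HasFDerivAt (fun s => J (A (s - q0))) (J.comp A) q0 :=
      (J.comp A).hasFDerivAt.comp q0 ((hasFDerivAt_id q0).sub_const q0)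
    have h3 := ((h1.const_add q0).add ((hasFDerivAt_id q0).sub_const q0)).sub h2
    have h4 : ((ContinuousLinearEquiv.refl ℂ Q : Q ≃L[ℂ] Q) : Q →L[ℂ] Q)
        = J.comp A + ContinuousLinearMap.id ℂ Q - J.comp A := by ext v; simp
    rw [h4]
    exact h3
  have hΘc : ContDiffAt ℂ (⊤ : WithTop ℕ∞) Θ q0 := hΘan.contDiffAt
  have hn : (⊤ : WithTop ℕ∞) ≠ 0 := by simp
  have hΘs : HasStrictFDerivAt Θ ((ContinuousLinearEquiv.refl ℂ Q : Q ≃L[ℂ] Q) : Q →L[ℂ] Q) q0 := by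
    have := hΘc.hasStrictFDerivAt hn
    rwa [hΘd.fderiv] at this
  have hΘ0 : Θ q0 = q0 := by simp [hΘ, hq]
  set τ := hΘs.localInverse Θ _ q0 with hτ
  have hτan : AnalyticAt ℂ τ q0 := by
    have := (hΘc.to_localInverse hΘd hn).analyticAt
    rw [hΘ0] at this
    exact this
  have hτ0 : τ q0 = q0 := by
    have := hΘs.localInverse_apply_image
    rwa [hΘ0] at this
  have hleft : ∀ᶠ s in 𝓝 q0, τ (Θ s) = s := hΘs.eventually_left_inverse
  have hright : ∀ᶠ q in 𝓝 q0, Θ (τ q) = q := by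
    have := hΘs.eventually_right_inverse
    rwa [hΘ0] at this
  have hAΘ : ∀ s, A (Θ s - q0) = π (E s - p0) := by
    intro s
    have : Θ s - q0 = J (E s - p0) + (s - q0) - J (A (s - q0)) := by simp only [hΘ]; abel
    rw [this, map_sub, map_add, hJ, hJ, hπA]; abel
  set h : Q → B := fun q => E (τ q) with hh
  have hhan : AnalyticAt ℂ h q0 := AnalyticAt.fun_comp (by rwa [hτ0]) hτan
  have hπh : ∀ᶠ q in 𝓝 q0, π (h q - p0) = A (q - q0) := by
    filter_upwards [hright] with q e
    rw [hh]; simp only; rw [← hAΘ, e]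
  have hrkA : rk A = rk π := by unfold rk; rw [hr]
  have htτ : Tendsto τ (𝓝 q0) (𝓝 q0) := by
    have := hτan.continuousAt.tendsto; rwa [hτ0] at this
  have hker : ∀ᶠ q in 𝓝 q0, ∀ v, A v = 0 → fderiv ℂ h q v = 0 := by
    filter_upwards [hπh.eventually_nhds, hhan.eventually_analyticAt, htτ.eventually hrk,
      htτ.eventually hE.eventually_analyticAt, hτan.eventually_analyticAt] with q e1 e2 e3 e4 e5
    apply ker_of_rank
    · intro v hv
      have h1 : HasFDerivAt (fun q => π (h q - p0)) (π.comp (fderiv ℂ h q)) q :=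
        π.hasFDerivAt.comp q (e2.differentiableAt.hasFDerivAt.sub_const p0)
      have h2 : HasFDerivAt (fun q => A (q - q0)) A q :=
        (A.hasFDerivAt.comp q ((hasFDerivAt_id q).sub_const q0))
      have := congrArg (fun L : Q →L[ℂ] B => L v) (h2.unique (h1.congr_of_eventuallyEq
        (by filter_upwards [e1] with y hy using hy.symm)))
      simp only [ContinuousLinearMap.comp_apply, hv, map_zero] at this
      exact this
    · have h1 : HasFDerivAt h ((fderiv ℂ E (τ q)).comp (fderiv ℂ τ q)) q :=
        e4.differentiableAt.hasFDerivAt.comp q e5.differentiableAt.hasFDerivAt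
      rw [hrkA]
      refine le_trans ?_ e3
      rw [h1.fderiv]
      refine Submodule.finrank_mono ?_
      rintro _ ⟨v, rfl⟩
      exact ⟨fderiv ℂ τ q v, rfl⟩
  -- constancy along fibres
  have hconst : ∀ᶠ q in 𝓝 q0, h q = h (q0 + J (A (q - q0))) := by
    obtain ⟨ε, hε, hb⟩ := Metric.eventually_nhds_iff_ball.1 (hker.and hhan.eventually_analyticAt)
    have hc : ContinuousAt (fun q => q0 + J (A (q - q0))) q0 := by fun_prop
    have hc' : ∀ᶠ q in 𝓝 q0, q0 + J (A (q - q0)) ∈ Metric.ball q0 ε :=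
      hc.eventually_mem (by simpa using Metric.ball_mem_nhds q0 hε)
    filter_upwards [hc', Metric.ball_mem_nhds q0 hε] with q h1 h2
    set a := q0 + J (A (q - q0)) with ha
    set v := q - a with hv
    have hAv : A v = 0 := by
      have : v = (q - q0) - J (A (q - q0)) := by rw [hv, ha]; abel
      rw [this, map_sub, hJ, hπA, sub_self]
    have hin : ∀ s ∈ Set.Icc (0:ℝ) 1, a + (s : ℂ) • v ∈ Metric.ball q0 ε := by
      intro s hs
      have := (convex_ball q0 ε).add_smul_sub_mem h1 h2 hs
      exact this
    have hder : ∀ s ∈ Set.Icc (0:ℝ) 1, HasDerivAt (fun s : ℝ => h (a + (s : ℂ) • v)) 0 s := by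
      intro s hs
      have e := hb _ (hin s hs)
      have e2 : HasDerivAt (fun s : ℝ => a + (s:ℂ) • v) v s := by
        have := ((Complex.ofRealCLM.hasDerivAt (x := s)).smul_const v).const_add a
        simpa using this
      have e3 := (e.2.differentiableAt.hasFDerivAt.restrictScalars ℝ).comp_hasDerivAt s e2
      have e4 : ((fderiv ℂ h (a + (s : ℂ) • v)).restrictScalars ℝ) v = 0 := e.1 v hAv
      rw [e4] at e3
      exact e3
    have := constant_of_has_deriv_right_zero
      (fun s hs => (hder s hs).continuousAt.continuousWithinAt)
      (fun s hs => (hder s ⟨hs.1, hs.2.le⟩).hasDerivWithinAt) 1 (by simp)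
    simpa [hv] using this
  have hcq : Tendsto (fun y : B => q0 + J y) (𝓝 0) (𝓝 q0) := by
    have : Continuous (fun y : B => q0 + J y) := by fun_prop
    simpa using this.tendsto 0
  have hqan : AnalyticAt ℂ (fun y : B => q0 + J y) 0 := analyticAt_const.add (J.analyticAt 0)
  have hhJ : AnalyticAt ℂ (fun y => h (q0 + J y) - p0) 0 :=
    (AnalyticAt.fun_comp (g := h) (f := fun y : B => q0 + J y) (by simpa using hhan) hqan).sub analyticAt_const
  refine ⟨fun y => (h (q0 + J y) - p0) - π (h (q0 + J y) - p0), fun y => τ (q0 + J y),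
    hhJ.sub ((π.analyticAt _).fun_comp hhJ), ?_, ?_, ?_, ?_, ?_, ?_, ?_⟩
  · simp [hh, hτ0, hq]
  · intro y; simp only [map_sub, hπ]; abel
  · intro y; simp only [hJπ]
  · refine ContinuousAt.comp (g := τ) (f := fun y : B => q0 + J y) ?_ hqan.continuousAt
    simpa using hτan.continuousAt
  · simp [hτ0]
  · have htΘ : Tendsto Θ (𝓝 q0) (𝓝 q0) := by
      have := hΘan.continuousAt.tendsto; rwa [hΘ0] at this
    filter_upwards [hleft, htΘ.eventually hconst] with s e1 e2
    rw [hAΘ, hJπ] at e2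
    have : E s = h (q0 + J (E s - p0)) := by
      rw [← e2, hh]; simp only; rw [e1]
    rw [← this]
  · filter_upwards [hcq.eventually hπh] with y e
    rw [add_sub_cancel_left, hJ] at e
    rw [e]
    simp only [hh]
    abel

/-- comparison of graphs -/
lemma graph_compare {P : Type} [NormedAddCommGroup P] [NormedSpace ℂ P] [FiniteDimensional ℂ P]
    [CompleteSpace P] {E : Q → B} {q0 : Q} {p0 : B} (hE : AnalyticAt ℂ E q0) (hq : E q0 = p0)
    (π : B →L[ℂ] B) (hπ : ∀ x, π (π x) = π x)
    (hr : LinearMap.range (π : B →ₗ[ℂ] B) = LinearMap.range (fderiv ℂ E q0 : Q →ₗ[ℂ] B))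
    (hrk : ∀ᶠ s in 𝓝 q0, rk (fderiv ℂ E s) ≤ rk π)
    {C : P → B} {t0 : P} {φ : B → B} {sec : B → P}
    (hφ1 : ∀ y, π (φ y) = 0) (hsec : ContinuousAt sec 0) (hsec0 : sec 0 = t0)
    (hCs : ∀ᶠ y in 𝓝 (0 : B), C (sec y) = p0 + π y + φ y)
    {j : P → Q} (hj : ContinuousAt j t0) (hj0 : j t0 = q0) (hC : ∀ᶠ t in 𝓝 t0, C t = E (j t)) :
    ∀ᶠ s in 𝓝 q0, (E s - p0) - π (E s - p0) = φ (E s - p0) := by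
  obtain ⟨ψ, -, h1, h2, h3, h4, -, -, h7, -⟩ := const_rank hE hq π hπ hr hrk
  have hst : Tendsto sec (𝓝 0) (𝓝 t0) := by
    have := hsec.tendsto; rwa [hsec0] at this
  have hjt : Tendsto j (𝓝 t0) (𝓝 q0) := by
    have := hj.tendsto; rwa [hj0] at this
  have heq : ∀ᶠ y in 𝓝 (0 : B), φ y = ψ y := by
    filter_upwards [hCs, hst.eventually hC, hst.eventually (hjt.eventually h7)] with y e1 e2 e3
    rw [← e2, e1] at e3
    have e4 : p0 + π y + φ y - p0 = π y + φ y := by abel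
    rw [e4, map_add, hπ, hφ1] at e3
    have e5 : ψ (π y + φ y) = ψ y := by
      rw [← h4, map_add, hπ, hφ1, add_zero, h4]
    rw [e5] at e3
    rw [← e3]; abel
  have ht : Tendsto (fun s => E s - p0) (𝓝 q0) (𝓝 0) := by
    have := hE.continuousAt.tendsto.sub_const p0
    rwa [hq, sub_self] at this
  filter_upwards [h7, ht.eventually heq] with s e1 e2
  rw [e1, e2]

end
end part7

section part8
open Filter

lemma rk_comp_le {E F G : Type} [NormedAddCommGroup E] [NormedSpace ℂ E] [NormedAddCommGroup F]
    [NormedSpace ℂ F] [NormedAddCommGroup G] [NormedSpace ℂ G] [FiniteDimensional ℂ G]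
    (A : F →L[ℂ] G) (B : E →L[ℂ] F) : rk (A.comp B) ≤ rk A := by
  apply Submodule.finrank_mono
  rintro _ ⟨x, rfl⟩
  exact ⟨B x, rfl⟩

lemma rk_comp_le' {E F G : Type} [NormedAddCommGroup E] [NormedSpace ℂ E] [NormedAddCommGroup F]
    [NormedSpace ℂ F] [NormedAddCommGroup G] [NormedSpace ℂ G] [FiniteDimensional ℂ F]
    (A : F →L[ℂ] G) (B : E →L[ℂ] F) : rk (A.comp B) ≤ rk B := by
  have : LinearMap.range ((A.comp B : E →L[ℂ] G) : E →ₗ[ℂ] G)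
      = (LinearMap.range (B : E →ₗ[ℂ] F)).map (A : F →ₗ[ℂ] G) := by
    exact LinearMap.range_comp (B : E →ₗ[ℂ] F) (A : F →ₗ[ℂ] G)
  unfold rk
  rw [this]
  exact Submodule.finrank_map_le _ _

namespace Geo

variable {N d : ℕ} {M : Set (Cn N)} {p : Cn N} (g : Geo N d M p)

lemma Vw_run {n : ℕ} (w : Fin n → Bool) (t : Fin n → Cn N) :
    g.Vw w t = g.run (ev (cw w id) t) (iot p) := by
  rw [ev_cw]; rfl

lemma cw_an {n : ℕ} (w : Fin n → Bool) {P : Type} [NormedAddCommGroup P] [NormedSpace ℂ P] {s0 : P}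
    (pr : P → Fin n → Cn N) (h : AnalyticAt ℂ pr s0) (h0 : pr s0 = 0) :
    ∀ m ∈ cw w pr, AnalyticAt ℂ m.2 s0 ∧ m.2 s0 = 0 := by
  intro m hm
  simp only [cw, List.mem_ofFn] at hm
  obtain ⟨i, rfl⟩ := hm
  refine ⟨?_, by simp [h0]⟩
  exact ((ContinuousLinearMap.proj (R := ℂ) (φ := fun _ : Fin n => Cn N) i).analyticAt _).fun_comp h

lemma rvP_an {P : Type} [NormedAddCommGroup P] [NormedSpace ℂ P] {s0 : P}
    {ms : List (Bool × (P → Cn N))} (h : ∀ m ∈ ms, AnalyticAt ℂ m.2 s0 ∧ m.2 s0 = 0) :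
    ∀ m ∈ rvP ms, AnalyticAt ℂ m.2 s0 ∧ m.2 s0 = 0 := by
  intro m hm
  simp only [rvP, List.mem_reverse, List.mem_map] at hm
  obtain ⟨m', hm', rfl⟩ := hm
  obtain ⟨h1, h2⟩ := h m' hm'
  exact ⟨h1.neg, by simp [h2]⟩

lemma Vw_an {n : ℕ} (w : Fin n → Bool) : AnalyticAt ℂ (g.Vw w) 0 := by
  have := (g.run_an (s0 := (0 : Fin n → Cn N)) (cw w id) (x := fun _ => iot p)
    (cw_an w id analyticAt_id rfl) analyticAt_const rfl).1
  refine this.congr (Eventually.of_forall fun t => ?_)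
  rw [Vw_run]

lemma exists_max : ∃ r : ℕ, (∃ n, ∃ w : Fin n → Bool,
      ∃ᶠ t in 𝓝 (0 : Fin n → Cn N), r ≤ rk (fderiv ℂ (g.Vw w) t)) ∧
    ∀ n, ∀ w : Fin n → Bool, ∀ᶠ t in 𝓝 (0 : Fin n → Cn N), rk (fderiv ℂ (g.Vw w) t) ≤ r := by
  classical
  let P : ℕ → Prop := fun r => ∃ n, ∃ w : Fin n → Bool,
      ∃ᶠ t in 𝓝 (0 : Fin n → Cn N), r ≤ rk (fderiv ℂ (g.Vw w) t)
  have hb : ∀ r, P r → r ≤ Module.finrank ℂ (Bn N) := by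
    rintro r ⟨n, w, h⟩
    obtain ⟨t, ht⟩ := h.exists
    exact ht.trans (Submodule.finrank_le _)
  have h0 : P 0 := ⟨0, fun i => true, by simpa using (Eventually.of_forall (fun _ => trivial) : ∀ᶠ _ in 𝓝 (0 : Fin 0 → Cn N), True).frequently⟩
  refine ⟨Nat.findGreatest P (Module.finrank ℂ (Bn N)), Nat.findGreatest_spec (P := P) (Nat.zero_le _) h0, ?_⟩
  intro n w
  by_contra hcon
  have hf : ∃ᶠ t in 𝓝 (0 : Fin n → Cn N),
      Nat.findGreatest P (Module.finrank ℂ (Bn N)) + 1 ≤ rk (fderiv ℂ (g.Vw w) t) := by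
    rw [Filter.not_eventually] at hcon
    exact hcon.mono fun t ht => by omega
  have hP : P (Nat.findGreatest P (Module.finrank ℂ (Bn N)) + 1) := ⟨n, w, hf⟩
  have := Nat.le_findGreatest (hb _ hP) hP
  omega

/-- rank of a parametrised run -/
lemma rank_param {r : ℕ} (hr : ∀ n, ∀ w : Fin n → Bool, ∀ᶠ t in 𝓝 (0 : Fin n → Cn N),
      rk (fderiv ℂ (g.Vw w) t) ≤ r)
    {P : Type} [NormedAddCommGroup P] [NormedSpace ℂ P] {s0 : P}
    (ms : List (Bool × (P → Cn N))) (hm : ∀ m ∈ ms, AnalyticAt ℂ m.2 s0 ∧ m.2 s0 = 0) :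
    ∀ᶠ s in 𝓝 s0, AnalyticAt ℂ (fun s => g.run (ev ms s) (iot p)) s ∧
      rk (fderiv ℂ (fun s => g.run (ev ms s) (iot p)) s) ≤ r := by
  have h1 := (g.run_an (s0 := s0) ms (x := fun _ => iot p) hm analyticAt_const rfl).1
  set w : Fin ms.length → Bool := fun i => (ms.get i).1
  set χ : P → Fin ms.length → Cn N := fun s i => (ms.get i).2 s
  have hχ : AnalyticAt ℂ χ s0 := AnalyticAt.pi fun i => (hm _ (ms.get_mem i)).1
  have hχ0 : χ s0 = 0 := funext fun i => (hm _ (ms.get_mem i)).2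
  have hfun : (fun s => g.run (ev ms s) (iot p)) = fun s => g.Vw w (χ s) :=
    funext fun s => g.ev_get ms s
  have ht : Tendsto χ (𝓝 s0) (𝓝 0) := by
    have := hχ.continuousAt.tendsto; rwa [hχ0] at this
  filter_upwards [h1.eventually_analyticAt, hχ.eventually_analyticAt,
    ht.eventually (g.Vw_an w).eventually_analyticAt, ht.eventually (hr _ w)] with s a1 a2 a3 a4
  refine ⟨a1, ?_⟩
  rw [hfun]
  have : fderiv ℂ (fun s => g.Vw w (χ s)) s = (fderiv ℂ (g.Vw w) (χ s)).comp (fderiv ℂ χ s) :=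
    fderiv_comp' (f := χ) (g := g.Vw w) s a3.differentiableAt a2.differentiableAt
  rw [this]
  exact (rk_comp_le _ _).trans a4

end Geo
end part8

section part9
open Filter

lemma slice_rank {Q P B : Type} [NormedAddCommGroup Q] [NormedSpace ℂ Q] [NormedAddCommGroup P]
    [NormedSpace ℂ P] [CompleteSpace P] [NormedAddCommGroup B] [NormedSpace ℂ B] [FiniteDimensional ℂ B]
    [CompleteSpace B] {F : P → B} {s1 : P} {r : ℕ}
    (hF : ∀ᶠ s in 𝓝 s1, AnalyticAt ℂ F s ∧ rk (fderiv ℂ F s) ≤ r)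
    {j : Q → P} {q0 : Q} (hj : AnalyticAt ℂ j q0) (hj0 : j q0 = s1) :
    AnalyticAt ℂ (fun q => F (j q)) q0 ∧ ∀ᶠ q in 𝓝 q0, rk (fderiv ℂ (fun q => F (j q)) q) ≤ r := by
  subst hj0
  refine ⟨AnalyticAt.fun_comp (g := F) (f := j) hF.self_of_nhds.1 hj, ?_⟩
  filter_upwards [hj.eventually_analyticAt, hj.continuousAt.tendsto.eventually hF] with q h1 h2
  rw [fderiv_comp' (f := j) (g := F) q h2.1.differentiableAt h1.differentiableAt]
  exact (rk_comp_le _ _).trans h2.2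

lemma range_slice {Q P B : Type} [NormedAddCommGroup Q] [NormedSpace ℂ Q] [NormedAddCommGroup P]
    [NormedSpace ℂ P] [NormedAddCommGroup B] [NormedSpace ℂ B] [FiniteDimensional ℂ B]
    {C : P → B} {E : Q → B} {t0 : P} {q0 : Q} {r : ℕ} (hE : DifferentiableAt ℂ E q0)
    {j : P → Q} (hj : DifferentiableAt ℂ j t0) (hj0 : j t0 = q0)
    (hC : ∀ᶠ t in 𝓝 t0, C t = E (j t)) (hr : rk (fderiv ℂ E q0) ≤ r) (hr' : r ≤ rk (fderiv ℂ C t0)) :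
    LinearMap.range (fderiv ℂ C t0 : P →ₗ[ℂ] B) = LinearMap.range (fderiv ℂ E q0 : Q →ₗ[ℂ] B) := by
  subst hj0
  have h : fderiv ℂ C t0 = (fderiv ℂ E (j t0)).comp (fderiv ℂ j t0) := by
    rw [Filter.EventuallyEq.fderiv_eq (f₁ := C) (f := fun t => E (j t)) hC]
    exact fderiv_comp' (f := j) (g := E) t0 hE hj
  apply Submodule.eq_of_le_of_finrank_le
  · rw [h]
    rintro _ ⟨x, rfl⟩
    exact ⟨fderiv ℂ j t0 x, rfl⟩
  · exact hr.trans hr'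

namespace Geo

variable {N d : ℕ} {M : Set (Cn N)} {p : Cn N} (g : Geo N d M p)

lemma mv_zero (b : Bool) : ∀ᶠ x in 𝓝 (iot p), g.R x = 0 → g.mv b 0 x = x := by
  have key : ∀ᶠ x in 𝓝 (iot p), g.R x = 0 → g.mv true 0 x = x := by
    filter_upwards [g.l_id] with x hx h
    have h1 : x + ((0, 0) : Bn N) = x := add00 x
    rw [mv, Ps, h1, hx h]
    simp [add00]
  cases b
  · filter_upwards [tendsto_sg.eventually key, g.sym] with x h1 h2 h3
    have : g.mv false 0 x = sg (g.mv true 0 (sg x)) := by simp [mv]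
    rw [this, h1 (by rw [h2, h3]; simp), sg_sg]
  · exact key

/-- the list `w(t) w(s)^{-1}` -/
def Lw {n : ℕ} (w : Fin n → Bool) (t s : Fin n → Cn N) : List (Bool × Cn N) :=
  (List.ofFn fun i => (w i, t i)) ++ rv (List.ofFn fun i => (w i, s i))

/-- parametrised version -/
def Lp {n : ℕ} (w : Fin n → Bool) {P : Type} (a b : P → Fin n → Cn N) : List (Bool × (P → Cn N)) :=
  cw w a ++ rvP (cw w b)

lemma ev_Lp {n : ℕ} (w : Fin n → Bool) {P : Type} (a b : P → Fin n → Cn N) (s : P) :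
    ev (Lp w a b) s = Lw w (a s) (b s) := by
  rw [Lp, Lw, ev_append, ev_cw, ev_rvP, ev_cw]

lemma Lp_an {n : ℕ} (w : Fin n → Bool) {P : Type} [NormedAddCommGroup P] [NormedSpace ℂ P]
    (a b : P →L[ℂ] (Fin n → Cn N)) :
    ∀ m ∈ Lp w a b, AnalyticAt ℂ m.2 0 ∧ m.2 0 = 0 := by
  intro m hm
  rw [Lp, List.mem_append] at hm
  rcases hm with hm | hm
  · exact cw_an w a (a.analyticAt 0) (map_zero a) m hm
  · exact rvP_an (cw_an w b (b.analyticAt 0) (map_zero b)) m hm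

lemma fl_rv (l : List (Bool × Cn N)) : (rv l).map fl = rv (l.map fl) := by
  simp [rv, fl, Function.comp_def, List.map_reverse]

lemma rv_rv (l : List (Bool × Cn N)) : rv (rv l) = l := by
  simp [rv, List.map_reverse, Function.comp_def]

/-- conjugation of parameters -/
def cjT (n : ℕ) : (Fin n → Cn N) →L[ℝ] (Fin n → Cn N) :=
  ContinuousLinearMap.pi fun i => cj.comp (ContinuousLinearMap.proj i)

@[simp] lemma cjT_apply (n : ℕ) (t : Fin n → Cn N) (i : Fin n) : cjT n t i = cj (t i) := rfl

lemma fl_Lw {n : ℕ} (w : Fin n → Bool) (t s : Fin n → Cn N) :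
    (Lw w t s).map fl = Lw (fun i => !w i) (cjT n t) (cjT n s) := by
  simp only [Lw, List.map_append, fl_rv, List.map_ofFn]
  rfl

/-- the closed orbit map -/
def Cw {n : ℕ} (w : Fin n → Bool) (u : (Fin n → Cn N) × (Fin n → Cn N)) : Bn N :=
  g.run (Lw w u.1 u.2) (iot p)

end Geo

open Geo in
/-- conjugation-invariant projection -/
lemma exists_proj {N : ℕ} (T : Submodule ℂ (Bn N)) (hT : ∀ x ∈ T, sg x ∈ T) :
    ∃ π : Bn N →L[ℂ] Bn N, (∀ x, π (π x) = π x) ∧ (∀ x, π (sg x) = sg (π x)) ∧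
      LinearMap.range (π : Bn N →ₗ[ℂ] Bn N) = T := by
  obtain ⟨f, hf⟩ := T.subtype.exists_leftInverse_of_injective (by simp)
  have hf' : ∀ x ∈ T, (f x : Bn N) = x := fun x hx => by
    have := congrArg (fun L => ((L ⟨x, hx⟩ : T) : Bn N)) hf
    simpa using this
  let τ : Bn N →ₗ[ℂ] Bn N :=
    { toFun := fun x => sg (f (sg x) : Bn N)
      map_add' := fun x y => by simp
      map_smul' := fun c x => by simp [sg_smul] }
  have hτ : ∀ x, τ x = sg (f (sg x) : Bn N) := fun x => rfl
  let π : Bn N →L[ℂ] Bn N := LinearMap.toContinuousLinearMap ((1/2 : ℂ) • (T.subtype ∘ₗ f + τ))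
  have hπ : ∀ x, π x = (1/2 : ℂ) • ((f x : Bn N) + sg (f (sg x) : Bn N)) := fun x => rfl
  have hmem : ∀ x, π x ∈ T := fun x => by
    rw [hπ]; exact T.smul_mem _ (T.add_mem (f x).2 (hT _ (f (sg x)).2))
  have hid : ∀ x ∈ T, π x = x := fun x hx => by
    rw [hπ, hf' x hx, hf' _ (hT x hx), sg_sg, ← two_smul ℂ x, smul_smul]; norm_num
  refine ⟨π, fun x => hid _ (hmem x), fun x => ?_, ?_⟩
  · rw [hπ, hπ, sg_smul, map_add, sg_sg, sg_sg, add_comm]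
    congr 1; simp [map_ofNat (starRingEnd ℂ) 2]
  · apply le_antisymm
    · rintro _ ⟨x, rfl⟩; exact hmem x
    · intro x hx; exact ⟨x, hid x hx⟩
end part9

section part10
open Filter
namespace Geo

variable {N d : ℕ} {M : Set (Cn N)} {p : Cn N} (g : Geo N d M p)

/-- membership in the graph -/
def onW (p : Cn N) (π : Bn N →L[ℂ] Bn N) (φ : Bn N → Bn N) (x : Bn N) : Prop :=
  (x - iot p) - π (x - iot p) = φ (x - iot p)

lemma Vw_split {n : ℕ} (w : Fin n → Bool) :
    ∀ᶠ u in 𝓝 (0 : (Fin n → Cn N) × (Fin n → Cn N)),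
      g.run (List.ofFn fun i => (w i, u.2 i)) (g.Cw w u) = g.Vw w u.1 := by
  have h1 : ∀ m ∈ cw w (fun u : (Fin n → Cn N) × (Fin n → Cn N) => u.1),
      AnalyticAt ℂ m.2 0 ∧ m.2 0 = 0 :=
    cw_an w _ ((ContinuousLinearMap.fst ℂ (Fin n → Cn N) (Fin n → Cn N)).analyticAt 0) rfl
  have h2 : ∀ m ∈ rvP (cw w (fun u : (Fin n → Cn N) × (Fin n → Cn N) => u.2)),
      AnalyticAt ℂ m.2 0 ∧ m.2 0 = 0 :=
    rvP_an (cw_an w _ ((ContinuousLinearMap.snd ℂ (Fin n → Cn N) (Fin n → Cn N)).analyticAt 0) rfl)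
  have t1 : ∀ {ms : List (Bool × ((Fin n → Cn N) × (Fin n → Cn N) → Cn N))},
      (∀ m ∈ ms, AnalyticAt ℂ m.2 0 ∧ m.2 0 = 0) → ∀ m ∈ ms, Tendsto m.2 (𝓝 0) (𝓝 0) := by
    intro ms h m hm
    have := (h m hm).1.continuousAt.tendsto
    rwa [(h m hm).2] at this
  have h3 := g.run_tendsto _ (t1 h1) (tendsto_const_nhds (x := iot p))
  have h4 := g.run_R _ (t1 h1) (tendsto_const_nhds (x := iot p))
    (Eventually.of_forall fun _ => g.R0)
  have h5 := g.run_cancel _ (t1 h2) h3 h4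
  filter_upwards [h5] with u hu
  rw [ev_rvP, rv_rv, ev_cw, ev_cw] at hu
  rw [Cw, Lw, run_append]
  exact hu

lemma Cw_R {n : ℕ} (w : Fin n → Bool) :
    ∀ᶠ u in 𝓝 (0 : (Fin n → Cn N) × (Fin n → Cn N)), g.R (g.Cw w u) = 0 := by
  have hl := Lp_an w (ContinuousLinearMap.fst ℂ (Fin n → Cn N) (Fin n → Cn N))
    (ContinuousLinearMap.snd ℂ (Fin n → Cn N) (Fin n → Cn N))
  have := g.run_R _ (fun m hm => by
    have := (hl m hm).1.continuousAt.tendsto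
    rwa [(hl m hm).2] at this) (tendsto_const_nhds (x := iot p))
    (Eventually.of_forall fun _ => g.R0)
  filter_upwards [this] with u hu
  rw [ev_Lp] at hu
  exact hu

lemma Cw_diag {n : ℕ} (w : Fin n → Bool) :
    ∀ᶠ t in 𝓝 (0 : Fin n → Cn N), g.Cw w (t, t) = iot p := by
  have hl := cw_an (N := N) w (id : (Fin n → Cn N) → _) analyticAt_id rfl
  have := g.run_cancel _ (fun m hm => by
    have := (hl m hm).1.continuousAt.tendsto
    rwa [(hl m hm).2] at this) (tendsto_const_nhds (x := iot p))
    (Eventually.of_forall fun _ => g.R0)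
  filter_upwards [this] with u hu
  rw [ev_cw] at hu
  rw [Cw, Lw, run_append]
  exact hu

/-- flipped loop starting from anywhere; cancels on the diagonal -/
lemma Lw_diag {n : ℕ} (w w' : Fin n → Bool) :
    ∀ᶠ y in 𝓝 (0 : ((Fin n → Cn N) × (Fin n → Cn N)) × (Fin n → Cn N)),
      g.run (Lw w' y.2 y.2) (g.Cw w y.1) = g.Cw w y.1 := by
  set P := ((Fin n → Cn N) × (Fin n → Cn N)) × (Fin n → Cn N)
  have t1 : ∀ {ms : List (Bool × (P → Cn N))},
      (∀ m ∈ ms, AnalyticAt ℂ m.2 0 ∧ m.2 0 = 0) → ∀ m ∈ ms, Tendsto m.2 (𝓝 0) (𝓝 0) := by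
    intro ms h m hm
    have := (h m hm).1.continuousAt.tendsto
    rwa [(h m hm).2] at this
  have hl : ∀ m ∈ Lp w (fun y : P => y.1.1) (fun y : P => y.1.2), AnalyticAt ℂ m.2 0 ∧ m.2 0 = 0 :=
    Lp_an w ((ContinuousLinearMap.fst ℂ (Fin n → Cn N) (Fin n → Cn N)).comp
      (ContinuousLinearMap.fst ℂ ((Fin n → Cn N) × (Fin n → Cn N)) (Fin n → Cn N)))
      ((ContinuousLinearMap.snd ℂ (Fin n → Cn N) (Fin n → Cn N)).comp
      (ContinuousLinearMap.fst ℂ ((Fin n → Cn N) × (Fin n → Cn N)) (Fin n → Cn N)))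
  have h2 : ∀ m ∈ cw w' (fun y : P => y.2), AnalyticAt ℂ m.2 0 ∧ m.2 0 = 0 :=
    cw_an w' _ ((ContinuousLinearMap.snd ℂ ((Fin n → Cn N) × (Fin n → Cn N)) (Fin n → Cn N)).analyticAt 0) rfl
  have h3 := g.run_tendsto _ (t1 hl) (tendsto_const_nhds (x := iot p))
  have h4 := g.run_R _ (t1 hl) (tendsto_const_nhds (x := iot p))
    (Eventually.of_forall fun _ => g.R0)
  have h5 := g.run_cancel _ (t1 h2) h3 h4
  filter_upwards [h5] with y hy
  simp only [Set.mem_setOf_eq, ev_Lp, ev_cw] at hy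
  rw [Lw, run_append]
  exact hy

lemma rkC {r : ℕ} (hr : ∀ n, ∀ w : Fin n → Bool, ∀ᶠ t in 𝓝 (0 : Fin n → Cn N),
      rk (fderiv ℂ (g.Vw w) t) ≤ r)
    {n : ℕ} (w : Fin n → Bool) : ∀ᶠ u in 𝓝 (0 : (Fin n → Cn N) × (Fin n → Cn N)),
    AnalyticAt ℂ (g.Cw w) u ∧ rk (fderiv ℂ (g.Cw w) u) ≤ r := by
  have hl := Lp_an w (ContinuousLinearMap.fst ℂ (Fin n → Cn N) (Fin n → Cn N))
    (ContinuousLinearMap.snd ℂ (Fin n → Cn N) (Fin n → Cn N))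
  have := g.rank_param hr _ hl
  have e : (fun s => g.run (ev (Lp w (ContinuousLinearMap.fst ℂ (Fin n → Cn N) (Fin n → Cn N))
    (ContinuousLinearMap.snd ℂ (Fin n → Cn N) (Fin n → Cn N))) s) (iot p)) = g.Cw w := by
    funext s; rw [ev_Lp]; rfl
  rwa [e] at this

lemma rkE {r : ℕ} (hr : ∀ n, ∀ w : Fin n → Bool, ∀ᶠ t in 𝓝 (0 : Fin n → Cn N),
      rk (fderiv ℂ (g.Vw w) t) ≤ r)
    {n : ℕ} (w : Fin n → Bool) (b : Bool) :
    ∀ᶠ y in 𝓝 (0 : ((Fin n → Cn N) × (Fin n → Cn N)) × Cn N),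
    AnalyticAt ℂ (fun y : ((Fin n → Cn N) × (Fin n → Cn N)) × Cn N => g.mv b y.2 (g.Cw w y.1)) y ∧
      rk (fderiv ℂ (fun y : ((Fin n → Cn N) × (Fin n → Cn N)) × Cn N => g.mv b y.2 (g.Cw w y.1)) y) ≤ r := by
  set P := ((Fin n → Cn N) × (Fin n → Cn N)) × Cn N
  have hl : ∀ m ∈ Lp w (fun y : P => y.1.1) (fun y : P => y.1.2) ++ [(b, fun y : P => y.2)],
      AnalyticAt ℂ m.2 0 ∧ m.2 0 = 0 := by
    intro m hm
    rcases List.mem_append.1 hm with hm | hm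
    · exact Lp_an w ((ContinuousLinearMap.fst ℂ (Fin n → Cn N) (Fin n → Cn N)).comp
        (ContinuousLinearMap.fst ℂ ((Fin n → Cn N) × (Fin n → Cn N)) (Cn N)))
        ((ContinuousLinearMap.snd ℂ (Fin n → Cn N) (Fin n → Cn N)).comp
        (ContinuousLinearMap.fst ℂ ((Fin n → Cn N) × (Fin n → Cn N)) (Cn N))) m hm
    · rw [List.mem_singleton] at hm
      subst hm
      exact ⟨(ContinuousLinearMap.snd ℂ ((Fin n → Cn N) × (Fin n → Cn N)) (Cn N)).analyticAt 0, rfl⟩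
  have := g.rank_param hr _ hl
  have e : (fun s => g.run (ev (Lp w (fun y : P => y.1.1) (fun y : P => y.1.2) ++
      [(b, fun y : P => y.2)]) s) (iot p)) = fun y : P => g.mv b y.2 (g.Cw w y.1) := by
    funext s; rw [ev_append, ev_Lp, run_append]; rfl
  rwa [e] at this

lemma rkS {r : ℕ} (hr : ∀ n, ∀ w : Fin n → Bool, ∀ᶠ t in 𝓝 (0 : Fin n → Cn N),
      rk (fderiv ℂ (g.Vw w) t) ≤ r)
    {n : ℕ} (w w' : Fin n → Bool) :
    ∀ᶠ y in 𝓝 (0 : ((Fin n → Cn N) × (Fin n → Cn N)) × ((Fin n → Cn N) × (Fin n → Cn N))),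
    AnalyticAt ℂ (fun y : ((Fin n → Cn N) × (Fin n → Cn N)) × ((Fin n → Cn N) × (Fin n → Cn N)) =>
        g.run (Lw w' y.2.1 y.2.2) (g.Cw w y.1)) y ∧
      rk (fderiv ℂ (fun y : ((Fin n → Cn N) × (Fin n → Cn N)) × ((Fin n → Cn N) × (Fin n → Cn N)) =>
        g.run (Lw w' y.2.1 y.2.2) (g.Cw w y.1)) y) ≤ r := by
  set P := ((Fin n → Cn N) × (Fin n → Cn N)) × ((Fin n → Cn N) × (Fin n → Cn N))
  have hl : ∀ m ∈ Lp w (fun y : P => y.1.1) (fun y : P => y.1.2) ++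
      Lp w' (fun y : P => y.2.1) (fun y : P => y.2.2),
      AnalyticAt ℂ m.2 0 ∧ m.2 0 = 0 := by
    intro m hm
    rcases List.mem_append.1 hm with hm | hm
    · exact Lp_an w ((ContinuousLinearMap.fst ℂ (Fin n → Cn N) (Fin n → Cn N)).comp
        (ContinuousLinearMap.fst ℂ ((Fin n → Cn N) × (Fin n → Cn N)) ((Fin n → Cn N) × (Fin n → Cn N))))
        ((ContinuousLinearMap.snd ℂ (Fin n → Cn N) (Fin n → Cn N)).comp
        (ContinuousLinearMap.fst ℂ ((Fin n → Cn N) × (Fin n → Cn N)) ((Fin n → Cn N) × (Fin n → Cn N)))) m hm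
    · exact Lp_an w' ((ContinuousLinearMap.fst ℂ (Fin n → Cn N) (Fin n → Cn N)).comp
        (ContinuousLinearMap.snd ℂ ((Fin n → Cn N) × (Fin n → Cn N)) ((Fin n → Cn N) × (Fin n → Cn N))))
        ((ContinuousLinearMap.snd ℂ (Fin n → Cn N) (Fin n → Cn N)).comp
        (ContinuousLinearMap.snd ℂ ((Fin n → Cn N) × (Fin n → Cn N)) ((Fin n → Cn N) × (Fin n → Cn N)))) m hm
  have := g.rank_param hr _ hl
  have e : (fun s => g.run (ev (Lp w (fun y : P => y.1.1) (fun y : P => y.1.2) ++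
      Lp w' (fun y : P => y.2.1) (fun y : P => y.2.2)) s) (iot p)) =
      fun y : P => g.run (Lw w' y.2.1 y.2.2) (g.Cw w y.1) := by
    funext s; rw [ev_append, ev_Lp, ev_Lp, run_append]; rfl
  rwa [e] at this

/-- analyticity of a run in the starting point -/
lemma run_start_an {n : ℕ} (w : Fin n → Bool) : ∀ᶠ t in 𝓝 (0 : Fin n → Cn N),
    AnalyticAt ℂ (fun x => g.run (List.ofFn fun i => (w i, t i)) x) (iot p) := by
  have h1 := (g.run_an (P := (Fin n → Cn N) × Bn N) (s0 := (0, iot p))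
    (cw w (fun y => y.1)) (x := fun y => y.2)
    (cw_an w _ ((ContinuousLinearMap.fst ℂ (Fin n → Cn N) (Bn N)).analyticAt _) rfl)
    ((ContinuousLinearMap.snd ℂ (Fin n → Cn N) (Bn N)).analyticAt _) rfl).1
  have h2 : Tendsto (fun t : Fin n → Cn N => (t, iot p)) (𝓝 0) (𝓝 (0, iot p)) :=
    tendsto_id.prodMk_nhds tendsto_const_nhds
  filter_upwards [h2.eventually h1.eventually_analyticAt] with t ht
  have := AnalyticAt.fun_comp (f := fun x : Bn N => (t, x)) (x := iot p) ht
    (AnalyticAt.prod analyticAt_const analyticAt_id)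
  refine this.congr (Eventually.of_forall fun x => ?_)
  simp only [ev_cw]

end Geo
end part10

section part11
open Filter
namespace Geo

variable {N d : ℕ} {M : Set (Cn N)} {p : Cn N} (g : Geo N d M p)

lemma fderiv_slice_snd {A B F : Type} [NormedAddCommGroup A] [NormedSpace ℂ A]
    [NormedAddCommGroup B] [NormedSpace ℂ B] [NormedAddCommGroup F] [NormedSpace ℂ F]
    {E : A × B → F} {a : A} {b : B} (hE : DifferentiableAt ℂ E (a, b)) :
    HasFDerivAt (fun y => E (a, y)) ((fderiv ℂ E (a, b)).comp (ContinuousLinearMap.inr ℂ A B)) b :=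
  hE.hasFDerivAt.comp b (hasFDerivAt_prodMk_right a b)

lemma orbit {r : ℕ} (hr : ∀ n, ∀ w : Fin n → Bool, ∀ᶠ t in 𝓝 (0 : Fin n → Cn N),
      rk (fderiv ℂ (g.Vw w) t) ≤ r)
    {n : ℕ} (w : Fin n → Bool) (hw : ∃ᶠ t in 𝓝 (0 : Fin n → Cn N), r ≤ rk (fderiv ℂ (g.Vw w) t)) :
    ∃ (π : Bn N →L[ℂ] Bn N) (φ : Bn N → Bn N),
      (∀ x, π (π x) = π x) ∧ (∀ x, π (sg x) = sg (π x)) ∧ rk π = r ∧ AnalyticAt ℂ φ 0 ∧ φ 0 = 0 ∧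
      (∀ y, π (φ y) = 0) ∧ (∀ y, φ (π y) = φ y) ∧
      (∀ᶠ y in 𝓝 (0 : Bn N), g.R (iot p + π y + φ y) = 0) ∧
      (∀ b, ∀ᶠ z : Cn N × Bn N in 𝓝 (0, iot p), onW p π φ z.2 → onW p π φ (g.mv b z.1 z.2)) ∧
      (∀ᶠ x in 𝓝 (iot p), onW p π φ x → onW p π φ (sg x)) := by
  set T := Fin n → Cn N
  set w' : Fin n → Bool := fun i => !w i
  -- tendsto maps
  have td : Tendsto (fun t : T => (t, t)) (𝓝 0) (𝓝 (0 : T × T)) :=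
    tendsto_id.prodMk_nhds tendsto_id
  have tE : Tendsto (fun t : T => ((t, t), (0 : Cn N))) (𝓝 0) (𝓝 (0 : (T × T) × Cn N)) :=
    td.prodMk_nhds tendsto_const_nhds
  have tc : Tendsto (fun t : T => cjT n t) (𝓝 0) (𝓝 (0 : T)) := by
    have := (cjT (N := N) n).continuous.tendsto 0
    rwa [map_zero] at this
  have tS : Tendsto (fun t : T => ((t, t), (cjT n t, cjT n t))) (𝓝 0) (𝓝 (0 : (T × T) × (T × T))) :=
    td.prodMk_nhds (tc.prodMk_nhds tc)
  have tD : Tendsto (fun t : T => ((t, t), cjT n t)) (𝓝 0) (𝓝 (0 : (T × T) × T)) :=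
    td.prodMk_nhds tc
  obtain ⟨t0, hrk0, hVan, hC0, hKC, hKR, hsp, hst, hEt, hEf, hS, hdg⟩ :=
    (hw.and_eventually ((g.Vw_an w).eventually_analyticAt.and ((g.Cw_diag w).and
      ((td.eventually (g.rkC hr w).eventually_nhds).and
      ((td.eventually (g.Cw_R w).eventually_nhds).and
      ((td.eventually (g.Vw_split w).eventually_nhds).and
      ((g.run_start_an w).and
      ((tE.eventually (g.rkE hr w true).eventually_nhds).and
      ((tE.eventually (g.rkE hr w false).eventually_nhds).and
      ((tS.eventually (g.rkS hr w w').eventually_nhds).and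
      (tD.eventually (g.Lw_diag w w').eventually_nhds))))))))))).exists
  have hE : ∀ b, ∀ᶠ y in 𝓝 (((t0, t0), (0 : Cn N)) : (T × T) × Cn N),
      AnalyticAt ℂ (fun y : (T × T) × Cn N => g.mv b y.2 (g.Cw w y.1)) y ∧
      rk (fderiv ℂ (fun y : (T × T) × Cn N => g.mv b y.2 (g.Cw w y.1)) y) ≤ r := by
    intro b; cases b
    · exact hEf
    · exact hEt
  -- the map C
  set C : T → Bn N := fun t => g.Cw w (t, t0) with hC
  have hCt0 : C t0 = iot p := hC0
  have aj : AnalyticAt ℂ (fun t : T => (t, t0)) t0 := AnalyticAt.prod analyticAt_id analyticAt_const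
  have ctj : Tendsto (fun t : T => (t, t0)) (𝓝 t0) (𝓝 (t0, t0)) := aj.continuousAt.tendsto
  obtain ⟨hCan, hCrk⟩ := slice_rank hKC aj rfl
  change AnalyticAt ℂ C t0 at hCan
  change ∀ᶠ t in 𝓝 t0, rk (fderiv ℂ C t) ≤ r at hCrk
  have hCR : ∀ᶠ t in 𝓝 t0, g.R (C t) = 0 := ctj.eventually hKR
  have hCge : r ≤ rk (fderiv ℂ C t0) := by
    have h1 : ∀ᶠ t in 𝓝 t0, g.Vw w t = g.run (List.ofFn fun i => (w i, t0 i)) (C t) := by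
      filter_upwards [ctj.eventually hsp] with t ht
      exact ht.symm
    have h2 : fderiv ℂ (g.Vw w) t0 = _ :=
      Filter.EventuallyEq.fderiv_eq (f₁ := g.Vw w)
        (f := fun t => g.run (List.ofFn fun i => (w i, t0 i)) (C t)) h1
    rw [h2] at hrk0
    rw [fderiv_comp' (f := C) (g := fun x => g.run (List.ofFn fun i => (w i, t0 i)) x) t0
      (by rw [hCt0]; exact hst.differentiableAt) hCan.differentiableAt] at hrk0
    exact hrk0.trans (rk_comp_le' _ _)
  have hCeq : rk (fderiv ℂ C t0) = r := le_antisymm hCrk.self_of_nhds hCge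
  -- the maps E_b
  set E : Bool → T × Cn N → Bn N := fun b y => g.mv b y.2 (C y.1) with hEdef
  have ajE : AnalyticAt ℂ (fun y : T × Cn N => ((y.1, t0), y.2)) (t0, 0) :=
    AnalyticAt.prod (AnalyticAt.prod ((ContinuousLinearMap.fst ℂ T (Cn N)).analyticAt _)
      analyticAt_const) ((ContinuousLinearMap.snd ℂ T (Cn N)).analyticAt _)
  have hE1 : ∀ b, AnalyticAt ℂ (E b) (t0, 0) ∧ ∀ᶠ y in 𝓝 (t0, (0 : Cn N)), rk (fderiv ℂ (E b) y) ≤ r :=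
    fun b => slice_rank (hE b) ajE rfl
  have hE0 : ∀ b, E b (t0, 0) = iot p := fun b => by
    change g.mv b 0 (C t0) = _
    rw [hCt0, mv_p]
  have hCtend : Tendsto C (𝓝 t0) (𝓝 (iot p)) := by
    have := hCan.continuousAt.tendsto; rwa [hCt0] at this
  have hCE : ∀ b, ∀ᶠ t in 𝓝 t0, C t = E b (t, 0) := fun b => by
    filter_upwards [hCR, hCtend.eventually (g.mv_zero b)] with t h1 h2
    exact (h2 h1).symm
  have aj0 : AnalyticAt ℂ (fun t : T => (t, (0 : Cn N))) t0 := AnalyticAt.prod analyticAt_id analyticAt_const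
  -- the map E_σ
  set Es : T × T → Bn N := fun y => g.run (Lw w' y.2 (cjT n t0)) (C y.1) with hEs
  have ajS : AnalyticAt ℂ (fun y : T × T => ((y.1, t0), (y.2, cjT n t0))) (t0, cjT n t0) :=
    AnalyticAt.prod (AnalyticAt.prod ((ContinuousLinearMap.fst ℂ T T).analyticAt _)
      analyticAt_const) (AnalyticAt.prod ((ContinuousLinearMap.snd ℂ T T).analyticAt _) analyticAt_const)
  obtain ⟨hSan, hSrk⟩ := slice_rank hS ajS rfl
  change AnalyticAt ℂ Es (t0, cjT n t0) at hSan
  change ∀ᶠ y in 𝓝 (t0, cjT n t0), rk (fderiv ℂ Es y) ≤ r at hSrk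
  have hEsC : ∀ t, Es (t0, cjT n t) = sg (C t) := fun t => by
    change g.run (Lw w' (cjT n t) (cjT n t0)) (C t0) = sg (g.run (Lw w t t0) (iot p))
    rw [run_sg, fl_Lw, hCt0, sg_iot]
  have hEs0 : Es (t0, cjT n t0) = iot p := by rw [hEsC, hCt0, sg_iot]
  have ajc : AnalyticAt ℂ (fun t : T => (t, cjT n t0)) t0 := AnalyticAt.prod analyticAt_id analyticAt_const
  have hCEs : ∀ᶠ t in 𝓝 t0, C t = Es (t, cjT n t0) := by
    have h1 : Tendsto (fun t : T => ((t, t0), cjT n t0)) (𝓝 t0) (𝓝 ((t0, t0), cjT n t0)) :=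
      ctj.prodMk_nhds tendsto_const_nhds
    filter_upwards [h1.eventually hdg] with t ht
    exact ht.symm
  have hrS := range_slice hSan.differentiableAt ajc.differentiableAt rfl hCEs hSrk.self_of_nhds hCge
  have hrE := fun b => range_slice (hE1 b).1.differentiableAt aj0.differentiableAt rfl (hCE b)
    (hE1 b).2.self_of_nhds hCge
  -- symmetry of the tangent space
  have hsgT : ∀ x ∈ LinearMap.range (fderiv ℂ C t0 : T →ₗ[ℂ] Bn N),
      sg x ∈ LinearMap.range (fderiv ℂ C t0 : T →ₗ[ℂ] Bn N) := by
    rintro _ ⟨u, rfl⟩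
    rw [hrS]
    refine ⟨(0, cjT n u), ?_⟩
    have d1 : HasFDerivAt (fun t => Es (t0, cjT n t))
        ((((fderiv ℂ Es (t0, cjT n t0)).comp (ContinuousLinearMap.inr ℂ T T)).restrictScalars ℝ).comp
          (cjT (N := N) n)) t0 :=
      HasFDerivAt.comp t0 ((fderiv_slice_snd hSan.differentiableAt).restrictScalars ℝ)
        (cjT (N := N) n).hasFDerivAt
    have d2 : HasFDerivAt (fun t => sg (C t)) (sg.comp ((fderiv ℂ C t0).restrictScalars ℝ)) t0 :=
      HasFDerivAt.comp t0 sg.hasFDerivAt (hCan.differentiableAt.hasFDerivAt.restrictScalars ℝ)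
    have e : (fun t => Es (t0, cjT n t)) = fun t => sg (C t) := funext hEsC
    rw [e] at d1
    have := congrArg (fun L => L u) (d1.unique d2)
    exact this
  obtain ⟨π, hπ, hπs, hπr⟩ := exists_proj _ hsgT
  have hrkπ : rk π = r := by
    unfold rk; rw [hπr]; exact hCeq
  obtain ⟨φ, sec, hφan, hφ0, hφ1, hφ2, hsc, hsc0, -, hCs⟩ :=
    const_rank hCan hCt0 π hπ hπr (by rw [hrkπ]; exact hCrk)
  have hEW : ∀ b, ∀ᶠ y in 𝓝 (t0, (0 : Cn N)), onW p π φ (E b y) := fun b =>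
    graph_compare (hE1 b).1 (hE0 b) π hπ (hπr.trans (hrE b)) (by rw [hrkπ]; exact (hE1 b).2)
      hφ1 hsc hsc0 hCs aj0.continuousAt rfl (hCE b)
  have hSW : ∀ᶠ y in 𝓝 (t0, cjT n t0), onW p π φ (Es y) :=
    graph_compare hSan hEs0 π hπ (hπr.trans hrS) (by rw [hrkπ]; exact hSrk)
      hφ1 hsc hsc0 hCs ajc.continuousAt rfl hCEs
  have tsec : Tendsto sec (𝓝 0) (𝓝 t0) := by
    have := hsc.tendsto; rwa [hsc0] at this
  have tx : Tendsto (fun x : Bn N => x - iot p) (𝓝 (iot p)) (𝓝 0) := by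
    have := (tendsto_id (x := 𝓝 (iot p))).sub_const (iot p)
    rw [sub_self] at this
    exact this
  have hWC : ∀ᶠ x in 𝓝 (iot p), onW p π φ x → C (sec (x - iot p)) = x := by
    filter_upwards [tx.eventually hCs] with x hx h
    rw [hx, ← h]; abel
  refine ⟨π, φ, hπ, hπs, hrkπ, hφan, hφ0, hφ1, hφ2, ?_, ?_, ?_⟩
  · filter_upwards [hCs, tsec.eventually hCR] with y h1 h2
    rw [← h1, h2]
  · intro b
    have t1 : Tendsto (fun z : Cn N × Bn N => z.2) (𝓝 (0, iot p)) (𝓝 (iot p)) :=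
      continuous_snd.tendsto _
    have t2 : Tendsto (fun z : Cn N × Bn N => z.1) (𝓝 (0, iot p)) (𝓝 0) :=
      continuous_fst.tendsto _
    have t3 := ((tsec.comp tx).comp t1).prodMk_nhds t2
    filter_upwards [t3.eventually (hEW b), t1.eventually hWC] with z h1 h2 h3
    have h4 := h2 h3
    have : E b (sec (z.2 - iot p), z.1) = g.mv b z.1 z.2 := by
      change g.mv b z.1 (C (sec (z.2 - iot p))) = _
      rw [h4]
    rw [← this]; exact h1
  · have t3 : Tendsto (fun x : Bn N => (t0, cjT n (sec (x - iot p)))) (𝓝 (iot p)) (𝓝 (t0, cjT n t0)) :=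
      tendsto_const_nhds.prodMk_nhds (((cjT n).continuous.tendsto _).comp (tsec.comp tx))
    filter_upwards [t3.eventually hSW, hWC] with x h1 h2 h3
    rw [hEsC, h2 h3] at h1
    exact h1

end Geo
end part11

section part12
open Filter

lemma mem_tangentCone_of_curve {E : Type} [NormedAddCommGroup E] [NormedSpace ℝ E] {S : Set E}
    {γ : ℝ → E} {v : E} (hd : HasDerivAt γ v 0) (hS : ∀ᶠ s in 𝓝 (0 : ℝ), γ s ∈ S) :
    v ∈ tangentConeAt ℝ S (γ 0) := by
  refine mem_tangentConeAt_of_seq (𝓝[≠] (0 : ℝ)) (fun s => s⁻¹) (fun s => γ s - γ 0) ?_ ?_ ?_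
  · have := (hd.continuousAt.tendsto.sub_const (γ 0)).mono_left (nhdsWithin_le_nhds (s := {0}ᶜ))
    simpa using this
  · filter_upwards [nhdsWithin_le_nhds hS] with s hs
    have : γ 0 + (γ s - γ 0) = γ s := by abel
    rw [this]; exact hs
  · have := hasDerivAt_iff_tendsto_slope.1 hd
    refine this.congr fun s => ?_
    rw [slope_def_module]; simp

lemma fderiv_tangent {E F : Type} [NormedAddCommGroup E] [NormedSpace ℝ E] [NormedAddCommGroup F]
    [NormedSpace ℝ F] {S : Set E} {f : E → F} {f' : E →L[ℝ] F} {q : E} (hf : HasFDerivAt f f' q)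
    (hq : q ∈ S) (h0 : ∀ᶠ z in 𝓝 q, z ∈ S → f z = 0) : ∀ v ∈ tangentSpaceAt S q, f' v = 0 := by
  have hfq : f q = 0 := h0.self_of_nhds hq
  have h1 : HasFDerivWithinAt f (0 : E →L[ℝ] F) S q := by
    have : HasFDerivWithinAt (fun _ => (0 : F)) (0 : E →L[ℝ] F) S q := hasFDerivWithinAt_const _ _ _
    refine this.congr_of_eventuallyEq ?_ hfq
    filter_upwards [nhdsWithin_le_nhds h0, self_mem_nhdsWithin] with z h1 h2 using h1 h2
  have h2 := hf.hasFDerivWithinAt.unique_on h1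
  have h3 : tangentSpaceAt S q ≤ LinearMap.ker (f' : E →ₗ[ℝ] F) := by
    apply Submodule.span_le.2
    intro v hv
    exact h2 hv
  exact fun v hv => h3 hv

namespace Geo

variable {N d : ℕ} {M : Set (Cn N)} {p : Cn N} (g : Geo N d M p)

/-- defining function of the graph -/
def Fw (p : Cn N) (π : Bn N →L[ℂ] Bn N) (φ : Bn N → Bn N) (x : Bn N) : Bn N :=
  (x - iot p) - π (x - iot p) - φ (x - iot p)

lemma onW_iff {π : Bn N →L[ℂ] Bn N} {φ : Bn N → Bn N} {x : Bn N} :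
    onW p π φ x ↔ Fw p π φ x = 0 := by
  rw [onW, Fw, sub_eq_zero]

lemma Fw_pi {π : Bn N →L[ℂ] Bn N} {φ : Bn N → Bn N} (hπ : ∀ x, π (π x) = π x)
    (hφ1 : ∀ y, π (φ y) = 0) (x : Bn N) : π (Fw p π φ x) = 0 := by
  rw [Fw, map_sub, map_sub, hπ, hφ1]; simp

lemma onW_xi {π : Bn N →L[ℂ] Bn N} {φ : Bn N → Bn N} (hπ : ∀ x, π (π x) = π x)
    (hφ1 : ∀ y, π (φ y) = 0) (hφ2 : ∀ y, φ (π y) = φ y) (y : Bn N) :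
    onW p π φ (iot p + π y + φ y) := by
  have e : iot p + π y + φ y - iot p = π y + φ y := by abel
  have e2 : π (π y + φ y) = π y := by rw [map_add, hπ, hφ1, add_zero]
  rw [onW, e, e2, ← hφ2 (π y + φ y), e2, hφ2]; abel

lemma Fw_sg {π : Bn N →L[ℂ] Bn N} {φ : Bn N → Bn N} (hπ : ∀ x, π (π x) = π x)
    (hπs : ∀ x, π (sg x) = sg (π x)) (hφan : AnalyticAt ℂ φ 0) (hφ0 : φ 0 = 0)
    (hφ1 : ∀ y, π (φ y) = 0) (hφ2 : ∀ y, φ (π y) = φ y)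
    (hs : ∀ᶠ x in 𝓝 (iot p), onW p π φ x → onW p π φ (sg x)) :
    ∀ᶠ x in 𝓝 (iot p), Fw p π φ (sg x) = sg (Fw p π φ x) := by
  have tx : Tendsto (fun x : Bn N => x - iot p) (𝓝 (iot p)) (𝓝 0) := by
    have := (tendsto_id (x := 𝓝 (iot p))).sub_const (iot p)
    rw [sub_self] at this
    exact this
  have tφ : Tendsto φ (𝓝 0) (𝓝 0) := by
    have := hφan.continuousAt.tendsto; rwa [hφ0] at this
  have ty : Tendsto (fun y : Bn N => iot p + π y + φ y) (𝓝 0) (𝓝 (iot p)) := by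
    have h1 : Tendsto π (𝓝 0) (𝓝 0) := by
      have := π.continuous.tendsto 0; rwa [map_zero] at this
    have := (h1.const_add (iot p)).add tφ
    simpa using this
  have hφs : ∀ᶠ y in 𝓝 (0 : Bn N), φ (sg y) = sg (φ y) := by
    filter_upwards [ty.eventually hs] with y hy
    have h1 := hy (onW_xi hπ hφ1 hφ2 y)
    have e : sg (iot p + π y + φ y) - iot p = π (sg y) + sg (φ y) := by
      rw [map_add, map_add, sg_iot, hπs]; abel
    have e2 : π (π (sg y) + sg (φ y)) = π (sg y) := by
      rw [map_add, hπ, hπs (φ y), hφ1, map_zero, add_zero]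
    rw [onW, e, e2, ← hφ2 (_ + _), e2, hφ2] at h1
    rw [← h1]; abel
  filter_upwards [tx.eventually hφs] with x hx
  have e : sg x - iot p = sg (x - iot p) := by rw [map_sub, sg_iot]
  rw [Fw, Fw, e, hπs, hx, map_sub sg (_ - _), map_sub sg (x - iot p) (π _)]

end Geo

/-- The real form of `ker π` -/
def realKer {N : ℕ} (π : Bn N →L[ℂ] Bn N) : Submodule ℝ (Bn N) where
  carrier := {b | π b = 0 ∧ sg b = b}
  add_mem' := by
    rintro a b ⟨h1, h2⟩ ⟨h3, h4⟩
    exact ⟨by rw [map_add, h1, h3, add_zero], by rw [map_add, h2, h4]⟩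
  zero_mem' := ⟨map_zero _, map_zero _⟩
  smul_mem' := by
    rintro c b ⟨h1, h2⟩
    exact ⟨by rw [← Complex.coe_smul, map_smul, h1, smul_zero], by rw [map_smul, h2]⟩

lemma finrank_realKer_le {N : ℕ} (π : Bn N →L[ℂ] Bn N) :
    Module.finrank ℝ (realKer π) ≤ 2 * N := by
  have h : Module.finrank ℝ (Cn N) = 2 * N := by
    rw [finrank_real_of_complex, finrank_euclideanSpace_fin]
  rw [← h]
  let f : realKer π →ₗ[ℝ] Cn N := (LinearMap.fst ℝ (Cn N) (Cn N)) ∘ₗ (realKer π).subtype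
  refine LinearMap.finrank_le_finrank_of_injective (f := f) ?_
  intro a b hab
  have hab : (a : Bn N).1 = (b : Bn N).1 := hab
  ext1
  rw [sg_fixed a.2.2, sg_fixed b.2.2, hab]

lemma finrank_realKer_ge {N : ℕ} (π : Bn N →L[ℂ] Bn N) (hπs : ∀ x, π (sg x) = sg (π x)) :
    2 * N ≤ Module.finrank ℝ (realKer π) + rk π := by
  have hB : Module.finrank ℂ (Bn N) = 2 * N := by
    rw [Module.finrank_prod, finrank_euclideanSpace_fin]; ring
  have h1 := LinearMap.finrank_range_add_finrank_ker (π : Bn N →ₗ[ℂ] Bn N)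
  rw [hB] at h1
  set bs := Module.finBasis ℝ (realKer π)
  have h2 : LinearMap.ker (π : Bn N →ₗ[ℂ] Bn N) ≤
      Submodule.span ℂ (Set.range fun i => (bs i : Bn N)) := by
    have hV : ∀ b ∈ realKer π, b ∈ Submodule.span ℂ (Set.range fun i => (bs i : Bn N)) := by
      intro b hb
      have := congrArg Subtype.val (bs.sum_repr ⟨b, hb⟩)
      simp only [Submodule.coe_sum, Submodule.coe_smul] at this
      rw [← this]
      refine Submodule.sum_mem _ fun i _ => ?_
      rw [← Complex.coe_smul]
      exact Submodule.smul_mem _ _ (Submodule.subset_span ⟨i, rfl⟩)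
    intro b hb
    have hb : π b = 0 := hb
    have hsb : π (sg b) = 0 := by rw [hπs, hb, map_zero]
    have e : b = (1/2 : ℂ) • (b + sg b) + (1/2 : ℂ) • (- I) • (I • b + sg (I • b)) := by
      have : sg (I • b) = - (I • sg b) := by rw [sg_smul]; simp
      rw [this, smul_add, smul_add, smul_add, smul_neg, smul_smul (-I) I, smul_smul (-I) I]
      simp only [neg_mul, I_mul_I, neg_neg, one_smul]
      have : (1/2 : ℂ) • b + (1/2 : ℂ) • b = b := by rw [← add_smul]; norm_num
      rw [smul_neg]
      nth_rw 1 [← this]; abel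
    rw [e]
    refine Submodule.add_mem _ (Submodule.smul_mem _ _ (hV _ ⟨?_, ?_⟩))
      (Submodule.smul_mem _ _ (Submodule.smul_mem _ _ (hV _ ⟨?_, ?_⟩)))
    · rw [map_add, hb, hsb, add_zero]
    · rw [map_add, sg_sg, add_comm]
    · rw [map_add, hπs, map_smul, hb, smul_zero, map_zero, add_zero]
    · rw [map_add, sg_sg, add_comm]
  have h3 := Submodule.finrank_mono h2
  have h4 := finrank_range_le_card (R := ℂ) (fun i => (bs i : Bn N))
  rw [Fintype.card_fin] at h4
  unfold Set.finrank at h4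
  unfold rk
  omega
end part12

section part13
open Filter
namespace Geo

variable {N d : ℕ} {M : Set (Cn N)} {p : Cn N} (g : Geo N d M p)

lemma Fw_an {π : Bn N →L[ℂ] Bn N} {φ : Bn N → Bn N} (hφan : AnalyticAt ℂ φ 0) :
    AnalyticAt ℂ (Fw p π φ) (iot p) := by
  have h1 : AnalyticAt ℂ (fun x : Bn N => x - iot p) (iot p) := analyticAt_id.sub analyticAt_const
  have h2 : AnalyticAt ℂ (fun x : Bn N => π (x - iot p)) (iot p) := (π.analyticAt _).fun_comp h1
  have h3 : AnalyticAt ℂ (fun x : Bn N => φ (x - iot p)) (iot p) :=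
    AnalyticAt.fun_comp (g := φ) (f := fun x : Bn N => x - iot p) (by simpa using hφan) h1
  exact (h1.sub h2).sub h3

/-- derivative of the defining function on `ker π` -/
lemma Fw_fderiv {π : Bn N →L[ℂ] Bn N} {φ : Bn N → Bn N} (hφ2 : ∀ y, φ (π y) = φ y)
    {x b : Bn N} (hx : AnalyticAt ℂ (Fw p π φ) x) (hb : π b = 0) :
    fderiv ℂ (Fw p π φ) x b = b := by
  have h1 : HasDerivAt (fun s : ℂ => Fw p π φ (x + s • b)) (fderiv ℂ (Fw p π φ) x b) 0 := by
    have := hx.differentiableAt.hasFDerivAt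
    have h2 : HasDerivAt (fun s : ℂ => x + s • b) b 0 := by
      simpa using ((hasDerivAt_id (0 : ℂ)).smul_const b).const_add x
    have h3 : HasFDerivAt (Fw p π φ) (fderiv ℂ (Fw p π φ) x) (x + (0 : ℂ) • b) := by simpa using this
    exact h3.comp_hasDerivAt (0 : ℂ) h2
  have h2 : (fun s : ℂ => Fw p π φ (x + s • b)) = fun s => Fw p π φ x + s • b := by
    funext s
    have e : x + s • b - iot p = (x - iot p) + s • b := by abel
    have e2 : π (x + s • b - iot p) = π (x - iot p) := by
      rw [e, map_add, map_smul, hb, smul_zero, add_zero]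
    rw [Fw, e2, ← hφ2, e2, hφ2, e, Fw]; abel
  rw [h2] at h1
  have h3 : HasDerivAt (fun s : ℂ => Fw p π φ x + s • b) b 0 := by
    simpa using ((hasDerivAt_id (0 : ℂ)).smul_const b).const_add (Fw p π φ x)
  exact h1.unique h3

/-- tangency of the moves to the graph -/
lemma Fw_tangent {π : Bn N →L[ℂ] Bn N} {φ : Bn N → Bn N} (hφan : AnalyticAt ℂ φ 0)
    (hmv : ∀ᶠ z : Cn N × Bn N in 𝓝 (0, iot p), onW p π φ z.2 → onW p π φ (g.mv true z.1 z.2)) :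
    ∀ᶠ x in 𝓝 (iot p), g.R x = 0 → onW p π φ x → ∀ v, fderiv ℂ g.R x (v, 0) = 0 →
      fderiv ℂ (Fw p π φ) x (v, 0) = 0 := by
  have t1 : Tendsto (fun x : Bn N => ((0 : Cn N), x)) (𝓝 (iot p)) (𝓝 (0, iot p)) :=
    tendsto_const_nhds.prodMk_nhds tendsto_id
  filter_upwards [t1.eventually hmv.eventually_nhds, g.l_der, g.l_an.eventually_analyticAt,
    (Fw_an (p := p) (π := π) hφan).eventually_analyticAt, g.l_id] with x h1 h2 h3 h4 h5 hR hW v hv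
  have hl := h2 hR _ hv
  have d1 : HasDerivAt (fun s : ℂ => x + ((s • v, 0) : Bn N)) ((v, 0) : Bn N) 0 := by
    have := ((hasDerivAt_id (0 : ℂ)).smul_const ((v, 0) : Bn N)).const_add x
    simpa using this
  have e0 : x + (((0 : ℂ) • v, 0) : Bn N) = x := by simp [add00]
  have d2 : HasDerivAt (fun s : ℂ => g.l (x + ((s • v, 0) : Bn N))) 0 0 := by
    have h : HasFDerivAt g.l (fderiv ℂ g.l x) (x + (((0 : ℂ) • v, 0) : Bn N)) := by
      rw [e0]; exact h3.differentiableAt.hasFDerivAt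
    have := h.comp_hasDerivAt (0 : ℂ) d1
    rw [hl] at this
    exact this
  have d3 : HasDerivAt (fun s : ℂ => g.mv true (s • v) x) ((v, 0) : Bn N) 0 := by
    have := d1.add ((ilC g.D).hasFDerivAt.comp_hasDerivAt (0 : ℂ) d2)
    simp only [map_zero, add_zero] at this
    exact this
  have e1 : g.mv true ((0 : ℂ) • v) x = x := by
    rw [mv, Ps, e0, h5 hR]; simp [add00]
  have d4 : HasDerivAt (fun s : ℂ => Fw p π φ (g.mv true (s • v) x))
      (fderiv ℂ (Fw p π φ) x (v, 0)) 0 := by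
    have h : HasFDerivAt (Fw p π φ) (fderiv ℂ (Fw p π φ) x) (g.mv true ((0 : ℂ) • v) x) := by
      rw [e1]; exact h4.differentiableAt.hasFDerivAt
    exact h.comp_hasDerivAt (0 : ℂ) d3
  have t2 : Tendsto (fun s : ℂ => (s • v, x)) (𝓝 0) (𝓝 (0, x)) := by
    have : Continuous (fun s : ℂ => (s • v, x)) := by fun_prop
    simpa using this.tendsto 0
  have d5 : HasDerivAt (fun s : ℂ => Fw p π φ (g.mv true (s • v) x)) 0 0 := by
    refine (hasDerivAt_const (0 : ℂ) (0 : Bn N)).congr_of_eventuallyEq ?_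
    filter_upwards [t2.eventually h1] with s hs
    exact onW_iff.1 (hs hW)
  exact d4.unique d5

lemma not_minimal {r : ℕ} (hrd : r + d < 2 * N) {π : Bn N →L[ℂ] Bn N} {φ : Bn N → Bn N}
    (hπ : ∀ x, π (π x) = π x) (hπs : ∀ x, π (sg x) = sg (π x)) (hrk : rk π = r)
    (hφan : AnalyticAt ℂ φ 0) (hφ0 : φ 0 = 0)
    (hφ1 : ∀ y, π (φ y) = 0) (hφ2 : ∀ y, φ (π y) = φ y)
    (hRW : ∀ᶠ y in 𝓝 (0 : Bn N), g.R (iot p + π y + φ y) = 0)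
    (hmv : ∀ b, ∀ᶠ z : Cn N × Bn N in 𝓝 (0, iot p), onW p π φ z.2 → onW p π φ (g.mv b z.1 z.2))
    (hs : ∀ᶠ x in 𝓝 (iot p), onW p π φ x → onW p π φ (sg x)) : ¬ IsMinimalAt M d p := by
  intro hmin
  apply hmin
  have hFan := Fw_an (p := p) (π := π) hφan
  have hFs := Fw_sg hπ hπs hφan hφ0 hφ1 hφ2 hs
  have hFt := g.Fw_tangent hφan (hmv true)
  have ti : Tendsto (iot : Cn N → Bn N) (𝓝 p) (𝓝 (iot p)) := iot.continuous.tendsto p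
  have tx : Tendsto (fun x : Bn N => x - iot p) (𝓝 (iot p)) (𝓝 0) := by
    have := (tendsto_id (x := 𝓝 (iot p))).sub_const (iot p)
    rw [sub_self] at this
    exact this
  obtain ⟨δ, hδ, hball⟩ := Metric.eventually_nhds_iff_ball.1
    (g.loc.eventually_nhds.and (((tx.comp ti).eventually hRW).and
      ((ti.eventually hFan.eventually_analyticAt).and ((ti.eventually hFs.eventually_nhds).and
      ((ti.eventually hFt).and (ti.eventually g.an.eventually_analyticAt))))))
  set F := Fw p π φ with hF
  set S : Set (Cn N) := {q | q ∈ Metric.ball p δ ∧ onW p π φ (iot q)} with hSdef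
  have hSM : S ⊆ M := by
    rintro q ⟨hq, hW⟩
    obtain ⟨h1, h2, -⟩ := hball q hq
    refine h1.self_of_nhds.2 ?_
    have : iot p + π (iot q - iot p) + φ (iot q - iot p) = iot q := by
      rw [← hW]; abel
    rw [← this]; exact h2
  have hpS : p ∈ S := ⟨Metric.mem_ball_self hδ, by simp [onW, hφ0]⟩
  set V := realKer π with hV
  set c := Module.finrank ℝ V with hc
  have hc1 : c ≤ 2 * N := finrank_realKer_le π
  have hc2 := finrank_realKer_ge π hπs
  change _ ≤ c + _ at hc2
  refine ⟨S, 2 * N - c, hSM, hpS, by omega, ?_, ?_⟩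
  · intro q hq
    obtain ⟨κ, hκ⟩ := V.subtype.exists_leftInverse_of_injective (by simp)
    have hκ' : ∀ b (hb : b ∈ V), κ b = ⟨b, hb⟩ := fun b hb => by
      have := congrArg (fun L => L ⟨b, hb⟩) hκ
      exact this
    set bs := Module.finBasis ℝ V
    let co : Fin c → (Bn N →L[ℝ] ℝ) := fun k => LinearMap.toContinuousLinearMap ((bs.coord k) ∘ₗ κ)
    have hco : ∀ k b, co k b = bs.repr (κ b) k := fun k b => rfl
    have hFV : ∀ z ∈ Metric.ball p δ, F (iot z) ∈ V := by
      intro z hz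
      obtain ⟨-, -, -, h4, -⟩ := hball z hz
      refine ⟨Fw_pi hπ hφ1 _, ?_⟩
      have := h4.self_of_nhds
      rw [sg_iot] at this
      exact this.symm
    refine ⟨c, Metric.ball p δ, fun z k => co k (F (iot z)), Metric.isOpen_ball, hq.1, ?_, ?_, ?_, ?_⟩
    · rw [finrank_real_of_complex, finrank_euclideanSpace_fin]; omega
    · intro k z hz
      obtain ⟨-, -, h3, -⟩ := hball z hz
      have h3' : AnalyticAt ℝ F (iot z) := h3.restrictScalars
      exact ((co k).analyticAt _).fun_comp (AnalyticAt.fun_comp (g := F) (f := iot) h3' (iot.analyticAt z))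
    · ext z
      simp only [Set.mem_inter_iff, Set.mem_setOf_eq, hSdef]
      constructor
      · rintro ⟨⟨h1, h2⟩, -⟩
        refine ⟨h1, fun k => ?_⟩
        rw [hF, onW_iff.1 h2, map_zero]
      · rintro ⟨h1, h2⟩
        refine ⟨⟨h1, onW_iff.2 ?_⟩, h1⟩
        have h3 : κ (F (iot z)) = 0 := by
          apply bs.repr.injective
          ext k
          rw [map_zero]; exact h2 k
        rw [hκ' _ (hFV z h1)] at h3
        exact congrArg Subtype.val h3
    · rintro z ⟨-, hz⟩
      obtain ⟨-, -, h3, -⟩ := hball z hz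
      have hd : ∀ k, HasFDerivAt (fun z => co k (F (iot z)))
          ((co k).comp (((fderiv ℂ F (iot z)).restrictScalars ℝ).comp iot)) z := fun k =>
        (co k).hasFDerivAt.comp z ((h3.differentiableAt.hasFDerivAt.restrictScalars ℝ).comp z
          iot.hasFDerivAt)
      have hval : ∀ k j, fderiv ℝ (fun z => co k (F (iot z))) z (bs j : Bn N).1 = if j = k then 1 else 0 := by
        intro k j
        rw [(hd k).fderiv]
        change co k (fderiv ℂ F (iot z) (iot (bs j : Bn N).1)) = _
        rw [← sg_fixed (bs j).2.2, Fw_fderiv hφ2 h3 (bs j).2.1, hco, hκ' _ (bs j).2]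
        simp [Finsupp.single_apply]
      rw [Fintype.linearIndependent_iff]
      intro a ha j
      have := congrArg (fun L => L (bs j : Bn N).1) ha
      simp only [ContinuousLinearMap.sum_apply, ContinuousLinearMap.smul_apply, hval,
        ContinuousLinearMap.zero_apply, smul_eq_mul] at this
      simpa using this
  · intro q hq v hv
    obtain ⟨h1, h2, h3, h4, h5, h6⟩ := hball q hq.1
    have hqM := hSM hq
    have hR0 : g.R (iot q) = 0 := h1.self_of_nhds.1 hqM
    have hdR : HasFDerivAt (fun z => g.R (iot z)) (((fderiv ℂ g.R (iot q)).restrictScalars ℝ).comp iot) q :=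
      (h6.differentiableAt.hasFDerivAt.restrictScalars ℝ).comp q iot.hasFDerivAt
    have hT : ∀ u ∈ tangentSpaceAt M q, fderiv ℂ g.R (iot q) (iot u) = 0 := fun u hu =>
      fderiv_tangent hdR hqM (by filter_upwards [h1] with z hz using hz.1) u hu
    obtain ⟨hv1, hv2⟩ := hv
    obtain ⟨v', hv', rfl⟩ := hv2
    set v : Cn N := mulI v' with hvdef
    have hIv : I • v = - v' := by
      change I • (I • v') = _
      rw [smul_smul]; simp
    have e1 := hT v hv1
    have e2 : fderiv ℂ g.R (iot q) (iot (I • v)) = 0 := by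
      rw [hIv, map_neg, map_neg, hT v' hv', neg_zero]
    have e3 : fderiv ℂ g.R (iot q) (v, 0) = 0 := by
      rw [inl_eq, map_smul, map_sub, map_smul, e1, e2]; simp
    have e4 := h5 hR0 hq.2 v e3
    have e5 : fderiv ℂ F (iot q) (0, cj v) = 0 := by
      have := fderiv_sym (f := F) (h := F) sg (x := iot q) h3.differentiableAt
        (by rw [sg_iot]; exact h3.differentiableAt) h4 (v, 0)
      rw [sg_iot, e4, map_zero] at this
      simpa [sg_apply] using this
    have e6 : fderiv ℂ F (iot q) (iot v) = 0 := by
      have : iot v = ((v, 0) : Bn N) + (0, cj v) := by simp [iot_apply]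
      rw [this, map_add, e5, add_zero]
      exact e4
    -- curve
    set ξ : ℝ → Bn N := fun s => iot (q + s • v) - F (iot (q + s • v)) with hξ
    have dc : HasDerivAt (fun s : ℝ => iot (q + s • v)) (iot v) 0 := by
      have h : HasDerivAt (fun s : ℝ => q + s • v) v 0 := by
        simpa using ((hasDerivAt_id (0 : ℝ)).smul_const v).const_add q
      exact iot.hasFDerivAt.comp_hasDerivAt (0 : ℝ) h
    have dF : HasDerivAt (fun s : ℝ => F (iot (q + s • v))) 0 0 := by
      have h : HasFDerivAt F ((fderiv ℂ F (iot q)).restrictScalars ℝ) (iot (q + (0 : ℝ) • v)) := by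
        rw [zero_smul, add_zero]; exact h3.differentiableAt.hasFDerivAt.restrictScalars ℝ
      have := h.comp_hasDerivAt (0 : ℝ) dc
      have e7 : ((fderiv ℂ F (iot q)).restrictScalars ℝ) (iot v) = 0 := e6
      rw [e7] at this
      exact this
    have dξ : HasDerivAt ξ (iot v) 0 := by
      have := dc.sub dF
      rw [sub_zero] at this; exact this
    have dγ : HasDerivAt (fun s => (ξ s).1) v 0 :=
      (ContinuousLinearMap.fst ℝ (Cn N) (Cn N)).hasFDerivAt.comp_hasDerivAt (0 : ℝ) dξ
    have hξ0 : (ξ 0).1 = q := by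
      have : F (iot q) = 0 := onW_iff.1 hq.2
      have h0 : ξ 0 = iot q := by simp [hξ, this]
      rw [h0]; rfl
    have := mem_tangentCone_of_curve (S := S) dγ ?_
    · rw [hξ0] at this
      exact Submodule.subset_span this
    · have tq : Tendsto (fun s : ℝ => iot (q + s • v)) (𝓝 0) (𝓝 (iot q)) := by
        have := dc.continuousAt.tendsto
        simpa using this
      have tγ : Tendsto (fun s => (ξ s).1) (𝓝 0) (𝓝 q) := by
        have := dγ.continuousAt.tendsto
        rwa [hξ0] at this
      filter_upwards [tq.eventually h4, tγ.eventually (Metric.isOpen_ball.mem_nhds hq.1)] with s hs1 hs2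
      refine ⟨hs2, ?_⟩
      have h7 : sg (ξ s) = ξ s := by
        rw [hξ]; simp only [map_sub]
        rw [← hs1, sg_iot]
      rw [← sg_fixed h7]
      have h8 : ξ s = iot p + π (iot (q + s • v) - iot p) + φ (iot (q + s • v) - iot p) := by
        simp only [hξ, hF, Fw]; abel
      rw [h8]
      exact onW_xi hπ hφ1 hφ2 _

/-- maximal orbits of minimal manifolds have full rank -/
lemma minimal_rank (hmin : IsMinimalAt M d p) : ∃ n, ∃ w : Fin n → Bool,
      ∃ᶠ t in 𝓝 (0 : Fin n → Cn N), 2 * N ≤ rk (fderiv ℂ (g.Vw w) t) + d := by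
  obtain ⟨r, ⟨n, w, hw⟩, hr⟩ := g.exists_max
  by_cases h : r + d < 2 * N
  · obtain ⟨π, φ, h1, h2, h3, h4, h5, h6, h7, h8, h9, h10⟩ := g.orbit hr w hw
    exact absurd hmin (g.not_minimal h h1 h2 h3 h4 h5 h6 h7 h8 h9 h10)
  · exact ⟨n, w, hw.mono fun t ht => by omega⟩

end Geo
end part13

section part14
open Filter

section order
variable {E F : Type} [NormedAddCommGroup E] [NormedSpace ℂ E] [NormedAddCommGroup F]
  [NormedSpace ℂ F] [CompleteSpace F]

/-- `f` vanishes to order `m` at `q` -/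
def VOrd (f : E → F) (q : E) (m : ℕ) : Prop := f =O[𝓝 q] fun x => ‖x - q‖ ^ m

lemma VOrd.mono {f : E → F} {q : E} {m n : ℕ} (h : VOrd f q m) (hn : n ≤ m) : VOrd f q n := by
  refine Asymptotics.IsBigO.trans h ?_
  refine Asymptotics.IsBigO.of_bound 1 ?_
  filter_upwards [Metric.ball_mem_nhds q one_pos] with x hx
  rw [mem_ball_iff_norm] at hx
  rw [one_mul, Real.norm_of_nonneg (by positivity), Real.norm_of_nonneg (by positivity)]
  exact pow_le_pow_of_le_one (norm_nonneg _) hx.le hn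

lemma VOrd.fderiv {f : E → F} {q : E} {m : ℕ} (hf : AnalyticAt ℂ f q) (h : VOrd f q (m + 1)) :
    VOrd (fderiv ℂ f) q m := by
  rcases Nat.eq_zero_or_pos m with rfl | hm
  · simp only [VOrd, pow_zero]
    exact (hf.fderiv.continuousAt.tendsto).isBigO_one ℝ
  have h0 : _root_.fderiv ℂ f q = 0 := (Asymptotics.IsBigO.hasFDerivAt h (by omega)).fderiv
  obtain ⟨C, hC0, hC⟩ := h.exists_pos
  rw [Asymptotics.isBigOWith_iff] at hC
  obtain ⟨δ, hδ, hb⟩ := Metric.eventually_nhds_iff_ball.1 (hC.and hf.eventually_analyticAt)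
  refine Asymptotics.IsBigO.of_bound (C * 2 ^ (m + 1)) ?_
  filter_upwards [Metric.ball_mem_nhds q (half_pos hδ)] with x hx
  rw [Real.norm_of_nonneg (by positivity)]
  rcases eq_or_ne x q with rfl | hxq
  · rw [h0, norm_zero]; positivity
  set r := ‖x - q‖ with hr
  have hr0 : 0 < r := norm_pos_iff.2 (sub_ne_zero.2 hxq)
  rw [mem_ball_iff_norm, ← hr] at hx
  refine ContinuousLinearMap.opNorm_le_of_unit_norm (by positivity) ?_
  intro v hv
  have hmem : ∀ s : ℂ, ‖s‖ ≤ r → ‖x + s • v - q‖ ≤ 2 * r := by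
    intro s hs
    have : x + s • v - q = (x - q) + s • v := by abel
    rw [this]
    refine (norm_add_le _ _).trans ?_
    rw [norm_smul, hv, mul_one, ← hr]; linarith
  have hmem' : ∀ s : ℂ, ‖s‖ ≤ r → x + s • v ∈ Metric.ball q δ := by
    intro s hs
    rw [mem_ball_iff_norm]
    have := hmem s hs
    linarith
  have hda : ∀ s : ℂ, ‖s‖ ≤ r → HasDerivAt (fun s : ℂ => f (x + s • v))
      (_root_.fderiv ℂ f (x + s • v) v) s := by
    intro s hs
    have h1 : HasDerivAt (fun s : ℂ => x + s • v) v s := by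
      simpa using ((hasDerivAt_id s).smul_const v).const_add x
    exact (hb _ (hmem' s hs)).2.differentiableAt.hasFDerivAt.comp_hasDerivAt s h1
  have hcl : DiffContOnCl ℂ (fun s : ℂ => f (x + s • v)) (Metric.ball 0 r) := by
    refine DifferentiableOn.diffContOnCl fun s hs => ?_
    rw [closure_ball _ hr0.ne', mem_closedBall_zero_iff] at hs
    exact (hda s hs).differentiableAt.differentiableWithinAt
  have := norm_deriv_le_of_forall_mem_sphere_norm_le hr0 hcl (C := C * (2 * r) ^ (m + 1)) (by
    intro s hs
    rw [mem_sphere_zero_iff_norm] at hs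
    refine (hb _ (hmem' s hs.le)).1.trans ?_
    rw [Real.norm_of_nonneg (by positivity)]
    gcongr
    exact hmem s hs.le)
  rw [(hda 0 (by simpa using hr0.le)).deriv, zero_smul, add_zero] at this
  refine this.trans (le_of_eq ?_)
  field_simp
  ring

lemma VOrd.dir {f : E → F} {b : E → E} {q : E} {m : ℕ} (hf : AnalyticAt ℂ f q)
    (hb : ContinuousAt b q) (h : VOrd f q (m + 1)) :
    VOrd (fun x => _root_.fderiv ℂ f x (b x)) q m := by
  have h1 := VOrd.fderiv hf h
  have h2 : b =O[𝓝 q] fun _ => (1 : ℝ) := hb.tendsto.isBigO_one ℝ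
  have h3 : (fun x => _root_.fderiv ℂ f x (b x)) =O[𝓝 q]
      fun x => ‖_root_.fderiv ℂ f x‖ * ‖b x‖ :=
    Asymptotics.IsBigO.of_bound 1 (Eventually.of_forall fun x => by
      rw [one_mul, Real.norm_of_nonneg (by positivity)]
      exact ContinuousLinearMap.le_opNorm _ _)
  have h4 := h1.norm_left.mul h2.norm_left
  simp only [mul_one] at h4
  exact h3.trans h4

lemma VOrd.zero {f : E → F} {q : E} (h : VOrd f q 1) : f q = 0 := by
  obtain ⟨C, hC⟩ := h.isBigOWith
  have := (Asymptotics.isBigOWith_iff.1 hC).self_of_nhds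
  simpa using this

/-- the operator `T ↦ DT(b)` -/
def dop (b : E → E) (T : E → F) (y : E) : F := _root_.fderiv ℂ T y (b y)

lemma dop_an {b : E → E} {T : E → F} {y : E} (hb : AnalyticAt ℂ b y) (hT : AnalyticAt ℂ T y) :
    AnalyticAt ℂ (dop b T) y := by
  have h : AnalyticAt ℂ (fun z : (E →L[ℂ] F) × E => z.1 z.2) (_root_.fderiv ℂ T y, b y) :=
    (ContinuousLinearMap.id ℂ (E →L[ℂ] F)).analyticAt_bilinear _
  exact AnalyticAt.fun_comp (g := fun z : (E →L[ℂ] F) × E => z.1 z.2)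
    (f := fun y => (_root_.fderiv ℂ T y, b y)) h (hT.fderiv.prod hb)

/-- commutation with constant vector fields along which `b` is constant -/
lemma dop_comm {b : E → E} {T : E → F} {y e : E} (hb : AnalyticAt ℂ b y) (hT : AnalyticAt ℂ T y)
    (he : _root_.fderiv ℂ b y e = 0) :
    _root_.fderiv ℂ (dop b T) y e = _root_.fderiv ℂ (fun y => _root_.fderiv ℂ T y e) y (b y) := by
  have hs : IsSymmSndFDerivAt ℂ T y :=
    (hT.contDiffAt (n := (⊤ : WithTop ℕ∞))).isSymmSndFDerivAt (by simp)
  have h1 := fderiv_clm_apply (𝕜 := ℂ) (c := _root_.fderiv ℂ T) (u := b) hT.fderiv.differentiableAt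
    hb.differentiableAt
  have h2 := fderiv_clm_apply (𝕜 := ℂ) (x := y) (c := _root_.fderiv ℂ T) (u := fun _ => e)
    hT.fderiv.differentiableAt (differentiableAt_const e)
  change _root_.fderiv ℂ (fun y => _root_.fderiv ℂ T y (b y)) y e = _
  rw [h1, h2]
  simp only [ContinuousLinearMap.add_apply, ContinuousLinearMap.comp_apply, he, map_zero, zero_add,
    ContinuousLinearMap.flip_apply, fderiv_fun_const, Pi.zero_apply, ContinuousLinearMap.zero_apply]
  exact hs _ _

end order
end part14

section part15
open Filter

section crf
variable {N N' : ℕ} {M : Set (Cn N)} {p : Cn N}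

/-- vertical vector field -/
def bL (a : Bn N → Cn N) (x : Bn N) : Bn N := (0, a x)

/-- vertical vector field with parameters -/
def bP (N' : ℕ) (a : Bn N → Cn N) (y : Bn N × Cn N') : Bn N × Cn N' := ((0, a y.1), 0)

lemma bL_an {a : Bn N → Cn N} {x : Bn N} (ha : AnalyticAt ℂ a x) : AnalyticAt ℂ (bL a) x :=
  analyticAt_const.prod ha

lemma bP_an {a : Bn N → Cn N} {y : Bn N × Cn N'} (ha : AnalyticAt ℂ a y.1) :
    AnalyticAt ℂ (bP N' a) y := by
  have h : AnalyticAt ℂ (fun y : Bn N × Cn N' => a y.1) y :=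
    AnalyticAt.fun_comp (g := a) (f := fun y : Bn N × Cn N' => y.1) ha
      ((ContinuousLinearMap.fst ℂ (Bn N) (Cn N')).analyticAt y)
  exact (analyticAt_const.prod h).prod analyticAt_const

lemma bP_fderiv {a : Bn N → Cn N} {y : Bn N × Cn N'} (ha : AnalyticAt ℂ a y.1) (e : Cn N') :
    fderiv ℂ (bP N' a) y (0, e) = 0 := by
  have h1 : HasFDerivAt (fun x : Bn N => (((0, a x), 0) : Bn N × Cn N')) (fderiv ℂ
    (fun x : Bn N => (((0, a x), 0) : Bn N × Cn N')) y.1) y.1 :=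
    ((analyticAt_const.prod ha).prod analyticAt_const).differentiableAt.hasFDerivAt
  have h2 := h1.comp y (ContinuousLinearMap.fst ℂ (Bn N) (Cn N')).hasFDerivAt
  have h3 : HasFDerivAt (bP N' a) _ y := h2
  rw [h3.fderiv]
  simp

lemma cr_coeff (L : CRVectorField M p) : ∃ a : Bn N → Cn N, AnalyticAt ℂ a (iot p) ∧
    ∀ᶠ q in 𝓝 p, ∀ G' : Bn N →L[ℂ] ℂ, G' (0, a (iot q)) =
      ∑ j, L.coeff q j * G' (0, cbasis j 1) := by
  have h1 : AnalyticAt ℝ (fun q => ∑ j, L.coeff q j • (cbasis j 1 : Cn N)) p := by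
    apply Finset.analyticAt_fun_sum
    intro j _
    exact (L.analytic j p L.mem).smul analyticAt_const
  obtain ⟨a, ha, hb⟩ := exists_cpx h1
  refine ⟨a, ha, ?_⟩
  filter_upwards [hb] with q hq G'
  rw [hq]
  have : ((0, ∑ j, L.coeff q j • (cbasis j 1 : Cn N)) : Bn N) =
      ∑ j, L.coeff q j • ((0, cbasis j 1) : Bn N) := by
    have := map_sum (LinearMap.inr ℂ (Cn N) (Cn N)) (fun j => L.coeff q j • (cbasis j 1 : Cn N))
      Finset.univ
    simpa only [LinearMap.inr_apply, map_smul] using this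
  rw [this, map_sum]
  simp only [map_smul, smul_eq_mul]

lemma tendsto_iot {q : Cn N} : Tendsto (iot : Cn N → Bn N) (𝓝 q) (𝓝 (iot q)) :=
  iot.continuous.tendsto q

lemma cr_apply (L : CRVectorField M p) {a : Bn N → Cn N}
    (ha : ∀ᶠ q in 𝓝 p, ∀ G' : Bn N →L[ℂ] ℂ, G' (0, a (iot q)) =
      ∑ j, L.coeff q j * G' (0, cbasis j 1)) {G : Bn N → ℂ} {f : Cn N → ℂ}
    (hG : AnalyticAt ℂ G (iot p)) (hf : ∀ᶠ q in 𝓝 p, G (iot q) = f q) :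
    ∀ᶠ q in 𝓝 p, dop (bL a) G (iot q) = L.apply f q := by
  filter_upwards [ha, hf.eventually_nhds, tendsto_iot.eventually hG.eventually_analyticAt]
    with q h1 h2 h3
  rw [dop, bL, h1, CRVectorField.apply]
  refine Finset.sum_congr rfl fun j _ => ?_
  rw [wirtDBar_iot h3.differentiableAt h2]

lemma cr_tangent (L : CRVectorField M p) {a : Bn N → Cn N}
    (ha : ∀ᶠ q in 𝓝 p, ∀ G' : Bn N →L[ℂ] ℂ, G' (0, a (iot q)) =
      ∑ j, L.coeff q j * G' (0, cbasis j 1)) {B : Bn N → ℂ}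
    (hB : AnalyticAt ℂ B (iot p)) (h0 : ∀ᶠ q in 𝓝 p, q ∈ M → B (iot q) = 0) :
    ∀ᶠ q in 𝓝 p, q ∈ M → dop (bL a) B (iot q) = 0 := by
  have hev := h0.and (tendsto_iot.eventually hB.eventually_analyticAt)
  obtain ⟨U, hU, hUo, hpU⟩ := eventually_nhds_iff.1 hev
  have han : ∀ z ∈ U, AnalyticAt ℝ (fun q => B (iot q)) z := fun z hz =>
    AnalyticAt.fun_comp (g := B) (f := iot) ((hU z hz).2.restrictScalars) (iot.analyticAt z)
  obtain ⟨V, hV, hpV, h1⟩ := L.tangent (fun q => (B (iot q)).re) U hUo hpU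
    (fun z hz => (Complex.reCLM.analyticAt _).fun_comp (han z hz))
    (fun z hz => by simp [(hU z hz.2).1 hz.1])
  obtain ⟨V', hV', hpV', h2⟩ := L.tangent (fun q => (B (iot q)).im) U hUo hpU
    (fun z hz => (Complex.imCLM.analyticAt _).fun_comp (han z hz))
    (fun z hz => by simp [(hU z hz.2).1 hz.1])
  filter_upwards [cr_apply L ha hB (Eventually.of_forall fun q => rfl), hV.mem_nhds hpV,
    hV'.mem_nhds hpV', hUo.mem_nhds hpU] with q h3 h4 h5 h6 hqM
  rw [h3, CRVectorField.apply]
  have hd := (han q h6).differentiableAt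
  have e1 : ∀ v, ((fderiv ℝ (fun q => (B (iot q)).re) q v : ℝ) : ℂ) +
      I * (fderiv ℝ (fun q => (B (iot q)).im) q v : ℝ) = fderiv ℝ (fun q => B (iot q)) q v := by
    intro v
    have r1 : HasFDerivAt (fun q => (B (iot q)).re) (Complex.reCLM.comp (fderiv ℝ (fun q => B (iot q)) q)) q :=
      Complex.reCLM.hasFDerivAt.comp q hd.hasFDerivAt
    have r2 : HasFDerivAt (fun q => (B (iot q)).im) (Complex.imCLM.comp (fderiv ℝ (fun q => B (iot q)) q)) q :=
      Complex.imCLM.hasFDerivAt.comp q hd.hasFDerivAt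
    rw [r1.fderiv, r2.fderiv, mul_comm]
    exact Complex.re_add_im _
  have e2 := h1 q ⟨hqM, h4⟩
  have e3 := h2 q ⟨hqM, h5⟩
  have : ∑ j, L.coeff q j * wirtDBar (fun q => B (iot q)) q j =
      (∑ j, L.coeff q j * wirtDBarR (fun q => (B (iot q)).re) q j) +
      I * ∑ j, L.coeff q j * wirtDBarR (fun q => (B (iot q)).im) q j := by
    rw [Finset.mul_sum, ← Finset.sum_add_distrib]
    refine Finset.sum_congr rfl fun j _ => ?_
    rw [wirtDBar, wirtDBarR, wirtDBarR, ← e1, ← e1]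
    ring
  rw [this, e2, e3]; simp

lemma subst_fderiv {T : Bn N × Cn N' → ℂ} {K : Cn N → Cn N'} {x : Bn N}
    (hK : AnalyticAt ℂ K x.1) (hT : AnalyticAt ℂ T (x, K x.1)) (v : Cn N) :
    fderiv ℂ (fun x : Bn N => T (x, K x.1)) x (0, v) = fderiv ℂ T (x, K x.1) ((0, v), 0) := by
  have h1 : HasFDerivAt (fun x : Bn N => K x.1)
      ((fderiv ℂ K x.1).comp (ContinuousLinearMap.fst ℂ (Cn N) (Cn N))) x :=
    hK.differentiableAt.hasFDerivAt.comp x (ContinuousLinearMap.fst ℂ (Cn N) (Cn N)).hasFDerivAt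
  have h2 : HasFDerivAt (fun x : Bn N => T (x, K x.1)) _ x :=
    hT.differentiableAt.hasFDerivAt.comp x ((hasFDerivAt_id x).prodMk h1)
  rw [h2.fderiv]
  simp

lemma subst_an {F : Type} [NormedAddCommGroup F] [NormedSpace ℂ F]
    {T : Bn N × Cn N' → F} {K : Cn N → Cn N'} {x : Bn N}
    (hK : AnalyticAt ℂ K x.1) (hT : AnalyticAt ℂ T (x, K x.1)) :
    AnalyticAt ℂ (fun x : Bn N => T (x, K x.1)) x :=
  AnalyticAt.fun_comp (g := T) (f := fun x : Bn N => (x, K x.1)) hT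
    (analyticAt_id.prod (AnalyticAt.fun_comp (g := K) (f := fun x : Bn N => x.1) hK
      ((ContinuousLinearMap.fst ℂ (Cn N) (Cn N)).analyticAt x)))

lemma subst_tendsto {K : Cn N → Cn N'} (hK : AnalyticAt ℂ K p) :
    Tendsto (fun x : Bn N => (x, K x.1)) (𝓝 (iot p)) (𝓝 (iot p, K p)) :=
  tendsto_id.prodMk_nhds (hK.continuousAt.tendsto.comp (continuous_fst.tendsto (iot p)))

end crf
end part15

section part16
open Filter

section goodness
variable {N N' : ℕ} {M M' : Set (Cn N)} {p : Cn N} {H₁ H₂ : Cn N → Cn N'}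

/-- functions controlling the difference of two maps -/
structure Good (M : Set (Cn N)) (p : Cn N) (H₁ H₂ : Cn N → Cn N') (k : ℕ)
    (T : Bn N × Cn N' → ℂ) : Prop where
  an : AnalyticAt ℂ T (iot p, H₁ p)
  dec : ∃ A B : Bn N → ℂ, AnalyticAt ℂ A (iot p) ∧ AnalyticAt ℂ B (iot p) ∧
    (∀ᶠ x in 𝓝 (iot p), T (x, H₁ x.1) - T (x, H₂ x.1) = A x + B x) ∧
    (∀ᶠ q in 𝓝 p, q ∈ M → B (iot q) = 0) ∧
    ∀ᶠ x in 𝓝 (iot p), ∀ m, VOrd (fun z => H₁ z - H₂ z) (cj x.2) (m + k) → VOrd A x m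

lemma Good.mono {k k' : ℕ} {T : Bn N × Cn N' → ℂ} (h : Good M p H₁ H₂ k T) (hk : k ≤ k') :
    Good M p H₁ H₂ k' T := by
  obtain ⟨h1, A, B, hA, hB, h2, h3, h4⟩ := h
  refine ⟨h1, A, B, hA, hB, h2, h3, ?_⟩
  filter_upwards [h4] with x hx m hm
  exact hx m (hm.mono (by omega))

lemma Good.zero {k : ℕ} : Good M p H₁ H₂ k (fun _ => 0) := by
  refine ⟨analyticAt_const, fun _ => 0, fun _ => 0, analyticAt_const, analyticAt_const, by simp,
    by simp, Eventually.of_forall fun x m _ => ?_⟩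
  exact Asymptotics.isBigO_zero _ _

lemma Good.add {k : ℕ} {T S : Bn N × Cn N' → ℂ} (hT : Good M p H₁ H₂ k T)
    (hS : Good M p H₁ H₂ k S) : Good M p H₁ H₂ k (fun y => T y + S y) := by
  obtain ⟨h1, A, B, hA, hB, h2, h3, h4⟩ := hT
  obtain ⟨h1', A', B', hA', hB', h2', h3', h4'⟩ := hS
  refine ⟨h1.add h1', fun x => A x + A' x, fun x => B x + B' x, hA.add hA', hB.add hB', ?_, ?_, ?_⟩
  · filter_upwards [h2, h2'] with x e e'
    linear_combination e + e'
  · filter_upwards [h3, h3'] with x e e' hx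
    rw [e hx, e' hx, add_zero]
  · filter_upwards [h4, h4'] with x e e' m hm
    exact Asymptotics.IsBigO.add (e m hm) (e' m hm)

lemma Good.smul {k : ℕ} {T : Bn N × Cn N' → ℂ} (hT : Good M p H₁ H₂ k T) (c : ℂ) :
    Good M p H₁ H₂ k (fun y => c * T y) := by
  obtain ⟨h1, A, B, hA, hB, h2, h3, h4⟩ := hT
  refine ⟨analyticAt_const.mul h1, fun x => c * A x, fun x => c * B x, analyticAt_const.mul hA,
    analyticAt_const.mul hB, ?_, ?_, ?_⟩
  · filter_upwards [h2] with x e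
    linear_combination c * e
  · filter_upwards [h3] with x e hx
    rw [e hx, mul_zero]
  · filter_upwards [h4] with x e m hm
    exact Asymptotics.IsBigO.const_mul_left (e m hm) c

lemma Good.step {k : ℕ} {T : Bn N × Cn N' → ℂ} (hT : Good M p H₁ H₂ k T)
    (hH₁ : AnalyticAt ℂ H₁ p) (hH₂ : AnalyticAt ℂ H₂ p) (hH : H₂ p = H₁ p)
    (L : CRVectorField M p) {a : Bn N → Cn N} (haa : AnalyticAt ℂ a (iot p))
    (ha : ∀ᶠ q in 𝓝 p, ∀ G' : Bn N →L[ℂ] ℂ, G' (0, a (iot q)) =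
      ∑ j, L.coeff q j * G' (0, cbasis j 1)) :
    Good M p H₁ H₂ (k + 1) (dop (bP N' a) T) := by
  obtain ⟨h1, A, B, hA, hB, h2, h3, h4⟩ := hT
  refine ⟨dop_an (bP_an haa) h1, dop (bL a) A, dop (bL a) B, dop_an (bL_an haa) hA,
    dop_an (bL_an haa) hB, ?_, cr_tangent L ha hB h3, ?_⟩
  · have t1 := subst_tendsto hH₁
    have t2 := subst_tendsto hH₂
    rw [hH] at t2
    have tf : Tendsto (fun x : Bn N => x.1) (𝓝 (iot p)) (𝓝 p) := continuous_fst.tendsto (iot p)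
    filter_upwards [t1.eventually h1.eventually_analyticAt, t2.eventually h1.eventually_analyticAt,
      tf.eventually hH₁.eventually_analyticAt, tf.eventually hH₂.eventually_analyticAt,
      hA.eventually_analyticAt, hB.eventually_analyticAt, h2.eventually_nhds]
      with x e1 e2 e3 e4 e5 e6 e7
    have d1 := (subst_an e3 e1).differentiableAt
    have d2 := (subst_an e4 e2).differentiableAt
    have e8 : fderiv ℂ (fun x : Bn N => T (x, H₁ x.1) - T (x, H₂ x.1)) x =
        fderiv ℂ (fun x => A x + B x) x := Filter.EventuallyEq.fderiv_eq e7
    rw [fderiv_fun_sub d1 d2, fderiv_fun_add e5.differentiableAt e6.differentiableAt] at e8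
    have e9 := congrArg (fun L => L ((0, a x) : Bn N)) e8
    simp only [ContinuousLinearMap.sub_apply, ContinuousLinearMap.add_apply] at e9
    rw [subst_fderiv e3 e1, subst_fderiv e4 e2] at e9
    exact e9
  · filter_upwards [h4, hA.eventually_analyticAt, haa.eventually_analyticAt] with x e1 e2 e3 m hm
    refine VOrd.dir e2 (bL_an e3).continuousAt (e1 (m + 1) ?_)
    rwa [show m + 1 + k = m + (k + 1) by ring]

/-- conjugate map -/
def Hb (H : Cn N → Cn N') (ζ : Cn N) : Cn N' := cj (H (cj ζ))

lemma Hb_an {H : Cn N → Cn N'} {ζ : Cn N} (h : AnalyticAt ℂ H (cj ζ)) : AnalyticAt ℂ (Hb H) ζ :=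
  analyticAt_conj cj cj cj_smul cj_smul h

lemma Good.base (hH₁ : AnalyticAt ℂ H₁ p) (hH₂ : AnalyticAt ℂ H₂ p) (hH : H₂ p = H₁ p)
    {R' : Bn N' → ℂ} (hR : AnalyticAt ℂ R' (iot (H₁ p)))
    (hM₁ : ∀ᶠ q in 𝓝 p, q ∈ M → R' (iot (H₁ q)) = 0)
    (hM₂ : ∀ᶠ q in 𝓝 p, q ∈ M → R' (iot (H₂ q)) = 0) :
    Good M p H₁ H₂ 0 (fun y => R' (y.2, Hb H₁ y.1.2)) := by
  have hb : ∀ {H : Cn N → Cn N'}, AnalyticAt ℂ H p →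
      AnalyticAt ℂ (fun x : Bn N => Hb H x.2) (iot p) := fun {H} h =>
    AnalyticAt.fun_comp (g := Hb H) (f := fun x : Bn N => x.2)
      (Hb_an (by rw [iot_apply, cj_cj]; exact h))
      ((ContinuousLinearMap.snd ℂ (Cn N) (Cn N)).analyticAt (iot p))
  have hf : ∀ {H : Cn N → Cn N'}, AnalyticAt ℂ H p →
      AnalyticAt ℂ (fun x : Bn N => H x.1) (iot p) := fun {H} h =>
    AnalyticAt.fun_comp (g := H) (f := fun x : Bn N => x.1)
      (by exact h) ((ContinuousLinearMap.fst ℂ (Cn N) (Cn N)).analyticAt (iot p))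
  have hp : ∀ {H : Cn N → Cn N'}, Hb H (iot p).2 = cj (H p) := fun {H} => by
    rw [iot_apply, Hb, cj_cj]
  have hc : ∀ {H K : Cn N → Cn N'}, AnalyticAt ℂ H p → AnalyticAt ℂ K p → H p = H₁ p → K p = H₁ p →
      AnalyticAt ℂ (fun x : Bn N => R' (H x.1, Hb K x.2)) (iot p) := fun {H K} hH hK e1 e2 =>
    AnalyticAt.fun_comp (g := R') (f := fun x : Bn N => (H x.1, Hb K x.2))
      (by
        have : (H (iot p).1, Hb K (iot p).2) = iot (H₁ p) := by
          rw [hp, e2]; change (H p, _) = _; rw [e1, iot_apply]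
        rw [this]; exact hR) ((hf hH).prod (hb hK))
  refine ⟨?_, fun x => R' (H₂ x.1, Hb H₂ x.2) - R' (H₂ x.1, Hb H₁ x.2),
    fun x => R' (H₁ x.1, Hb H₁ x.2) - R' (H₂ x.1, Hb H₂ x.2),
    (hc hH₂ hH₂ hH hH).sub (hc hH₂ hH₁ hH rfl), (hc hH₁ hH₁ rfl rfl).sub (hc hH₂ hH₂ hH hH),
    Eventually.of_forall fun x => by ring, ?_, ?_⟩
  · refine AnalyticAt.fun_comp (g := R') (f := fun y : Bn N × Cn N' => (y.2, Hb H₁ y.1.2)) ?_ ?_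
    · simp only [hp]; rw [iot_apply] at hR; exact hR
    · exact ((ContinuousLinearMap.snd ℂ (Bn N) (Cn N')).analyticAt _).prod
        (AnalyticAt.fun_comp (g := fun x : Bn N => Hb H₁ x.2) (f := fun y : Bn N × Cn N' => y.1)
          (hb hH₁) ((ContinuousLinearMap.fst ℂ (Bn N) (Cn N')).analyticAt _))
  · filter_upwards [hM₁, hM₂] with q e1 e2 hq
    have h1 := e1 hq
    have h2 := e2 hq
    simp only [iot_apply, Hb, cj_cj] at h1 h2 ⊢
    rw [h1, h2, sub_zero]
  · obtain ⟨K, s, hs, hL⟩ := hR.hasStrictFDerivAt.exists_lipschitzOnWith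
    have tt : ∀ {H K : Cn N → Cn N'}, AnalyticAt ℂ H p → AnalyticAt ℂ K p → H p = H₁ p → K p = H₁ p →
      Tendsto (fun x : Bn N => (H x.1, Hb K x.2)) (𝓝 (iot p)) (𝓝 (iot (H₁ p))) := by
      intro H K hH hK e1 e2
      have := ((hf hH).prod (hb hK)).continuousAt.tendsto
      have e3 : (H (iot p).1, Hb K (iot p).2) = iot (H₁ p) := by
          rw [hp, e2]; change (H p, _) = _; rw [e1, iot_apply]
      rwa [e3] at this
    filter_upwards [((tt hH₂ hH₂ hH hH).eventually hs).eventually_nhds,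
      ((tt hH₂ hH₁ hH rfl).eventually hs).eventually_nhds] with x e1 e2 m hm
    have tx : Tendsto (fun y : Bn N => cj y.2) (𝓝 x) (𝓝 (cj x.2)) :=
      (cj.continuous.comp continuous_snd).tendsto x
    have h1 := Asymptotics.IsBigO.comp_tendsto hm tx
    have h2 : (fun y : Bn N => R' (H₂ y.1, Hb H₂ y.2) - R' (H₂ y.1, Hb H₁ y.2)) =O[𝓝 x]
        ((fun z => H₁ z - H₂ z) ∘ fun y : Bn N => cj y.2) := by
      refine Asymptotics.IsBigO.of_bound K ?_
      filter_upwards [e1, e2] with y f1 f2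
      have := hL.norm_sub_le f1 f2
      refine this.trans (mul_le_mul_of_nonneg_left (le_of_eq ?_) K.2)
      rw [Prod.mk_sub_mk, sub_self, Prod.norm_def, norm_zero]
      simp only [Hb, ← map_sub, norm_cj, Function.comp]
      rw [max_eq_right (norm_nonneg _), norm_sub_rev]
    refine (h2.trans h1).trans (Asymptotics.IsBigO.of_bound 1 (Eventually.of_forall fun y => ?_))
    simp only [Function.comp, add_zero, ← map_sub, norm_cj, one_mul]
    rw [Real.norm_of_nonneg (by positivity), Real.norm_of_nonneg (by positivity)]
    gcongr
    rw [← Prod.snd_sub]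
    exact norm_snd_le _

end goodness
end part16

section part17
open Filter

section goodlist
variable {N N' : ℕ} {M : Set (Cn N)} {p : Cn N} {H₁ H₂ : Cn N → Cn N'}

lemma good_list (hH₁ : AnalyticAt ℂ H₁ p) (hH₂ : AnalyticAt ℂ H₂ p) (hH : H₂ p = H₁ p)
    {M' : Set (Cn N')} (hM₁ : ∀ᶠ q in 𝓝 p, q ∈ M → H₁ q ∈ M')
    (hM₂ : ∀ᶠ q in 𝓝 p, q ∈ M → H₂ q ∈ M') {ρ' : Cn N' → ℝ} {U' : Set (Cn N')}
    (hU : IsOpen U') (hpU : H₁ p ∈ U') (hρ : AnalyticOnNhd ℝ ρ' U') (h0 : ∀ w ∈ M' ∩ U', ρ' w = 0)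
    (Ls : List (CRVectorField M p)) :
    ∃ T, Good M p H₁ H₂ Ls.length T ∧ ∀ᶠ q in 𝓝 p, ∀ j,
      fderiv ℂ T (iot q, H₁ q) (0, cbasis j 1) = CRApplyList Ls (fun z => wirtD ρ' (H₁ z) j) q := by
  induction Ls with
  | nil =>
    obtain ⟨R', hR, hRρ⟩ := exists_cpx (f := fun q => (ρ' q : ℂ))
      ((Complex.ofRealCLM.analyticAt _).fun_comp (hρ _ hpU))
    have t1 : Tendsto H₁ (𝓝 p) (𝓝 (H₁ p)) := hH₁.continuousAt
    have t2 : Tendsto H₂ (𝓝 p) (𝓝 (H₁ p)) := by rw [← hH]; exact hH₂.continuousAt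
    have hG := Good.base (M := M) hH₁ hH₂ hH hR
      (by
        filter_upwards [t1.eventually hRρ, t1.eventually (hU.mem_nhds hpU), hM₁] with q e1 e2 e3 hq
        rw [e1, h0 _ ⟨e3 hq, e2⟩, Complex.ofReal_zero])
      (by
        filter_upwards [t2.eventually hRρ, t2.eventually (hU.mem_nhds hpU), hM₂] with q e1 e2 e3 hq
        rw [e1, h0 _ ⟨e3 hq, e2⟩, Complex.ofReal_zero])
    refine ⟨_, hG, ?_⟩
    filter_upwards [t1.eventually hRρ.eventually_nhds, t1.eventually (hU.mem_nhds hpU),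
      (tendsto_iot.comp t1).eventually hR.eventually_analyticAt, hH₁.eventually_analyticAt]
      with q e1 e2 e3 e4 j
    have e3' : AnalyticAt ℂ R' (iot (H₁ q)) := e3
    change _ = wirtD ρ' (H₁ q) j
    rw [wirtD_iot e3'.differentiableAt (hρ _ e2).differentiableAt e1]
    have hb : HasFDerivAt (fun y : Bn N × Cn N' => Hb H₁ y.1.2)
        ((fderiv ℂ (fun x : Bn N => Hb H₁ x.2) (iot q)).comp
          (ContinuousLinearMap.fst ℂ (Bn N) (Cn N'))) (iot q, H₁ q) := by
      have : AnalyticAt ℂ (fun x : Bn N => Hb H₁ x.2) (iot q) :=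
        AnalyticAt.fun_comp (g := Hb H₁) (f := fun x : Bn N => x.2)
          (Hb_an (by rw [iot_apply, cj_cj]; exact e4))
          ((ContinuousLinearMap.snd ℂ (Cn N) (Cn N)).analyticAt (iot q))
      exact HasFDerivAt.comp (g := fun x : Bn N => Hb H₁ x.2) (iot q, H₁ q)
        this.differentiableAt.hasFDerivAt
        (ContinuousLinearMap.fst ℂ (Bn N) (Cn N')).hasFDerivAt
    have hR2 : HasFDerivAt R' (fderiv ℂ R' (iot (H₁ q))) (H₁ q, Hb H₁ (iot q).2) := by
      have : (H₁ q, Hb H₁ (iot q).2) = iot (H₁ q) := by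
        simp only [iot_apply, Hb, cj_cj]
      rw [this]; exact e3'.differentiableAt.hasFDerivAt
    have hT : HasFDerivAt (fun y : Bn N × Cn N' => R' (y.2, Hb H₁ y.1.2)) _ (iot q, H₁ q) :=
      HasFDerivAt.comp (g := R') (iot q, H₁ q) hR2
        ((ContinuousLinearMap.snd ℂ (Bn N) (Cn N')).hasFDerivAt.prodMk hb)
    rw [hT.fderiv]
    simp
  | cons L Ls ih =>
    obtain ⟨T, hT, hq⟩ := ih
    obtain ⟨a, haa, ha⟩ := cr_coeff L
    refine ⟨dop (bP N' a) T, hT.step hH₁ hH₂ hH L haa ha, ?_⟩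
    rw [eventually_all]
    intro j
    have hS : AnalyticAt ℂ (fun y => fderiv ℂ T y ((0, cbasis j 1) : Bn N × Cn N')) (iot p, H₁ p) :=
      dop_an (b := fun _ => (0, cbasis j 1)) analyticAt_const hT.an
    have hG := subst_an (K := H₁) (x := iot p) hH₁ hS
    have hc := cr_apply L ha hG (f := CRApplyList Ls (fun z => wirtD ρ' (H₁ z) j))
      (by filter_upwards [hq] with q h using h j)
    have tt : Tendsto (fun q => (iot q, H₁ q)) (𝓝 p) (𝓝 (iot p, H₁ p)) :=
      tendsto_iot.prodMk_nhds hH₁.continuousAt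
    filter_upwards [hc, tt.eventually hT.an.eventually_analyticAt, tt.eventually hS.eventually_analyticAt,
      hH₁.eventually_analyticAt, tendsto_iot.eventually haa.eventually_analyticAt] with q e1 e2 e3 e4 e5
    rw [dop_comm (bP_an e5) e2 (bP_fderiv e5 _)]
    change _ = L.apply (CRApplyList Ls (fun z => wirtD ρ' (H₁ z) j)) q
    rw [← e1, dop, bL, subst_fderiv e4 e3]
    rfl

lemma good_frame (hH₁ : AnalyticAt ℂ H₁ p) (hH₂ : AnalyticAt ℂ H₂ p) (hH : H₂ p = H₁ p)
    {M' : Set (Cn N')} (hM₁ : ∀ᶠ q in 𝓝 p, q ∈ M → H₁ q ∈ M')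
    (hM₂ : ∀ᶠ q in 𝓝 p, q ∈ M → H₂ q ∈ M') {ℓ : ℕ} (hfn : FinNondeg M p M' ℓ H₁)
    (v : Fin N' → ℂ) : ∃ T, Good M p H₁ H₂ ℓ T ∧ ∀ j,
      fderiv ℂ T (iot p, H₁ p) (0, cbasis j 1) = v j := by
  have hv : v ∈ (⊤ : Submodule ℂ (Fin N' → ℂ)) := trivial
  rw [← hfn] at hv
  induction hv using Submodule.span_induction with
  | mem x hx =>
    obtain ⟨Ls, ρ', U', hl, hU, hpU, hρ, h0, rfl⟩ := hx
    obtain ⟨T, hT, hq⟩ := good_list hH₁ hH₂ hH hM₁ hM₂ hU hpU hρ h0 Ls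
    exact ⟨T, hT.mono hl, hq.self_of_nhds⟩
  | zero => exact ⟨_, Good.zero, fun j => by simp⟩
  | add x y _ _ hx hy =>
    obtain ⟨T, hT, h1⟩ := hx
    obtain ⟨S, hS, h2⟩ := hy
    refine ⟨_, hT.add hS, fun j => ?_⟩
    rw [fderiv_fun_add hT.an.differentiableAt hS.an.differentiableAt]
    simp [h1, h2]
  | smul c x _ hx =>
    obtain ⟨T, hT, h1⟩ := hx
    refine ⟨_, hT.smul c, fun j => ?_⟩
    rw [fderiv_const_mul hT.an.differentiableAt]
    simp [h1]

end goodlist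

namespace Geo
variable {N N' d : ℕ} {M : Set (Cn N)} {p : Cn N} (g : Geo N d M p) {H₁ H₂ : Cn N → Cn N'}

lemma prop_core (hH₁ : AnalyticAt ℂ H₁ p) (hH₂ : AnalyticAt ℂ H₂ p) (hH : H₂ p = H₁ p)
    {M' : Set (Cn N')} (hM₁ : ∀ᶠ q in 𝓝 p, q ∈ M → H₁ q ∈ M')
    (hM₂ : ∀ᶠ q in 𝓝 p, q ∈ M → H₂ q ∈ M') {ℓ : ℕ} (hfn : FinNondeg M p M' ℓ H₁) :
    ∀ᶠ x in 𝓝 (iot p), g.R x = 0 → ∀ m, VOrd (fun z => H₁ z - H₂ z) (cj x.2) (m + ℓ) →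
      VOrd (fun z => H₁ z - H₂ z) x.1 m := by
  have hfr := fun i : Fin N' => good_frame hH₁ hH₂ hH hM₁ hM₂ hfn (fun j => if j = i then 1 else 0)
  choose T hT hTd using hfr
  have hdec := fun i => (hT i).dec
  choose A B hA hB hAB hB0 hord using hdec
  have hB1 := fun i => g.ident (hB i) (hB0 i)
  -- the vector valued function
  set Γ : Bn N × Cn N' → (Fin N' → ℂ) := fun y i => T i y with hΓ
  have hΓan : AnalyticAt ℂ Γ (iot p, H₁ p) := AnalyticAt.pi fun i => (hT i).an
  have hΓd : ∀ v : Cn N', fderiv ℂ Γ (iot p, H₁ p) (0, v) = fun i => v i := by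
    intro v
    funext i
    rw [hΓ, fderiv_pi fun i => (hT i).an.differentiableAt]
    change fderiv ℂ (T i) (iot p, H₁ p) (0, v) = v i
    have hv : ((0, v) : Bn N × Cn N') = ∑ j, v j • ((0, cbasis j 1) : Bn N × Cn N') := by
      have h1 : v = ∑ j, v j • cbasis j 1 := by
        ext k
        simp [cbasis, Pi.single_apply]
      have := map_sum (LinearMap.inr ℂ (Bn N) (Cn N')) (fun j => v j • (cbasis j 1 : Cn N'))
        Finset.univ
      rw [← h1] at this
      simpa only [LinearMap.inr_apply, map_smul] using this
    rw [hv, map_sum]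
    simp only [map_smul, hTd]
    simp
  obtain ⟨C, hC, hlow⟩ : ∃ C : ℝ, 0 ≤ C ∧ ∀ᶠ z : (Bn N × Cn N') × (Bn N × Cn N') in
      𝓝 ((iot p, H₁ p), (iot p, H₁ p)), z.1.1 = z.2.1 → ‖z.1.2 - z.2.2‖ ≤ C * ‖Γ z.1 - Γ z.2‖ := by
    let Λ : Cn N' ≃L[ℂ] (Fin N' → ℂ) := EuclideanSpace.equiv (Fin N') ℂ
    set K := ‖(Λ.symm : (Fin N' → ℂ) →L[ℂ] Cn N')‖ with hK
    have hΛ : ∀ v, ‖v‖ ≤ K * ‖Λ v‖ := fun v => by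
      have := (Λ.symm : (Fin N' → ℂ) →L[ℂ] Cn N').le_opNorm (Λ v)
      simpa using this
    have hst := hΓan.hasStrictFDerivAt.isLittleO
    have h1 := hst.def (c := 1 / (2 * (K + 1))) (by positivity)
    refine ⟨2 * K, by positivity, ?_⟩
    filter_upwards [h1] with z hz hzz
    obtain ⟨⟨x, w⟩, ⟨x', w'⟩⟩ := z
    simp only at hzz hz ⊢
    subst hzz
    have e1 : ((x, w) : Bn N × Cn N') - (x, w') = (0, w - w') := by simp
    have e2 : fderiv ℂ Γ (iot p, H₁ p) (0, w - w') = Λ (w - w') := hΓd _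
    rw [e1, e2] at hz
    have e3 : ‖((0, w - w') : Bn N × Cn N')‖ = ‖w - w'‖ := by simp [Prod.norm_def]
    rw [e3] at hz
    have e4 : ‖Λ (w - w')‖ ≤ ‖Γ (x, w) - Γ (x, w')‖ + 1 / (2 * (K + 1)) * ‖w - w'‖ := by
      have := norm_sub_le (Γ (x, w) - Γ (x, w')) (Γ (x, w) - Γ (x, w') - Λ (w - w'))
      rw [sub_sub_cancel] at this
      linarith
    have e5 := hΛ (w - w')
    have e6 : K * (1 / (2 * (K + 1)) * ‖w - w'‖) ≤ 1 / 2 * ‖w - w'‖ := by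
      rw [← mul_assoc]
      refine mul_le_mul_of_nonneg_right ?_ (norm_nonneg _)
      rw [mul_one_div, div_le_div_iff₀ (by positivity) (by positivity)]
      linarith
    have e7 : K * ‖Λ (w - w')‖ ≤ K * ‖Γ (x, w) - Γ (x, w')‖ + 1 / 2 * ‖w - w'‖ := by
      have := mul_le_mul_of_nonneg_left e4 (norm_nonneg (Λ.symm : (Fin N' → ℂ) →L[ℂ] Cn N'))
      rw [← hK] at this
      linarith
    linarith
  have tt : Tendsto (fun x : Bn N => ((x, H₁ x.1), (x, H₂ x.1))) (𝓝 (iot p))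
      (𝓝 ((iot p, H₁ p), (iot p, H₁ p))) := by
    have t2 := subst_tendsto hH₂
    rw [hH] at t2
    exact (subst_tendsto hH₁).prodMk_nhds t2
  have key : ∀ᶠ x in 𝓝 (iot p), g.R x = 0 → ‖H₁ x.1 - H₂ x.1‖ ≤ C * ‖fun i => A i x‖ := by
    filter_upwards [tt.eventually hlow, eventually_all.2 hAB, eventually_all.2 hB1] with x e1 e2 e3 hx
    have := e1 rfl
    have e4 : Γ (x, H₁ x.1) - Γ (x, H₂ x.1) = fun i => A i x := by
      funext i
      simp only [Pi.sub_apply, hΓ, e2 i, e3 i hx, add_zero]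
    rwa [e4] at this
  -- the section
  set s : Bn N → Bn N := fun x => g.mv false 0 x with hs
  have hsan : AnalyticAt ℂ s (iot p) :=
    AnalyticAt.fun_comp (g := fun y : Cn N × Bn N => g.mv false y.1 y.2) (f := fun x => (0, x))
      (g.mv_an false) (analyticAt_const.prod analyticAt_id)
  have hst : Tendsto s (𝓝 (iot p)) (𝓝 (iot p)) := g.mv_tendsto false tendsto_const_nhds tendsto_id
  have hsR : ∀ᶠ x in 𝓝 (iot p), g.R (s x) = 0 := g.mv_R false tendsto_const_nhds tendsto_id
  filter_upwards [g.mv_zero false, (hst.eventually key).eventually_nhds, hsR.eventually_nhds,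
    hsan.eventually_analyticAt, eventually_all.2 hord] with x e1 e2 e3 e4 e5 hx m hm
  have hsx : s x = x := e1 hx
  have tZ : Tendsto (fun Z : Cn N => (Z, x.2)) (𝓝 x.1) (𝓝 x) :=
    tendsto_id.prodMk_nhds tendsto_const_nhds
  have tZs : Tendsto (fun Z : Cn N => s (Z, x.2)) (𝓝 x.1) (𝓝 x) := by
    have := e4.continuousAt.tendsto
    rw [hsx] at this
    exact this.comp tZ
  have b1 : (fun z => H₁ z - H₂ z) =O[𝓝 x.1] fun Z => (fun i => A i (s (Z, x.2))) := by
    refine Asymptotics.IsBigO.of_bound C ?_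
    filter_upwards [tZ.eventually e2, tZ.eventually e3] with Z f1 f2
    have := f1 f2
    rwa [hs, mv_false_fst] at this
  have b2 : (fun Z => (fun i => A i (s (Z, x.2)))) =O[𝓝 x.1] fun Z => ‖s (Z, x.2) - x‖ ^ m := by
    rw [Asymptotics.isBigO_pi]
    intro i
    exact (e5 i m hm).comp_tendsto tZs
  have b3 : (fun Z => s (Z, x.2) - x) =O[𝓝 x.1] fun Z => Z - x.1 := by
    have := (e4.differentiableAt.hasFDerivAt.isBigO_sub).comp_tendsto tZ
    simp only [Function.comp_def, hsx] at this
    refine this.trans (Asymptotics.IsBigO.of_bound 1 (Eventually.of_forall fun Z => ?_))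
    have : ((Z, x.2) : Bn N) - x = (Z - x.1, 0) := by ext <;> simp
    rw [this, one_mul, Prod.norm_def]; simp
  exact (b1.trans b2).trans (b3.norm_norm.pow m)

end Geo
end part17

section part18
open Filter

namespace Geo
variable {N N' d : ℕ} {M : Set (Cn N)} {p : Cn N} (g : Geo N d M p)

lemma prop_move {h : Cn N → Cn N'} {ℓ : ℕ}
    (hp : ∀ᶠ x in 𝓝 (iot p), g.R x = 0 → ∀ m, VOrd h (cj x.2) (m + ℓ) → VOrd h x.1 m)
    (b : Bool) {P : Type} {f : Filter P} {a : P → Cn N} {x : P → Bn N}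
    (ha : Tendsto a f (𝓝 0)) (hx : Tendsto x f (𝓝 (iot p))) :
    ∀ᶠ s in f, ∀ m, VOrd h (x s).1 (m + ℓ) ∧ VOrd h (cj (x s).2) (m + ℓ) →
      VOrd h (g.mv b (a s) (x s)).1 m ∧ VOrd h (cj (g.mv b (a s) (x s)).2) m := by
  have hp2 : ∀ᶠ x in 𝓝 (iot p), g.R x = 0 → ∀ m, VOrd h x.1 (m + ℓ) → VOrd h (cj x.2) m := by
    filter_upwards [tendsto_sg.eventually hp, g.sym] with y e1 e2 hy m hm
    have := e1 (by rw [e2, hy, map_zero]) m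
    simp only [sg_apply, cj_cj] at this
    exact this hm
  have t := g.mv_tendsto b ha hx
  filter_upwards [t.eventually hp, t.eventually hp2, g.mv_R b ha hx] with s e1 e2 e3 m ⟨h1, h2⟩
  cases b
  · have h3 : VOrd h (g.mv false (a s) (x s)).1 (m + ℓ) := by rw [mv_false_fst]; exact h1
    exact ⟨h3.mono (by omega), e2 e3 m h3⟩
  · have h3 : VOrd h (cj (g.mv true (a s) (x s)).2) (m + ℓ) := by rw [mv_true_snd]; exact h2
    exact ⟨e1 e3 m h3, h3.mono (by omega)⟩

lemma prop_run {h : Cn N → Cn N'} {ℓ : ℕ}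
    (hp : ∀ᶠ x in 𝓝 (iot p), g.R x = 0 → ∀ m, VOrd h (cj x.2) (m + ℓ) → VOrd h x.1 m)
    {P : Type} {f : Filter P} (ms : List (Bool × (P → Cn N))) {x : P → Bn N}
    (hm : ∀ m ∈ ms, Tendsto m.2 f (𝓝 0)) (hx : Tendsto x f (𝓝 (iot p))) :
    ∀ᶠ s in f, ∀ m, VOrd h (x s).1 (m + ms.length * ℓ) ∧ VOrd h (cj (x s).2) (m + ms.length * ℓ) →
      VOrd h (g.run (ev ms s) (x s)).1 m ∧ VOrd h (cj (g.run (ev ms s) (x s)).2) m := by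
  induction ms generalizing x with
  | nil => exact Eventually.of_forall fun s m h => by simpa [run, ev] using h
  | cons c ms ih =>
    have h1 := ih (fun m' hm' => hm m' (List.mem_cons_of_mem _ hm'))
      (g.mv_tendsto c.1 (hm c List.mem_cons_self) hx)
    have h2 := g.prop_move hp c.1 (hm c List.mem_cons_self) hx
    filter_upwards [h1, h2] with s e1 e2 m e3
    refine e1 m (e2 _ ?_)
    have : m + (c :: ms).length * ℓ = m + ms.length * ℓ + ℓ := by simp; ring
    rwa [this] at e3

lemma R_rank : ∀ᶠ x in 𝓝 (iot p), Module.finrank ℂ (LinearMap.ker (fderiv ℂ g.R x : Bn N →ₗ[ℂ] (Fin d → ℂ)))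
    + d = 2 * N := by
  have h1 : ContinuousAt (fun x => (fderiv ℂ g.R x).comp (ilC g.D)) (iot p) :=
    g.an.fderiv.continuousAt.clm_comp continuousAt_const
  have h2 : (fderiv ℂ g.R (iot p)).comp (ilC g.D) = 1 := by
    ext1 μ
    exact g.hD μ
  have h3 : {A : (Fin d → ℂ) →L[ℂ] (Fin d → ℂ) | IsUnit A} ∈
      𝓝 ((fderiv ℂ g.R (iot p)).comp (ilC g.D)) := by
    rw [h2]; exact Units.isOpen.mem_nhds isUnit_one
  filter_upwards [h1.tendsto.eventually h3] with x hx
  obtain ⟨u, hu⟩ := hx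
  have hs : LinearMap.range (fderiv ℂ g.R x : Bn N →ₗ[ℂ] (Fin d → ℂ)) = ⊤ := by
    rw [LinearMap.range_eq_top]
    intro μ
    refine ⟨ilC g.D ((↑u⁻¹ : (Fin d → ℂ) →L[ℂ] (Fin d → ℂ)) μ), ?_⟩
    have := congrArg (fun A => A μ) u.mul_inv
    rw [hu] at this
    exact this
  have hB : Module.finrank ℂ (Bn N) = 2 * N := by
    rw [Module.finrank_prod, finrank_euclideanSpace_fin]; ring
  have := LinearMap.finrank_range_add_finrank_ker (fderiv ℂ g.R x : Bn N →ₗ[ℂ] (Fin d → ℂ))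
  rw [hs, finrank_top, hB, Module.finrank_fin_fun] at this
  omega

lemma R_lift : ∀ᶠ x in 𝓝 (iot p), g.R x = 0 → ∀ v, ∃ u : Bn N, fderiv ℂ g.R x u = 0 ∧ u.1 = v := by
  set s : Bn N → Bn N := fun x => g.mv false 0 x with hs
  have hsan : AnalyticAt ℂ s (iot p) :=
    AnalyticAt.fun_comp (g := fun y : Cn N × Bn N => g.mv false y.1 y.2) (f := fun x => (0, x))
      (g.mv_an false) (analyticAt_const.prod analyticAt_id)
  have hsR : ∀ᶠ x in 𝓝 (iot p), g.R (s x) = 0 := g.mv_R false tendsto_const_nhds tendsto_id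
  filter_upwards [g.mv_zero false, hsR.eventually_nhds, hsan.eventually_analyticAt,
    g.an.eventually_analyticAt] with x e1 e2 e3 e4 hx v
  have hsx : s x = x := e1 hx
  refine ⟨fderiv ℂ s x (v, 0), ?_, ?_⟩
  · have h1 : HasFDerivAt g.R (fderiv ℂ g.R x) (s x) := by
      rw [hsx]; exact e4.differentiableAt.hasFDerivAt
    have h2 := h1.comp x e3.differentiableAt.hasFDerivAt
    have h3 : HasFDerivAt (g.R ∘ s) (0 : Bn N →L[ℂ] (Fin d → ℂ)) x :=
      (hasFDerivAt_const 0 x).congr_of_eventuallyEq e2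
    have := congrArg (fun A => A ((v, 0) : Bn N)) (h2.unique h3)
    exact this
  · have h2 : HasFDerivAt (fun x => (s x).1) _ x :=
      (ContinuousLinearMap.fst ℂ (Cn N) (Cn N)).hasFDerivAt.comp x e3.differentiableAt.hasFDerivAt
    have h3 : HasFDerivAt (fun x => (s x).1) (ContinuousLinearMap.fst ℂ (Cn N) (Cn N)) x := by
      have : (fun x => (s x).1) = fun x : Bn N => x.1 := by
        funext y; rw [hs, mv_false_fst]
      rw [this]
      exact (ContinuousLinearMap.fst ℂ (Cn N) (Cn N)).hasFDerivAt
    exact congrArg (fun A => A ((v, 0) : Bn N)) (h2.unique h3)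

lemma final_zero {h : Cn N → Cn N'} (han : AnalyticAt ℂ h p) {ℓ : ℕ}
    (hp : ∀ᶠ x in 𝓝 (iot p), g.R x = 0 → ∀ m, VOrd h (cj x.2) (m + ℓ) → VOrd h x.1 m)
    {n : ℕ} {w : Fin n → Bool}
    (hw : ∃ᶠ t in 𝓝 (0 : Fin n → Cn N), 2 * N ≤ rk (fderiv ℂ (g.Vw w) t) + d)
    (h0 : VOrd h p (n * ℓ + 1)) : ∀ᶠ z in 𝓝 p, h z = 0 := by
  have hm : ∀ m ∈ cw w (id : (Fin n → Cn N) → _), Tendsto m.2 (𝓝 0) (𝓝 0) := by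
    intro m hm
    obtain ⟨h1, h2⟩ := cw_an w id analyticAt_id (s0 := (0 : Fin n → Cn N)) rfl m hm
    have := h1.continuousAt.tendsto
    rwa [h2] at this
  have hlen : (cw w (id : (Fin n → Cn N) → _)).length = n := by simp [cw]
  have z1 : ∀ᶠ t in 𝓝 (0 : Fin n → Cn N), h (g.Vw w t).1 = 0 := by
    filter_upwards [g.prop_run hp (cw w id) hm (x := fun _ => iot p) tendsto_const_nhds] with t ht
    rw [Vw_run]
    refine (ht 1 ?_).1.zero
    rw [hlen, add_comm, iot_apply]
    simp only [cj_cj]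
    exact ⟨h0, h0⟩
  have hVt : Tendsto (g.Vw w) (𝓝 0) (𝓝 (iot p)) := by
    have := g.run_tendsto (cw w id) hm (x := fun _ => iot p) tendsto_const_nhds
    simpa only [← Vw_run] using this
  have hVR : ∀ᶠ t in 𝓝 (0 : Fin n → Cn N), g.R (g.Vw w t) = 0 := by
    have := g.run_R (cw w id) hm (x := fun _ => iot p) tendsto_const_nhds
      (Eventually.of_forall fun _ => g.R0)
    simpa only [← Vw_run] using this
  obtain ⟨δ, hδ, hball⟩ := Metric.eventually_nhds_iff_ball.1 han.eventually_analyticAt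
  have hV1 : Tendsto (fun t => (g.Vw w t).1) (𝓝 0) (𝓝 p) := (continuous_fst.tendsto (iot p)).comp hVt
  obtain ⟨t, ht, e1, e2, e3, e4, e5, e6, e7⟩ := (hw.and_eventually (z1.eventually_nhds.and
    (hVR.eventually_nhds.and ((hVt.eventually g.R_rank).and ((hVt.eventually g.R_lift).and
    ((g.Vw_an w).eventually_analyticAt.and ((hV1.eventually (Metric.ball_mem_nhds p hδ)).and
    (hVt.eventually g.an.eventually_analyticAt)))))))).exists
  have hle : LinearMap.range (fderiv ℂ (g.Vw w) t : (Fin n → Cn N) →ₗ[ℂ] Bn N) ≤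
      LinearMap.ker (fderiv ℂ g.R (g.Vw w t) : Bn N →ₗ[ℂ] (Fin d → ℂ)) := by
    rintro _ ⟨v, rfl⟩
    have h1 := e7.differentiableAt.hasFDerivAt.comp t e5.differentiableAt.hasFDerivAt
    have h3 : HasFDerivAt (g.R ∘ g.Vw w) (0 : (Fin n → Cn N) →L[ℂ] (Fin d → ℂ)) t :=
      (hasFDerivAt_const 0 t).congr_of_eventuallyEq e2
    exact congrArg (fun A => A v) (h1.unique h3)
  have heq := Submodule.eq_of_le_of_finrank_le hle (by
    change _ ≤ rk _
    omega)
  have hst : HasStrictFDerivAt (fun t => (g.Vw w t).1)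
      ((ContinuousLinearMap.fst ℂ (Cn N) (Cn N)).comp (fderiv ℂ (g.Vw w) t)) t :=
    (ContinuousLinearMap.fst ℂ (Cn N) (Cn N)).hasStrictFDerivAt.comp t e5.hasStrictFDerivAt
  have hsurj : LinearMap.range (((ContinuousLinearMap.fst ℂ (Cn N) (Cn N)).comp
      (fderiv ℂ (g.Vw w) t) : (Fin n → Cn N) →L[ℂ] Cn N) : (Fin n → Cn N) →ₗ[ℂ] Cn N) = ⊤ := by
    rw [LinearMap.range_eq_top]
    intro v
    obtain ⟨u, hu, rfl⟩ := e4 e2.self_of_nhds v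
    have : u ∈ LinearMap.range (fderiv ℂ (g.Vw w) t : (Fin n → Cn N) →ₗ[ℂ] Bn N) := by
      rw [heq]; exact hu
    obtain ⟨v', rfl⟩ := this
    exact ⟨v', rfl⟩
  have hmap := hst.map_nhds_eq_of_surj hsurj
  have hz : ∀ᶠ z in 𝓝 (g.Vw w t).1, h z = 0 := by
    rw [← hmap]
    exact e1
  have := AnalyticOnNhd.eqOn_zero_of_preconnected_of_eventuallyEq_zero (𝕜 := ℂ)
    (f := h) (U := Metric.ball p δ) hball (convex_ball p δ).isPreconnected e6 hz
  filter_upwards [Metric.ball_mem_nhds p hδ] with z hz' using this hz'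

end Geo
end part18

section part19
section Jets
open Filter

lemma itf_equiv {N N' : ℕ} {H : Cn N → Cn N'} {p : Cn N} (hH : AnalyticAt ℂ H p) {k k' : ℕ}
    (e : Fin k ≃ Fin k') (v : Fin k → Cn N) (v' : Fin k' → Cn N) (hv : ∀ i, v i = v' (e i)) :
    iteratedFDeriv ℂ k H p v = iteratedFDeriv ℂ k' H p v' := by
  have hk : k = k' := Fin.equiv_iff_eq.1 ⟨e⟩
  subst hk
  have : v = v' ∘ e := funext hv
  rw [this]
  exact (hH.contDiffAt).iteratedFDeriv_comp_perm v' e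

lemma itf_perm {N N' : ℕ} {H : Cn N → Cn N'} {p : Cn N} (hH : AnalyticAt ℂ H p)
    {l l' : List (Fin N)} (h : l.Perm l') :
    iteratedFDeriv ℂ l.length H p (fun j => EuclideanSpace.single (l.get j) (1 : ℂ)) =
    iteratedFDeriv ℂ l'.length H p (fun j => EuclideanSpace.single (l'.get j) (1 : ℂ)) := by
  refine itf_equiv hH ⟨h.idxBij, h.symm.idxBij, fun i => h.idxBij_symm_idxBij,
    fun i => h.idxBij_idxBij_symm⟩ _ _ fun i => ?_
  have := h.getElem_idxBij_eq_getElem i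
  simp only [Equiv.coe_fn_mk, List.get_eq_getElem]
  rw [this]

lemma count_multiList {N : ℕ} (α : Fin N → ℕ) (i : Fin N) : (multiList N α).count i = α i := by
  rw [multiList, List.count_flatMap]
  have : (List.count i ∘ fun j => List.replicate (α j) j) = fun j => if j = i then α j else 0 := by
    funext j
    simp [List.count_replicate]
  rw [this]
  simp [← List.ofFn_id, List.map_ofFn, List.sum_ofFn]

lemma itf_basis {N N' : ℕ} {H₁ H₂ : Cn N → Cn N'} {p : Cn N} (h₁ : AnalyticAt ℂ H₁ p)
    (h₂ : AnalyticAt ℂ H₂ p) {t : ℕ}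
    (h : ∀ α : Fin N → ℕ, (∑ i, α i) ≤ t → mderiv α H₁ p = mderiv α H₂ p)
    {k : ℕ} (hk : k ≤ t) (f : Fin k → Fin N) :
    iteratedFDeriv ℂ k H₁ p (fun j => EuclideanSpace.single (f j) (1 : ℂ)) =
    iteratedFDeriv ℂ k H₂ p (fun j => EuclideanSpace.single (f j) (1 : ℂ)) := by
  set α : Fin N → ℕ := fun i => (List.ofFn f).count i with hα
  have hs : ∑ i, α i = k := by
    have := Multiset.sum_count_eq_card (s := Finset.univ) (m := (List.ofFn f : Multiset (Fin N)))
      (fun a _ => Finset.mem_univ a)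
    simpa using this
  have hp : (List.ofFn f).Perm (multiList N α) := by
    rw [List.perm_iff_count]
    intro i
    rw [count_multiList]
  have key : ∀ H : Cn N → Cn N', AnalyticAt ℂ H p →
      iteratedFDeriv ℂ k H p (fun j => EuclideanSpace.single (f j) (1 : ℂ)) = mderiv α H p := by
    intro H hH
    rw [mderiv, ← itf_perm hH hp]
    refine itf_equiv hH (finCongr (by simp)) _ _ fun i => ?_
    simp
  rw [key H₁ h₁, key H₂ h₂]
  exact h α (hs.le.trans hk)

lemma jets_vord {N N' : ℕ} {H₁ H₂ : Cn N → Cn N'} {p : Cn N} (h₁ : AnalyticAt ℂ H₁ p)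
    (h₂ : AnalyticAt ℂ H₂ p) {t : ℕ}
    (h : ∀ α : Fin N → ℕ, (∑ i, α i) ≤ t → mderiv α H₁ p = mderiv α H₂ p) :
    VOrd (fun z => H₁ z - H₂ z) p (t + 1) := by
  have hI : ∀ k ≤ t, iteratedFDeriv ℂ k H₁ p = iteratedFDeriv ℂ k H₂ p := by
    intro k hk
    apply ContinuousMultilinearMap.toMultilinearMap_injective
    refine Module.Basis.ext_multilinear (fun _ => (EuclideanSpace.basisFun (Fin N) ℂ).toBasis) ?_
    intro f
    simpa using itf_basis h₁ h₂ h hk f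
  obtain ⟨q₁, r₁, hq₁⟩ := h₁
  obtain ⟨q₂, r₂, hq₂⟩ := h₂
  have hS : ∀ y, q₁.partialSum (t + 1) y = q₂.partialSum (t + 1) y := by
    intro y
    refine Finset.sum_congr rfl fun k hk => ?_
    have e1 := hq₁.factorial_smul y k
    have e2 := hq₂.factorial_smul y k
    rw [hI k (by simpa [Nat.lt_succ_iff] using hk), ← e2] at e1
    have : ((k.factorial : ℕ) : ℂ) ≠ 0 := by exact_mod_cast k.factorial_ne_zero
    rw [← Nat.cast_smul_eq_nsmul ℂ, ← Nat.cast_smul_eq_nsmul ℂ] at e1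
    exact smul_right_injective _ this e1
  have a1 := hq₁.hasFPowerSeriesAt.isBigO_sub_partialSum_pow (t + 1)
  have a2 := hq₂.hasFPowerSeriesAt.isBigO_sub_partialSum_pow (t + 1)
  have a3 := a1.sub a2
  have ht : Tendsto (fun z : Cn N => z - p) (𝓝 p) (𝓝 0) := by
    have : Tendsto (fun z : Cn N => z - p) (𝓝 p) (𝓝 (p - p)) := tendsto_id.sub_const p
    rwa [sub_self] at this
  refine (a3.comp_tendsto ht).congr (fun z => ?_) fun z => rfl
  simp [hS]
end Jets
end part19

/-- **Finite jet determination.** There is `t₀`, depending only on `(M,p)` and `ℓ`, such that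
two maps of `(M,p)` into a generic submanifold `M'` which are finitely nondegenerate of order
at most `ℓ` at `p` and have the same `t₀`-jet at `p` coincide near `p`. -/
theorem finite_jet_determination
    {N dM : ℕ} (M : Set (Cn N)) (p : Cn N)
    (hM : IsGenericAt M dM p) (hmin : IsMinimalAt M dM p) (ℓ : ℕ) :
    ∃ t₀ : ℕ, ∀ (N' d' : ℕ) (M' : Set (Cn N')) (p' : Cn N'),
      (∀ q ∈ M', IsGenericAt M' d' q) → p' ∈ M' →
      ∀ (H₁ H₂ : Cn N → Cn N') (Ω₁ Ω₂ : Set (Cn N)),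
        IsOpen Ω₁ → p ∈ Ω₁ → DifferentiableOn ℂ H₁ Ω₁ → H₁ p = p' →
        (∀ z ∈ M ∩ Ω₁, H₁ z ∈ M') → FinNondeg M p M' ℓ H₁ →
        IsOpen Ω₂ → p ∈ Ω₂ → DifferentiableOn ℂ H₂ Ω₂ → H₂ p = p' →
        (∀ z ∈ M ∩ Ω₂, H₂ z ∈ M') → FinNondeg M p M' ℓ H₂ →
        (∀ α : Fin N → ℕ, (∑ i, α i) ≤ t₀ → mderiv α H₁ p = mderiv α H₂ p) →
        ∃ V : Set (Cn N), IsOpen V ∧ p ∈ V ∧ ∀ z ∈ V, H₁ z = H₂ z := by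
  obtain ⟨g⟩ := exists_geo hM
  obtain ⟨n, w, hw⟩ := g.minimal_rank hmin
  refine ⟨n * ℓ, ?_⟩
  intro N' d' M' p' _ _ H₁ H₂ Ω₁ Ω₂ o₁ m₁ f₁ e₁ s₁ n₁ o₂ m₂ f₂ e₂ s₂ _ hj
  have h₁ : AnalyticAt ℂ H₁ p := analyticAt_of_diff
    ((o₁.mem_nhds m₁) |> fun h => Filter.mem_of_superset h fun y hy =>
      (f₁ y hy).differentiableAt (o₁.mem_nhds hy))
  have h₂ : AnalyticAt ℂ H₂ p := analyticAt_of_diff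
    ((o₂.mem_nhds m₂) |> fun h => Filter.mem_of_superset h fun y hy =>
      (f₂ y hy).differentiableAt (o₂.mem_nhds hy))
  have k₁ : ∀ᶠ q in 𝓝 p, q ∈ M → H₁ q ∈ M' := by
    filter_upwards [o₁.mem_nhds m₁] with q hq hqM using s₁ q ⟨hqM, hq⟩
  have k₂ : ∀ᶠ q in 𝓝 p, q ∈ M → H₂ q ∈ M' := by
    filter_upwards [o₂.mem_nhds m₂] with q hq hqM using s₂ q ⟨hqM, hq⟩
  have hp := g.prop_core h₁ h₂ (e₂.trans e₁.symm) k₁ k₂ n₁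
  have hz := g.final_zero (h₁.sub h₂) hp hw (jets_vord h₁ h₂ hj)
  obtain ⟨V, hV, hVo, hpV⟩ := eventually_nhds_iff.1 hz
  exact ⟨V, hVo, hpV, fun z hz => sub_eq_zero.1 (hV z hz)⟩

end
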